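/- For every r > 0 there exist constants κ > 0 and N₀ (depending only on h, the choice of the roots z_p, and r) such that the following holds. Let N ≥ N₀ be an integer, let d be a positive integer with d ≤ N^ρ, and let σ ∈ (0,1] satisfy σ > (log N)^{−(log log log N)/4}. Set Y = σ^{−(k+2)} and M = ⌊(N/b_d)^{1/k}⌋. Then for every γ ∈ 𝔪(N, κ/σ, κ/σ^{k+1}) one has | ∑_{1 ≤ m ≤ M, m ∈ W_d(Y)} h_d'(m)·e(h_d(m)γ) | ≤ r·σ·w_d(Y)·N. -/

import Mathlib

/-- `γ(g;p)`: the smallest positive integer `γ` such that the derivative `g'` does not vanish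
identically modulo `p^γ`. -/
noncomputable def gammaExp (g : Polynomial ℤ) (p : ℕ) : ℕ :=
  sInf {c : ℕ | 0 < c ∧ ¬ ∀ n : ℤ, ((p : ℤ) ^ c) ∣ (Polynomial.derivative g).eval n}

/-- `j(g;p)`: the number of residues `s` modulo `p^{γ(g;p)}` with `g'(s) ≡ 0 (mod p^{γ(g;p)})`. -/
noncomputable def jCount (g : Polynomial ℤ) (p : ℕ) : ℕ := by
  classical
  exact ((Finset.range (p ^ gammaExp g p)).filter
    (fun s => ((p : ℤ) ^ gammaExp g p) ∣ (Polynomial.derivative g).eval (s : ℤ))).card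

/-- `∏_{p ≤ Y} (1 - j(g;p)/p^{γ(g;p)})`, the product being over primes `p ≤ Y`. -/
noncomputable def wProd (g : Polynomial ℤ) (Y : ℝ) : ℝ := by
  classical
  exact ∏ p ∈ (Finset.range (⌊Y⌋₊ + 1)).filter Nat.Prime,
    (1 - (jCount g p : ℝ) / (p : ℝ) ^ gammaExp g p)

/-- `W(g;Y) = {n ∈ ℤ : g'(n) ≢ 0 (mod p^{γ(g;p)}) for all primes p ≤ Y}`. -/
def WSet (g : Polynomial ℤ) (Y : ℝ) : Set ℤ :=
  {n : ℤ | ∀ p : ℕ, p.Prime → (p : ℝ) ≤ Y →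
    ¬ ((p : ℤ) ^ gammaExp g p ∣ (Polynomial.derivative g).eval n)}

/-- `W_q(g;Y) = {n ∈ ℤ : g'(n) ≢ 0 (mod p^{γ(g;p)}) for all primes p ≤ Y with p^{γ(g;p)} ∣ q}`. -/
def WqSet (g : Polynomial ℤ) (Y : ℝ) (q : ℕ) : Set ℤ :=
  {n : ℤ | ∀ p : ℕ, p.Prime → (p : ℝ) ≤ Y → p ^ gammaExp g p ∣ q →
    ¬ ((p : ℤ) ^ gammaExp g p ∣ (Polynomial.derivative g).eval n)}
/-- `e(x) = e^{2πix}`. -/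
noncomputable def e (x : ℝ) : ℂ := Complex.exp (2 * Real.pi * Complex.I * x)
/-- The distance from `x` to the nearest integer, i.e. the norm of the image of `x` in
`𝕋 = ℝ/ℤ`. -/
noncomputable def torusNorm (x : ℝ) : ℝ := |x - round x|
/-- The major arcs `𝔐(N,K,Q)`: points of `[0,1) ≅ 𝕋` within `K/N` (in the torus metric) of
some reduced fraction `a/q` with `1 ≤ a ≤ q ≤ Q` and `gcd(a,q) = 1`. -/
def majorArcs (N : ℕ) (K Q : ℝ) : Set ℝ :=
  {γ : ℝ | ∃ q : ℕ, 0 < q ∧ (q : ℝ) ≤ Q ∧ ∃ a : ℕ, 1 ≤ a ∧ a ≤ q ∧ Nat.gcd a q = 1 ∧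
    torusNorm (γ - (a : ℝ) / q) ≤ K / N}

/-- The minor arcs `𝔪(N,K,Q) = 𝕋 ∖ 𝔐(N,K,Q)`, with `𝕋` identified with `[0,1)`. -/
def minorArcs (N : ℕ) (K Q : ℝ) : Set ℝ := Set.Ico 0 1 \ majorArcs N K Q

theorem e_add (x y : ℝ) : e (x + y) = e x * e y := by
  unfold e; rw [← Complex.exp_add]; congr 1; push_cast; ring
theorem e_zero : e 0 = 1 := by simp [e]
theorem e_eq (x : ℝ) : e x = Complex.exp (Complex.I * ((2 * Real.pi * x : ℝ) : ℂ)) := by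
  unfold e; congr 1; push_cast; ring
theorem norm_e (x : ℝ) : ‖e x‖ = 1 := by
  rw [e_eq, mul_comm]; exact Complex.norm_exp_ofReal_mul_I _
theorem e_int (n : ℤ) : e n = 1 := by
  unfold e
  rw [Complex.exp_eq_one_iff]
  exact ⟨n, by push_cast; ring⟩
theorem e_nat (n : ℕ) : e n = 1 := by exact_mod_cast e_int n
theorem e_add_int (x : ℝ) (n : ℤ) : e (x + n) = e x := by rw [e_add, e_int, mul_one]
theorem e_neg (x : ℝ) : e (-x) = (starRingEnd ℂ) (e x) := by
  rw [e_eq, e_eq, ← Complex.exp_conj]; congr 1; rw [map_mul, Complex.conj_ofReal, Complex.conj_I]; push_cast; ring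
theorem e_nsmul (n : ℕ) (x : ℝ) : e (n * x) = e x ^ n := by
  induction n with
  | zero => simp [e_zero]
  | succ n ih => rw [pow_succ, ← ih, ← e_add]; congr 1; push_cast; ring
theorem e_sum {ι : Type*} (s : Finset ι) (f : ι → ℝ) : e (∑ i ∈ s, f i) = ∏ i ∈ s, e (f i) := by
  classical
  induction s using Finset.induction_on with
  | empty => simp [e_zero]
  | insert a s ha ih => rw [Finset.sum_insert ha, Finset.prod_insert ha, e_add, ih]
theorem e_ne_zero (x : ℝ) : e x ≠ 0 := by
  intro h; have := norm_e x; rw [h] at this; simp at this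
theorem e_eq_one_iff (x : ℝ) : e x = 1 ↔ ∃ n : ℤ, x = n := by
  constructor
  · intro h
    unfold e at h
    rw [Complex.exp_eq_one_iff] at h
    obtain ⟨n, hn⟩ := h
    refine ⟨n, ?_⟩
    have h2 : (2 * (Real.pi:ℂ) * Complex.I) ≠ 0 := by simp [Real.pi_ne_zero]
    have : (x:ℂ) = n := by
      apply mul_left_cancel₀ h2; rw [hn]; ring
    exact_mod_cast this
  · rintro ⟨n, rfl⟩; exact e_int n
theorem norm_e_sub_one_le (x : ℝ) : ‖e x - 1‖ ≤ 2 * Real.pi * |x| := by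
  rw [e_eq]
  have := Real.norm_exp_I_mul_ofReal_sub_one_le (x := 2 * Real.pi * x)
  rw [Real.norm_eq_abs, abs_mul, abs_of_pos (by positivity : 0 < 2 * Real.pi)] at this
  exact this
theorem norm_e_sub_e_le (x y : ℝ) : ‖e x - e y‖ ≤ 2 * Real.pi * |x - y| := by
  have : e x - e y = e y * (e (x - y) - 1) := by
    rw [mul_sub, ← e_add]; simp
  rw [this, norm_mul, norm_e, one_mul]; exact norm_e_sub_one_le _
theorem norm_e_taylor (x : ℝ) : ‖e x - 1 - 2 * Real.pi * Complex.I * x‖ ≤ 3 * (2 * Real.pi * |x|) ^ 2 := by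
  have hn : ‖(2 * Real.pi * Complex.I * x : ℂ)‖ = 2 * Real.pi * |x| := by
    simp [abs_of_pos Real.pi_pos]
  by_cases h : 2 * Real.pi * |x| ≤ 1
  · have := Complex.norm_exp_sub_one_sub_id_le (x := 2 * Real.pi * Complex.I * x) (by rw [hn]; exact h)
    rw [hn] at this
    unfold e
    nlinarith [sq_nonneg (2 * Real.pi * |x|)]
  · push Not at h
    have h1 : ‖e x - 1 - 2 * Real.pi * Complex.I * x‖ ≤ ‖e x - 1‖ + 2 * Real.pi * |x| := by
      rw [← hn]; exact norm_sub_le _ _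
    have := norm_e_sub_one_le x
    nlinarith
theorem norm_e_sub_one_ge (x : ℝ) (hx : |x| ≤ 1 / 2) : 4 * |x| ≤ ‖e x - 1‖ := by
  rw [e_eq, Complex.norm_exp_I_mul_ofReal_sub_one]
  have h1 : 2 * Real.pi * x / 2 = Real.pi * x := by ring
  rw [h1, Real.norm_eq_abs, abs_mul]
  have h2 : |Real.sin (Real.pi * x)| = Real.sin (Real.pi * |x|) := by
    rcases abs_cases x with ⟨h, h'⟩ | ⟨h, h'⟩
    · rw [h, abs_of_nonneg]
      apply Real.sin_nonneg_of_nonneg_of_le_pi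
      · positivity
      · rw [h] at hx; nlinarith [Real.pi_pos]
    · rw [h, mul_neg, Real.sin_neg, abs_of_nonpos]
      have : 0 ≤ Real.sin (Real.pi * (-x)) := by
        apply Real.sin_nonneg_of_nonneg_of_le_pi
        · apply mul_nonneg Real.pi_pos.le; linarith
        · rw [h] at hx; nlinarith [Real.pi_pos]
      rw [mul_neg, Real.sin_neg] at this; linarith
  rw [h2]
  have h3 := Real.mul_le_sin (x := Real.pi * |x|) (by positivity) (by nlinarith [Real.pi_pos])
  have h4 : 2 / Real.pi * (Real.pi * |x|) = 2 * |x| := by field_simp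
  rw [h4] at h3
  simp only [abs_two]; linarith
theorem geom_bound (α : ℝ) (L : ℕ) (a : ℤ) (ha : |α - a| ≤ 1 / 2) :
    ‖∑ n ∈ Finset.range L, e (n * α)‖ * (2 * |α - a|) ≤ 1 := by
  have h1 : ∑ n ∈ Finset.range L, e (n * α) = ∑ n ∈ Finset.range L, e (α - a) ^ n := by
    apply Finset.sum_congr rfl; intro n _
    rw [← e_nsmul, ← e_add_int (n * (α - a)) (n * a)]; congr 1; push_cast; ring
  have h2 := geom_sum_mul (e (α - a)) L
  have h3 : ‖∑ n ∈ Finset.range L, e (n * α)‖ * ‖e (α - a) - 1‖ ≤ 2 := by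
    rw [h1, ← norm_mul, h2]
    refine (norm_sub_le _ _).trans ?_
    rw [norm_pow, norm_e]; norm_num
  have h4 := norm_e_sub_one_ge _ ha
  nlinarith [norm_nonneg (∑ n ∈ Finset.range L, e (n * α))]

theorem vino (θ ε T : ℝ) (X : ℕ) (A : Finset ℕ) (hA : ∀ n ∈ A, 1 ≤ n ∧ n ≤ X) (b : ℕ → ℤ)
    (hb : ∀ n ∈ A, |θ * n - b n| ≤ ε) (hT : 1 ≤ T) (hε0 : 0 ≤ ε) (hε : 32 * T * ε ≤ 1)
    (hX : 16 * T < X) (hcard : (X : ℝ) ≤ T * A.card) :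
    ∃ q : ℕ, 1 ≤ q ∧ (q : ℝ) ≤ 8 * T ∧ ∃ a : ℤ, |q * θ - a| ≤ 8 * T ^ 2 * ε / X := by
  have hX0 : 0 < X := by
    have : (0:ℝ) < X := by linarith
    exact_mod_cast this
  have hXr : (0:ℝ) < X := by exact_mod_cast hX0
  obtain ⟨ξ, h1, h2⟩ := Real.exists_rat_abs_sub_le_and_den_le θ (n := 2 * X) (by omega)
  set q := ξ.den with hq
  have hq0 : 0 < q := ξ.den_pos
  have hqr : (0:ℝ) < q := by exact_mod_cast hq0
  have hξ : (ξ : ℝ) * q = ξ.num := by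
    have := Rat.mul_den_eq_num ξ
    exact_mod_cast this
  have hcop : IsCoprime (ξ.num) (q : ℤ) := by
    have := ξ.reduced
    rw [Int.isCoprime_iff_gcd_eq_one]; simpa [Int.gcd, Nat.Coprime] using this
  let r : ℕ → ℤ := fun n => ξ.num * n - q * b n
  have hr : ∀ n ∈ A, |(r n : ℝ)| ≤ q * ε + 1 / 2 := by
    intro n hn
    have hnX : (n:ℝ) ≤ X := by exact_mod_cast (hA n hn).2
    have e1 : (r n : ℝ) = q * ((θ * n - b n) - n * (θ - ξ)) := by
      simp only [r]; push_cast; rw [← hξ]; ring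
    rw [e1, abs_mul, abs_of_pos hqr]
    have e2 : |(θ * n - b n) - n * (θ - ξ)| ≤ ε + n * |θ - ξ| := by
      refine (abs_sub _ _).trans ?_
      rw [abs_mul, Nat.abs_cast]; linarith [hb n hn]
    have e3 : q * (n * |θ - ξ|) ≤ 1 / 2 := by
      have : q * (n * |θ - ξ|) ≤ q * (X * (1 / ((2 * X + 1) * q))) := by
        gcongr
        push_cast at h1; exact h1
      refine this.trans ?_
      have : (q:ℝ) * (X * (1 / ((2 * X + 1) * q))) = X / (2 * X + 1) := by field_simp
      rw [this, div_le_div_iff₀ (by positivity) (by norm_num)]; linarith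
    nlinarith
  have hdiv : ∀ n n' : ℕ, r n = r n' → (q : ℤ) ∣ (n : ℤ) - n' := by
    intro n n' h
    have : (q : ℤ) ∣ ξ.num * ((n : ℤ) - n') := ⟨b n - b n', by simp only [r] at h; linarith⟩
    exact hcop.symm.dvd_of_dvd_mul_left this
  have hq8 : (q : ℝ) ≤ 8 * T := by
    by_contra hcon
    push Not at hcon
    set m := ⌊q * ε + 1 / 2⌋₊ with hm
    have hinj : A.card ≤ ((Finset.range (X / q + 1)) ×ˢ (Finset.Icc (-(m:ℤ)) m)).card := by
      apply Finset.card_le_card_of_injOn (fun n => (n / q, r n))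
      · intro n hn
        have hn' := Finset.mem_coe.mp hn
        simp only [Finset.coe_product, Set.mem_prod, Finset.mem_coe, Finset.mem_range, Finset.mem_Icc]
        refine ⟨Nat.lt_succ_of_le (Nat.div_le_div_right (hA n hn').2), ?_⟩
        have h3 : ((r n).natAbs : ℝ) ≤ q * ε + 1 / 2 := by
          rw [Nat.cast_natAbs]; push_cast; exact hr n hn'
        have := Nat.le_floor h3
        constructor <;> omega
      · intro n hn n' hn' h
        simp only [Prod.mk.injEq] at h
        have h4 := hdiv n n' h.2
        have h5 : n % q = n' % q := by
          have : (n : ℤ) ≡ n' [ZMOD q] := (Int.modEq_iff_dvd.mpr (by simpa using (dvd_neg.mpr h4)))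
          exact (Int.natCast_modEq_iff.mp this)
        rw [← Nat.div_add_mod n q, ← Nat.div_add_mod n' q, h.1, h5]
    rw [Finset.card_product, Finset.card_range, Int.card_Icc] at hinj
    have h6 : ((m:ℤ) + 1 - -(m:ℤ)).toNat = 2 * m + 1 := by omega
    rw [h6] at hinj
    have h7 : (A.card : ℝ) ≤ (X / q + 1) * (2 * (q * ε + 1 / 2) + 1) := by
      have : (A.card : ℝ) ≤ ((X / q : ℕ) + 1) * (2 * m + 1) := by exact_mod_cast hinj
      refine this.trans ?_
      gcongr
      · exact Nat.cast_div_le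
      · exact Nat.floor_le (by positivity)
    have h8 : (X : ℝ) / q ≤ X / (8 * T) := by gcongr
    have h9 : (q : ℝ) ≤ 2 * X := by exact_mod_cast h2
    have h10 : (X / q + 1) * (2 * (q * ε + 1 / 2) + 1) = 2 * ε * X + 2 * (X / q) + 2 * q * ε + 2 := by
      field_simp; ring
    rw [h10] at h7
    have h11 : T * (X / (8 * T)) = X / 8 := by field_simp
    have h12 : T * (A.card : ℝ) ≤ T * (2 * ε * X + 2 * (X / (8 * T)) + 2 * (2 * X) * ε + 2) := by
      gcongr
      refine h7.trans ?_
      gcongr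
    have h13 : T * ε * X ≤ X / 16 := by nlinarith
    nlinarith
  refine ⟨q, hq0, hq8, ξ.num, ?_⟩
  -- there's a large n in A
  obtain ⟨n, hn, hnA⟩ : ∃ n ∈ A, A.card ≤ n := by
    by_contra hcon
    push Not at hcon
    have h0 : 0 < A.card := by
      rcases Nat.eq_zero_or_pos A.card with h | h
      · rw [h] at hcard; simp at hcard; omega
      · exact h
    have : A.card ≤ (Finset.Ico 1 A.card).card := by
      apply Finset.card_le_card
      intro n hn; rw [Finset.mem_Ico]; exact ⟨(hA n hn).1, hcon n hn⟩
    rw [Nat.card_Ico] at this; omega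
  have hrn : r n = 0 := by
    have h3 := hr n hn
    have h4 : |(r n : ℝ)| < 1 := by nlinarith
    have h5 : |r n| < 1 := by exact_mod_cast h4
    exact Int.abs_lt_one_iff.mp h5
  have hnr : (X:ℝ) ≤ T * n := hcard.trans (by gcongr)
  have hn0 : (0:ℝ) < n := by exact_mod_cast (hA n hn).1
  have h3 : (q * θ - ξ.num) * n = q * (θ * n - b n) := by
    have : ((r n : ℤ):ℝ) = 0 := by rw [hrn]; simp
    simp only [r] at this; push_cast at this; linarith
  have h4 : |q * θ - ξ.num| * n ≤ q * ε := by
    rw [← abs_of_pos hn0, ← abs_mul, h3, abs_mul, abs_of_pos hqr]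
    have := hb n hn; gcongr
  rw [le_div_iff₀ hXr]
  calc |q * θ - ξ.num| * X ≤ |q * θ - ξ.num| * (T * n) := by gcongr
    _ = T * (|q * θ - ξ.num| * n) := by ring
    _ ≤ T * (q * ε) := by gcongr
    _ ≤ T * (8 * T * ε) := by gcongr
    _ = _ := by ring

theorem vdc_id (c : ℕ → ℂ) (hc : ∀ n, ‖c n‖ = 1) (L : ℕ) :
    ‖∑ n ∈ Finset.range L, c n‖ ^ 2 = L + 2 * (∑ h ∈ Finset.range L,
      ∑ n ∈ Finset.range (L - (h + 1)), c (n + (h + 1)) * (starRingEnd ℂ) (c n)).re := by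
  induction L with
  | zero => simp
  | succ L ih =>
    have h1 : ∑ h ∈ Finset.range (L + 1), ∑ n ∈ Finset.range (L + 1 - (h + 1)),
        c (n + (h + 1)) * (starRingEnd ℂ) (c n) =
        (∑ h ∈ Finset.range L, ∑ n ∈ Finset.range (L - (h + 1)), c (n + (h + 1)) * (starRingEnd ℂ) (c n))
        + c L * (starRingEnd ℂ) (∑ n ∈ Finset.range L, c n) := by
      rw [Finset.sum_range_succ]
      have : L + 1 - (L + 1) = 0 := by omega
      rw [this, Finset.range_zero, Finset.sum_empty, add_zero, map_sum, Finset.mul_sum,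
        ← Finset.sum_range_reflect (fun n => c L * (starRingEnd ℂ) (c n)), ← Finset.sum_add_distrib]
      apply Finset.sum_congr rfl
      intro h hh
      have hh' := Finset.mem_range.mp hh
      have e1 : L + 1 - (h + 1) = (L - (h + 1)) + 1 := by omega
      rw [e1, Finset.sum_range_succ]
      have e2 : L - (h + 1) + (h + 1) = L := by omega
      have e3 : L - 1 - h = L - (h + 1) := by omega
      rw [e2, e3]
    rw [h1, Finset.sum_range_succ, Complex.add_re, mul_add, ← add_assoc]
    have h2 := Complex.normSq_add (∑ n ∈ Finset.range L, c n) (c L)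
    rw [← Complex.normSq_eq_norm_sq] at ih ⊢
    rw [h2, ih, Complex.normSq_eq_norm_sq, hc]
    have h3 : ((∑ n ∈ Finset.range L, c n) * (starRingEnd ℂ) (c L)).re
        = (c L * (starRingEnd ℂ) (∑ n ∈ Finset.range L, c n)).re := by
      simp only [Complex.mul_re, Complex.conj_re, Complex.conj_im]; ring
    rw [h3]; push_cast; ring

theorem vdc (c : ℕ → ℂ) (hc : ∀ n, ‖c n‖ = 1) (L : ℕ) :
    ‖∑ n ∈ Finset.range L, c n‖ ^ 2 ≤ L + 2 * ∑ h ∈ Finset.range L,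
      ‖∑ n ∈ Finset.range (L - (h + 1)), c (n + (h + 1)) * (starRingEnd ℂ) (c n)‖ := by
  rw [vdc_id c hc]
  gcongr
  exact (Complex.re_le_norm _).trans (norm_sum_le _ _)

open Polynomial in
theorem diff_poly (f : Polynomial ℝ) (k : ℕ) (hf : f.natDegree ≤ k + 1) (h : ℝ) :
    ∃ g : Polynomial ℝ, g.natDegree ≤ k ∧ g.coeff k = (k + 1) * f.coeff (k + 1) * h ∧
      ∀ x, g.eval x = f.eval (x + h) - f.eval x := by
  have hc : ∀ j, (taylor h f).coeff j = ∑ i ∈ Finset.range (k + 2), (i.choose j : ℝ) * f.coeff i * h ^ (i - j) := by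
    intro j
    rw [taylor_coeff, eval_eq_sum_range' (n := k + 2)]
    swap
    · refine lt_of_le_of_lt (natDegree_hasseDeriv_le f j) (by omega)
    simp only [hasseDeriv_coeff]
    have hz : ∀ i, k + 2 ≤ i → f.coeff i = 0 := fun i hi => coeff_eq_zero_of_natDegree_lt (by omega)
    have h1 : ∑ i ∈ Finset.range (k + 2), ((i + j).choose j : ℝ) * f.coeff (i + j) * h ^ i
      = ∑ i ∈ Finset.Ico j (k + 2 + j), (i.choose j : ℝ) * f.coeff i * h ^ (i - j) := by
      rw [Finset.sum_Ico_eq_sum_range]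
      have : k + 2 + j - j = k + 2 := by omega
      rw [this]
      apply Finset.sum_congr rfl; intro i _
      rw [add_comm j i, Nat.add_sub_cancel]
    rw [h1, Finset.sum_subset (s₂ := Finset.range (k + 2 + j))]
    · symm
      apply Finset.sum_subset
      · intro i; simp only [Finset.mem_range]; omega
      · intro i _ hi; rw [hz i (by simpa using hi)]; ring
    · intro i; simp only [Finset.mem_Ico, Finset.mem_range]; omega
    · intro i hi hi'
      simp only [Finset.mem_Ico, Finset.mem_range] at hi hi'
      rw [Nat.choose_eq_zero_of_lt (by omega)]; simp
  refine ⟨taylor h f - f, ?_, ?_, ?_⟩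
  · rw [natDegree_le_iff_coeff_eq_zero]
    intro j hj
    rw [coeff_sub, hc]
    by_cases hj' : j = k + 1
    · subst hj'
      rw [Finset.sum_eq_single (k + 1)]
      · simp
      · intro i hi hne
        rw [Nat.choose_eq_zero_of_lt (by have := Finset.mem_range.mp hi; omega)]; simp
      · simp
    · rw [coeff_eq_zero_of_natDegree_lt (by omega : f.natDegree < j), Finset.sum_eq_zero]
      · simp
      · intro i hi
        rw [Nat.choose_eq_zero_of_lt (by have := Finset.mem_range.mp hi; omega)]; simp
  · rw [coeff_sub, hc, Finset.sum_range_succ, Finset.sum_range_succ, Finset.sum_eq_zero]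
    · simp
    · intro i hi
      rw [Nat.choose_eq_zero_of_lt (by have := Finset.mem_range.mp hi; omega)]; simp
  · intro x
    rw [eval_sub, taylor_eval, add_comm]

set_option maxHeartbeats 1000000 in
theorem weyl (k : ℕ) (hk : 1 ≤ k) : ∃ C : ℕ, 1 ≤ C ∧ ∀ (T : ℝ), 1 ≤ T → ∀ (X L : ℕ), 1 ≤ X → L ≤ X →
    ∀ f : Polynomial ℝ, f.natDegree ≤ k →
    (X : ℝ) ≤ T * ‖∑ n ∈ Finset.range L, e (f.eval (n : ℝ))‖ →
    ∃ q : ℕ, 1 ≤ q ∧ (q : ℝ) ≤ C * T ^ C ∧ ∃ a : ℤ, |q * f.coeff k - a| ≤ C * T ^ C / X ^ k := by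
  induction k, hk using Nat.le_induction with
  | base =>
    refine ⟨1, le_refl _, ?_⟩
    intro T hT X L hX hL f hf hS
    refine ⟨1, le_refl _, by simpa using hT, round (f.coeff 1), ?_⟩
    have hXr : (0:ℝ) < X := by exact_mod_cast hX
    have h1 : ∀ n : ℕ, e (f.eval (n:ℝ)) = e (f.coeff 0) * e (n * f.coeff 1) := by
      intro n
      rw [← e_add, Polynomial.eval_eq_sum_range' (n := 2) (by omega)]
      congr 1
      simp [Finset.sum_range_succ]; ring
    simp_rw [h1] at hS
    rw [← Finset.mul_sum, norm_mul, norm_e, one_mul] at hS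
    have h2 := geom_bound (f.coeff 1) L (round (f.coeff 1)) (abs_sub_round _)
    simp only [Nat.cast_one, one_mul, pow_one]
    rw [le_div_iff₀ hXr]
    have h3 := abs_nonneg (f.coeff 1 - round (f.coeff 1))
    calc _ ≤ |f.coeff 1 - round (f.coeff 1)| * (T * ‖∑ n ∈ Finset.range L, e (n * f.coeff 1)‖) := by gcongr
      _ ≤ T := by nlinarith
  | succ k hk ih =>
    obtain ⟨C, hC, ih⟩ := ih
    set B : ℕ := 256 * C ^ 2 * 8 ^ (2 * C) with hB
    set C' : ℕ := max ((k + 1) * B ^ (k + 1)) ((2 + 4 * C) * (k + 1)) with hC'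
    have hB1 : 1 ≤ B := by rw [hB]; exact Nat.one_le_iff_ne_zero.mpr (by positivity)
    refine ⟨C', ?_, ?_⟩
    · rw [hC']; apply le_max_of_le_right; nlinarith
    intro T hT X L hX hL f hf hS
    have hXr : (1:ℝ) ≤ X := by exact_mod_cast hX
    have hX0 : (0:ℝ) < X := by linarith
    set T1 : ℝ := 8 * T ^ 2 with hT1
    have hT11 : 1 ≤ T1 := by rw [hT1]; nlinarith
    set Q : ℝ := C * T1 ^ C with hQ
    have hCr : (1:ℝ) ≤ C := by exact_mod_cast hC
    have hQ1 : 1 ≤ Q := by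
      rw [hQ]; exact one_le_mul_of_one_le_of_one_le hCr (one_le_pow₀ hT11)
    set Z : ℝ := 32 * T1 * Q ^ 2 with hZ
    have hQ2 : 1 ≤ Q ^ 2 := one_le_pow₀ hQ1
    have hZ1 : 1 ≤ Z := by rw [hZ]; nlinarith
    have hZB : Z = B * T ^ (2 + 4 * C) := by
      rw [hZ, hQ, hT1, hB]; push_cast; ring
    have hZC : (k + 1) * Z ^ (k + 1) ≤ C' * T ^ C' := by
      rw [hZB, mul_pow, ← mul_assoc, ← pow_mul]
      gcongr
      · have : (k + 1) * B ^ (k + 1) ≤ C' := le_max_left _ _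
        exact_mod_cast this
      · exact le_max_right _ _
    have hkr : (1:ℝ) ≤ k + 1 := by linarith [(Nat.cast_nonneg k : (0:ℝ) ≤ k)]
    have hZk : Z ^ (k + 1) ≤ C' * T ^ C' := by
      refine le_trans ?_ hZC
      have : 0 ≤ Z ^ (k + 1) := by positivity
      nlinarith
    by_cases hbig : (X : ℝ) ≤ Z
    · refine ⟨1, le_refl _, ?_, round (f.coeff (k + 1)), ?_⟩
      · simp only [Nat.cast_one]
        exact le_trans (one_le_pow₀ hZ1) hZk
      · rw [le_div_iff₀ (by positivity)]
        simp only [Nat.cast_one, one_mul]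
        refine le_trans ?_ hZk
        have h1 := abs_sub_round (f.coeff (k + 1))
        have h2 : (X:ℝ) ^ (k + 1) ≤ Z ^ (k + 1) := by gcongr
        have h3 : (0:ℝ) ≤ (X:ℝ) ^ (k + 1) := by positivity
        have h4 := abs_nonneg (f.coeff (k + 1) - round (f.coeff (k + 1)))
        nlinarith
    push Not at hbig
    set S : ℕ → ℂ := fun h => ∑ n ∈ Finset.range (L - h), e (f.eval ((n + h : ℕ) : ℝ)) *
      (starRingEnd ℂ) (e (f.eval (n:ℝ))) with hSdef
    have hv := vdc (fun n => e (f.eval (n : ℝ))) (fun n => norm_e _) L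
    have hLr : (L : ℝ) ≤ X := by exact_mod_cast hL
    have hSle : ∀ h, ‖S h‖ ≤ X := by
      intro h
      refine (norm_sum_le _ _).trans ?_
      simp only [norm_mul, norm_e, RCLike.norm_conj, mul_one, Finset.sum_const, Finset.card_range, nsmul_eq_mul]
      refine le_trans ?_ hLr
      exact_mod_cast Nat.sub_le _ _
    have h32 : 32 * T1 ≤ Z := by rw [hZ]; nlinarith
    have hbig1 : 32 * T1 < X := by linarith
    have hsum : (X:ℝ) ^ 2 * 2 ≤ T1 * ∑ h ∈ Finset.range L, ‖S (h + 1)‖ := by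
      have h1 : (X:ℝ) ^ 2 ≤ T ^ 2 * ‖∑ n ∈ Finset.range L, e (f.eval (n : ℝ))‖ ^ 2 := by
        rw [← mul_pow]; gcongr
      have h2 : T ^ 2 * ‖∑ n ∈ Finset.range L, e (f.eval (n : ℝ))‖ ^ 2 ≤
          T ^ 2 * (L + 2 * ∑ h ∈ Finset.range L, ‖S (h + 1)‖) := by gcongr
      have h3 : 8 * T ^ 2 * L ≤ X * X := by
        rw [← hT1]; gcongr; linarith
      rw [hT1]
      nlinarith
    set H := (Finset.Icc 1 L).filter (fun h => (X:ℝ) ≤ T1 * ‖S h‖) with hH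
    have hHcard : (X : ℝ) ≤ T1 * H.card := by
      have h1 : ∑ h ∈ Finset.range L, ‖S (h + 1)‖ = ∑ h ∈ Finset.Icc 1 L, ‖S h‖ := by
        rw [Finset.range_eq_Ico, Finset.sum_Ico_add' (fun h => ‖S h‖)]; rfl
      have h2 : ∑ h ∈ Finset.Icc 1 L, T1 * ‖S h‖ ≤ ∑ h ∈ Finset.Icc 1 L, (X + if (X:ℝ) ≤ T1 * ‖S h‖ then T1 * X else 0) := by
        apply Finset.sum_le_sum
        intro h _
        split_ifs with hh
        · have := hSle h
          have : T1 * ‖S h‖ ≤ T1 * X := by gcongr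
          linarith
        · linarith
      rw [Finset.sum_add_distrib, ← Finset.sum_filter, Finset.sum_const, Finset.sum_const, Nat.card_Icc,
        ← Finset.mul_sum, ← h1] at h2
      simp only [Nat.add_sub_cancel, nsmul_eq_mul] at h2
      have h3 : (L:ℝ) * X ≤ X * X := by gcongr
      have h4 : (X:ℝ) * X ≤ (T1 * H.card) * X := by
        rw [hH]; linarith
      exact le_of_mul_le_mul_right h4 hX0
    have hex : ∀ h ∈ H, ∃ q : ℕ, 1 ≤ q ∧ (q : ℝ) ≤ Q ∧ ∃ a : ℤ,
        |q * ((k + 1) * f.coeff (k + 1) * h) - a| ≤ Q / X ^ k := by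
      intro h hh
      obtain ⟨g, hg1, hg2, hg3⟩ := diff_poly f k hf h
      have hh' := (Finset.mem_filter.mp hh).2
      have := ih T1 hT11 X (L - h) hX (by omega) g hg1 ?_
      · rw [hg2] at this; exact this
      · refine hh'.trans (le_of_eq ?_)
        congr 2
        apply Finset.sum_congr rfl
        intro n _
        rw [hg3, sub_eq_add_neg, e_add, e_neg]; push_cast; rfl
    choose! qq hq1 hq2 aa hqa using hex
    have hQf : 0 < ⌊Q⌋₊ := Nat.floor_pos.mpr hQ1
    obtain ⟨y, hy, hyc⟩ := Finset.exists_le_card_fiber_of_nsmul_le_card_of_maps_to (M := ℝ) (s := H)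
      (t := Finset.Icc 1 ⌊Q⌋₊) (f := qq) (b := (H.card : ℝ) / Q)
      (by intro h hh; rw [Finset.mem_Icc]; exact ⟨hq1 h hh, Nat.le_floor (hq2 h hh)⟩)
      (by rw [Finset.nonempty_Icc]; omega)
      (by
        rw [Nat.card_Icc, nsmul_eq_mul, Nat.add_sub_cancel]
        rw [mul_div_assoc', div_le_iff₀ (by linarith)]
        rw [mul_comm]; gcongr; exact Nat.floor_le (by linarith))
    rw [Finset.mem_Icc] at hy
    have hyQ : (y:ℝ) ≤ Q := (Nat.le_floor_iff (by linarith)).mp hy.2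
    set A := H.filter (fun h => qq h = y) with hA
    have hkX : (X:ℝ) ≤ X ^ k := by
      calc (X:ℝ) = X ^ 1 := by simp
        _ ≤ X ^ k := pow_le_pow_right₀ hXr hk
    obtain ⟨q', hq'1, hq'2, a', ha'⟩ := vino (y * ((k + 1) * f.coeff (k + 1))) (Q / X ^ k) (T1 * Q) X A
      (by
        intro n hn
        have := (Finset.mem_filter.mp (Finset.mem_filter.mp hn).1).1
        rw [Finset.mem_Icc] at this
        exact ⟨this.1, this.2.trans hL⟩)
      aa
      (by
        intro n hn
        have hn' := Finset.mem_filter.mp hn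
        have := hqa n hn'.1
        rw [hn'.2] at this
        rw [mul_assoc (y:ℝ)]; exact this)
      (by nlinarith) (by positivity)
      (by
        rw [mul_div_assoc', div_le_one (by positivity)]
        refine le_trans (le_of_eq ?_) (hbig.le.trans hkX)
        rw [hZ]; ring)
      (by
        refine lt_of_le_of_lt ?_ hbig
        rw [hZ]
        have h1 : Q ≤ Q ^ 2 := by nlinarith
        have h2 : T1 * Q ≤ T1 * Q ^ 2 := by gcongr
        have h3 : 0 ≤ T1 * Q ^ 2 := by positivity
        linarith)
      (by
        have h1 : (H.card : ℝ) ≤ A.card * Q := by rwa [div_le_iff₀ (by linarith)] at hyc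
        refine hHcard.trans ?_
        have h2 : T1 * H.card ≤ T1 * (A.card * Q) := by gcongr
        linarith)
    refine ⟨q' * y * (k + 1), ?_, ?_, a', ?_⟩
    · have := hy.1
      exact Nat.one_le_iff_ne_zero.mpr (by positivity)
    · push_cast
      have h1 : (q':ℝ) * y ≤ Z := by
        calc (q':ℝ) * y ≤ (8 * (T1 * Q)) * Q := by gcongr
          _ ≤ Z := by rw [hZ]; nlinarith
      have h2 : Z ≤ Z ^ (k + 1) := le_self_pow₀ hZ1 (by omega)
      refine le_trans ?_ hZC
      nlinarith
    · have h1 : ((q' * y * (k + 1) : ℕ) : ℝ) * f.coeff (k + 1) - a' = q' * (y * ((k + 1) * f.coeff (k + 1))) - a' := by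
        push_cast; ring
      rw [h1]
      refine ha'.trans ?_
      rw [mul_div_assoc', div_div, ← pow_succ]
      refine div_le_div_of_nonneg_right ?_ (by positivity)
      have h2 : Z ^ 2 ≤ Z ^ (k + 1) := pow_le_pow_right₀ hZ1 (by omega)
      refine le_trans ?_ (h2.trans hZk)
      rw [hZ]
      have h3 : Q ^ 3 ≤ Q ^ 4 := pow_le_pow_right₀ hQ1 (by norm_num)
      have h4 : 0 ≤ T1 ^ 2 * Q ^ 4 := by positivity
      have h5 : T1 ^ 2 * Q ^ 3 ≤ T1 ^ 2 * Q ^ 4 := by gcongr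
      calc _ = 8 * (T1 ^ 2 * Q ^ 3) := by ring
        _ ≤ 1024 * (T1 ^ 2 * Q ^ 4) := by linarith
        _ = _ := by ring

noncomputable def pmean (u : ℕ → ℂ) (R : ℕ) : ℂ := (∑ m ∈ Finset.range R, u m) / R

theorem per_sum_mul (u : ℕ → ℂ) (R n : ℕ) (hu : Function.Periodic u R) :
    ∑ m ∈ Finset.range (R * n), u m = n * ∑ m ∈ Finset.range R, u m := by
  induction n with
  | zero => simp
  | succ n ih =>
    rw [Nat.mul_succ, Finset.sum_range_add, ih]
    have : ∀ x, u (R * n + x) = u x := by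
      intro x; rw [add_comm, mul_comm]; exact hu.nat_mul n x
    simp_rw [this]; push_cast; ring

theorem pmean_mul_right (u : ℕ → ℂ) (R n : ℕ) (hn : 0 < n) (hu : Function.Periodic u R) :
    pmean u (R * n) = pmean u R := by
  unfold pmean
  rw [per_sum_mul u R n hu]
  have : (n:ℂ) ≠ 0 := by exact_mod_cast hn.ne'
  push_cast
  rw [mul_comm (R:ℂ), mul_div_mul_left _ _ this]

theorem per_mod (u : ℕ → ℂ) (R : ℕ) (hu : Function.Periodic u R) (m : ℕ) : u (m % R) = u m :=
  hu.map_mod_nat m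

theorem pmean_mul (f g : ℕ → ℂ) (a b : ℕ) (hab : a.Coprime b) (ha : 0 < a) (hb : 0 < b)
    (hf : Function.Periodic f a) (hg : Function.Periodic g b) :
    pmean (fun m => f m * g m) (a * b) = pmean f a * pmean g b := by
  unfold pmean
  have h1 : ∑ m ∈ Finset.range (a * b), f m * g m
      = ∑ x ∈ Finset.range a ×ˢ Finset.range b, f x.1 * g x.2 := by
    refine Finset.sum_nbij' (fun m => (m % a, m % b))
      (fun x => (Nat.chineseRemainder hab x.1 x.2 : ℕ)) ?_ ?_ ?_ ?_ ?_
    · intro m _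
      simp only [Finset.mem_product, Finset.mem_range]
      exact ⟨Nat.mod_lt _ ha, Nat.mod_lt _ hb⟩
    · intro x _
      simp only [Finset.mem_range]
      exact Nat.chineseRemainder_lt_mul hab x.1 x.2 ha.ne' hb.ne'
    · intro m hm
      have h2 := Nat.chineseRemainder_lt_mul hab (m % a) (m % b) ha.ne' hb.ne'
      have h3 := (Nat.chineseRemainder hab (m % a) (m % b)).2
      have h4 : (Nat.chineseRemainder hab (m % a) (m % b) : ℕ) ≡ m [MOD a * b] := by
        rw [← Nat.modEq_and_modEq_iff_modEq_mul hab]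
        exact ⟨h3.1.trans (Nat.mod_modEq _ _), h3.2.trans (Nat.mod_modEq _ _)⟩
      exact Nat.ModEq.eq_of_lt_of_lt h4 h2 (Finset.mem_range.mp hm)
    · intro x hx
      simp only [Finset.mem_product, Finset.mem_range] at hx
      have h3 := (Nat.chineseRemainder hab x.1 x.2).2
      ext
      · have := h3.1; unfold Nat.ModEq at this; simp only; rw [this, Nat.mod_eq_of_lt hx.1]
      · have := h3.2; unfold Nat.ModEq at this; simp only; rw [this, Nat.mod_eq_of_lt hx.2]
    · intro m _
      simp only [per_mod f a hf, per_mod g b hg]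
  rw [h1, Finset.sum_product]
  simp only []
  rw [← Finset.sum_mul_sum]
  push_cast
  rw [mul_div_mul_comm]

theorem periodic_of_dvd (u : ℕ → ℂ) (a b : ℕ) (hu : Function.Periodic u a) (h : a ∣ b) :
    Function.Periodic u b := by
  obtain ⟨c, rfl⟩ := h
  rw [mul_comm]; exact hu.nat_mul c

theorem pmean_eq_of_dvd (u : ℕ → ℂ) (a b : ℕ) (hu : Function.Periodic u a) (h : a ∣ b) (hb : 0 < b) :
    pmean u b = pmean u a := by
  obtain ⟨c, rfl⟩ := h
  exact pmean_mul_right u a c (Nat.pos_of_mul_pos_left hb) hu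

theorem periodic_prod (T : Finset ℕ) (f : ℕ → ℕ → ℂ) (q : ℕ → ℕ)
    (hf : ∀ p ∈ T, Function.Periodic (f p) (q p)) :
    Function.Periodic (fun m => ∏ p ∈ T, f p m) (∏ p ∈ T, q p) := by
  intro m
  apply Finset.prod_congr rfl
  intro p hp
  exact periodic_of_dvd _ _ _ (hf p hp) (Finset.dvd_prod_of_mem q hp) m

theorem pmean_prod (T : Finset ℕ) (f : ℕ → ℕ → ℂ) (q : ℕ → ℕ) (hq : ∀ p ∈ T, 0 < q p)
    (hf : ∀ p ∈ T, Function.Periodic (f p) (q p))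
    (hco : ∀ p ∈ T, ∀ p' ∈ T, p ≠ p' → (q p).Coprime (q p')) :
    pmean (fun m => ∏ p ∈ T, f p m) (∏ p ∈ T, q p) = ∏ p ∈ T, pmean (f p) (q p) := by
  classical
  induction T using Finset.induction_on with
  | empty => simp [pmean]
  | insert a T ha ih =>
    rw [Finset.prod_insert ha, Finset.prod_insert ha]
    rw [← ih (fun p hp => hq p (Finset.mem_insert_of_mem hp))
      (fun p hp => hf p (Finset.mem_insert_of_mem hp))
      (fun p hp p' hp' => hco p (Finset.mem_insert_of_mem hp) p' (Finset.mem_insert_of_mem hp'))]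
    rw [← pmean_mul]
    · congr 1; funext m; rw [Finset.prod_insert ha]
    · apply Nat.Coprime.prod_right
      intro p hp
      exact hco a (Finset.mem_insert_self _ _) p (Finset.mem_insert_of_mem hp)
        (fun h => ha (h ▸ hp))
    · exact hq a (Finset.mem_insert_self _ _)
    · exact Finset.prod_pos fun p hp => hq p (Finset.mem_insert_of_mem hp)
    · exact hf a (Finset.mem_insert_self _ _)
    · exact periodic_prod T f q fun p hp => hf p (Finset.mem_insert_of_mem hp)

theorem norm_pmean_le (u : ℕ → ℂ) (R : ℕ) (v : ℕ → ℝ) (h : ∀ m, ‖u m‖ ≤ v m) :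
    ‖pmean u R‖ ≤ (∑ m ∈ Finset.range R, v m) / R := by
  unfold pmean
  rw [norm_div, Complex.norm_natCast]
  gcongr
  exact (norm_sum_le _ _).trans (Finset.sum_le_sum fun m _ => h m)

theorem norm_pmean_le_one (u : ℕ → ℂ) (R : ℕ) (h : ∀ m, ‖u m‖ ≤ 1) : ‖pmean u R‖ ≤ 1 := by
  refine (norm_pmean_le u R (fun _ => 1) h).trans ?_
  simp only [Finset.sum_const, Finset.card_range, nsmul_eq_mul, mul_one]
  exact div_self_le_one _

theorem partial_sum (u : ℕ → ℂ) (R : ℕ) (hR : 0 < R) (hu : Function.Periodic u R)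
    (h1 : ∀ m, ‖u m‖ ≤ 1) (x : ℕ) :
    ‖∑ m ∈ Finset.range x, u m - x * pmean u R‖ ≤ 2 * R := by
  have hRc : (R:ℂ) ≠ 0 := by exact_mod_cast hR.ne'
  have e1 : ∑ m ∈ Finset.range x, u m = (x / R : ℕ) * ∑ m ∈ Finset.range R, u m
      + ∑ m ∈ Finset.range (x % R), u m := by
    conv_lhs => rw [← Nat.div_add_mod x R]
    rw [Finset.sum_range_add, per_sum_mul u R _ hu]
    congr 1
    apply Finset.sum_congr rfl
    intro m _
    rw [add_comm, mul_comm]; exact hu.nat_mul _ m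
  have e2 : (x:ℂ) * pmean u R = (x / R : ℕ) * ∑ m ∈ Finset.range R, u m + (x % R : ℕ) * pmean u R := by
    conv_lhs => rw [← Nat.div_add_mod x R]
    unfold pmean
    push_cast
    field_simp
  rw [e1, e2, add_sub_add_left_eq_sub]
  have hm : ((x % R : ℕ):ℝ) ≤ R := by exact_mod_cast (Nat.mod_lt x hR).le
  refine (norm_sub_le _ _).trans ?_
  have e3 : ‖∑ m ∈ Finset.range (x % R), u m‖ ≤ R := by
    refine (norm_sum_le _ _).trans ((Finset.sum_le_sum fun m _ => h1 m).trans ?_)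
    simpa using hm
  have e4 : ‖((x % R : ℕ):ℂ) * pmean u R‖ ≤ R := by
    rw [norm_mul, Complex.norm_natCast]
    have := norm_pmean_le_one u R h1
    have h0 := norm_nonneg (pmean u R)
    nlinarith [(Nat.cast_nonneg (x % R) : (0:ℝ) ≤ ((x % R : ℕ):ℝ))]
  linarith

theorem partial_sum' (u : ℕ → ℂ) (R : ℕ) (hR : 0 < R) (hu : Function.Periodic u R)
    (h1 : ∀ m, ‖u m‖ ≤ 1) (x : ℕ) :
    ‖∑ m ∈ Finset.Icc 1 x, (u m - pmean u R)‖ ≤ 4 * R := by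
  have e1 : ∑ m ∈ Finset.Icc 1 x, (u m - pmean u R) =
      (∑ m ∈ Finset.range (x + 1), u m - ((x + 1 : ℕ):ℂ) * pmean u R) - (u 0 - pmean u R) := by
    have : Finset.range (x + 1) = insert 0 (Finset.Icc 1 x) := by
      ext m; simp only [Finset.mem_range, Finset.mem_insert, Finset.mem_Icc]; omega
    rw [this, Finset.sum_insert (by simp), Finset.sum_sub_distrib]
    simp; ring
  rw [e1]
  refine (norm_sub_le _ _).trans ?_
  have h2 := partial_sum u R hR hu h1 (x + 1)
  have h3 : ‖u 0 - pmean u R‖ ≤ 2 := by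
    refine (norm_sub_le _ _).trans ?_
    linarith [h1 0, norm_pmean_le_one u R h1]
  have : (1:ℝ) ≤ R := by exact_mod_cast hR
  linarith

theorem abel_id (a F : ℕ → ℂ) (M : ℕ) :
    ∑ m ∈ Finset.Icc 1 M, a m * F m = (∑ m ∈ Finset.Icc 1 M, a m) * F M
      - ∑ m ∈ Finset.Ico 1 M, (∑ i ∈ Finset.Icc 1 m, a i) * (F (m + 1) - F m) := by
  induction M with
  | zero => simp
  | succ M ih =>
    rw [Finset.sum_Icc_succ_top (by omega), ih, Finset.sum_Icc_succ_top (by omega)]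
    rcases Nat.eq_zero_or_pos M with h | h
    · subst h; simp
    · rw [Finset.sum_Ico_succ_top (by omega)]; ring

theorem abel_bound (a F : ℕ → ℂ) (M : ℕ) (E : ℝ) (h : ∀ x ≤ M, ‖∑ m ∈ Finset.Icc 1 x, a m‖ ≤ E) :
    ‖∑ m ∈ Finset.Icc 1 M, a m * F m‖ ≤ E * (‖F M‖ + ∑ m ∈ Finset.Ico 1 M, ‖F (m + 1) - F m‖) := by
  rw [abel_id]
  refine (norm_sub_le _ _).trans ?_
  rw [mul_add, norm_mul, Finset.mul_sum]
  gcongr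
  · exact h M le_rfl
  · refine (norm_sum_le _ _).trans (Finset.sum_le_sum ?_)
    intro m hm
    rw [norm_mul]
    gcongr
    exact h m (Finset.mem_Ico.mp hm).2.le

open scoped Classical in
theorem bonf (P : Finset ℕ) (bad : ℕ → Prop) (t : ℕ) (ht : 1 ≤ t) :
    |(if ∀ p ∈ P, ¬ bad p then (1:ℝ) else 0) -
      ∑ S ∈ P.powerset.filter (fun S => S.card < t), (-1 : ℝ) ^ S.card * (if ∀ p ∈ S, bad p then 1 else 0)|
    ≤ ∑ S ∈ P.powersetCard t, (if ∀ p ∈ S, bad p then (1:ℝ) else 0) := by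
  set B := P.filter bad with hB
  have hcount : ∀ i, ∑ S ∈ P.powersetCard i, (if ∀ p ∈ S, bad p then (1:ℝ) else 0) = (B.card.choose i : ℝ) := by
    intro i
    rw [← Finset.card_powersetCard, Finset.sum_boole]
    congr 2
    ext S
    simp only [Finset.mem_filter, Finset.mem_powersetCard, hB]
    constructor
    · rintro ⟨⟨h1, h2⟩, h3⟩
      exact ⟨fun p hp => Finset.mem_filter.mpr ⟨h1 hp, h3 p hp⟩, h2⟩
    · rintro ⟨h1, h2⟩
      exact ⟨⟨fun p hp => (Finset.mem_filter.mp (h1 hp)).1, h2⟩, fun p hp => (Finset.mem_filter.mp (h1 hp)).2⟩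
  have hsum : ∑ S ∈ P.powerset.filter (fun S => S.card < t), (-1 : ℝ) ^ S.card * (if ∀ p ∈ S, bad p then 1 else 0)
      = ∑ i ∈ Finset.range t, (-1 : ℝ) ^ i * (B.card.choose i : ℝ) := by
    rw [← Finset.sum_fiberwise_of_maps_to (s := P.powerset.filter (fun S => S.card < t))
      (t := Finset.range t) (g := Finset.card) (by intro S hS; simpa using (Finset.mem_filter.mp hS).2)]
    apply Finset.sum_congr rfl
    intro i hi
    rw [← hcount, Finset.mul_sum]
    have : (P.powerset.filter (fun S => S.card < t)).filter (fun S => S.card = i) = P.powersetCard i := by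
      ext S
      simp only [Finset.mem_filter, Finset.mem_powerset, Finset.mem_powersetCard]
      have := Finset.mem_range.mp hi
      constructor
      · rintro ⟨⟨h1, _⟩, h2⟩; exact ⟨h1, h2⟩
      · rintro ⟨h1, h2⟩; exact ⟨⟨h1, by omega⟩, h2⟩
    rw [this]
    apply Finset.sum_congr rfl
    intro S hS
    rw [(Finset.mem_powersetCard.mp hS).2]
  rw [hsum, hcount]
  obtain ⟨t, rfl⟩ : ∃ s, t = s + 1 := ⟨t - 1, by omega⟩
  by_cases hb : ∀ p ∈ P, ¬ bad p
  · have : B = ∅ := by rw [hB, Finset.filter_eq_empty_iff]; intro p hp; exact hb p hp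
    rw [if_pos hb, this, Finset.sum_range_succ']
    simp
  · have hB0 : B.card ≠ 0 := by
      rw [Finset.card_ne_zero]
      push Not at hb
      obtain ⟨p, hp, hp'⟩ := hb
      exact ⟨p, Finset.mem_filter.mpr ⟨hp, hp'⟩⟩
    rw [if_neg hb, zero_sub, abs_neg]
    obtain ⟨n, hn⟩ : ∃ n, B.card = n + 1 := ⟨B.card - 1, by omega⟩
    rw [hn]
    have h1 : ∑ i ∈ Finset.range (t + 1), (-1:ℤ) ^ i * ((n + 1).choose i : ℤ) = (-1) ^ t * (n.choose t : ℤ) :=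
      Int.alternating_sum_range_choose_eq_choose
    have h2 : ∑ i ∈ Finset.range (t + 1), (-1 : ℝ) ^ i * ((n + 1).choose i : ℝ) = (-1) ^ t * (n.choose t : ℝ) := by
      exact_mod_cast congrArg (Int.cast : ℤ → ℝ) h1
    rw [h2, abs_mul, abs_pow, abs_neg, abs_one, one_pow, one_mul, Nat.abs_cast]
    have h3 : n.choose t ≤ (n + 1).choose (t + 1) := by
      rw [Nat.choose_succ_succ]; omega
    exact_mod_cast h3

theorem rankin (P : Finset ℕ) (x : ℕ → ℝ) (hx : ∀ p ∈ P, 0 ≤ x p) (t : ℕ) :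
    ∑ S ∈ P.powersetCard t, ∏ p ∈ S, x p ≤ Real.exp (-(2 * t)) * Real.exp (8 * ∑ p ∈ P, x p) := by
  have h1 : ∑ S ∈ P.powersetCard t, ∏ p ∈ S, (Real.exp 2 * x p) ≤ ∏ p ∈ P, (1 + Real.exp 2 * x p) := by
    rw [Finset.prod_one_add]
    apply Finset.sum_le_sum_of_subset_of_nonneg
    · intro S hS; rw [Finset.mem_powerset]; exact (Finset.mem_powersetCard.mp hS).1
    · intro S hS _
      apply Finset.prod_nonneg
      intro p hp
      have := hx p (Finset.mem_powerset.mp hS hp)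
      positivity
  have h2 : ∑ S ∈ P.powersetCard t, ∏ p ∈ S, (Real.exp 2 * x p) =
      Real.exp (2 * t) * ∑ S ∈ P.powersetCard t, ∏ p ∈ S, x p := by
    rw [Finset.mul_sum]
    apply Finset.sum_congr rfl
    intro S hS
    rw [Finset.prod_mul_distrib, Finset.prod_const, (Finset.mem_powersetCard.mp hS).2, ← Real.exp_nat_mul]
    ring_nf
  have h3 : ∏ p ∈ P, (1 + Real.exp 2 * x p) ≤ Real.exp (8 * ∑ p ∈ P, x p) := by
    rw [Finset.mul_sum, Real.exp_sum]
    apply Finset.prod_le_prod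
    · intro p hp; have := hx p hp; positivity
    · intro p hp
      have h4 := hx p hp
      have h5 := Real.add_one_le_exp (8 * x p)
      have h6 : Real.exp 2 ≤ 8 := by
        have : Real.exp 2 = Real.exp 1 ^ 2 := by rw [← Real.exp_nat_mul]; norm_num
        rw [this]
        have := Real.exp_one_lt_d9
        have := Real.exp_pos 1
        nlinarith
      nlinarith
  rw [h2] at h1
  rw [Real.exp_neg, ← div_eq_inv_mul, le_div_iff₀ (Real.exp_pos _), mul_comm]
  linarith

def Good (k C : ℕ) (g : Polynomial ℤ) : Prop :=
  g.natDegree = k ∧ 0 < g.leadingCoeff ∧ (∀ i, |g.coeff i| ≤ C * g.leadingCoeff) ∧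
  ∀ p : ℕ, p.Prime → ∀ (j : ℕ) (K : ℤ), (∀ i, 1 ≤ i → (p:ℤ) ^ j ∣ K * g.coeff i) → (p:ℤ) ^ j ∣ K * C

def vdm (k : ℕ) (s : Fin k → ℤ) : ℤ := ∏ i : Fin k, ∏ j ∈ Finset.Ioi i, (s j - s i)

theorem vdm_dvd (k : ℕ) (f : Polynomial ℤ) (hf : f.natDegree < k) (s : Fin k → ℤ) (D : ℤ)
    (hD : ∀ i, D ∣ f.eval (s i)) (i : ℕ) : D ∣ vdm k s * f.coeff i := by
  by_cases hi : i < k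
  · have h1 : (Matrix.vandermonde s).mulVec (fun j : Fin k => f.coeff j) = fun j => f.eval (s j) := by
      funext j
      rw [Polynomial.eval_eq_sum_range' hf, Matrix.mulVec, dotProduct, ← Fin.sum_univ_eq_sum_range (fun l => f.coeff l * s j ^ l)]
      simp [Matrix.vandermonde_apply, mul_comm]
    have h2 : (Matrix.vandermonde s).adjugate.mulVec (fun j => f.eval (s j)) =
        fun j : Fin k => vdm k s * f.coeff j := by
      rw [← h1, Matrix.mulVec_mulVec, Matrix.adjugate_mul, Matrix.det_vandermonde, Matrix.smul_mulVec, Matrix.one_mulVec]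
      rfl
    have h3 := congrFun h2 ⟨i, hi⟩
    simp only at h3
    rw [← h3, Matrix.mulVec, dotProduct]
    exact Finset.dvd_sum fun j _ => Dvd.dvd.mul_left (hD j) _
  · rw [Polynomial.coeff_eq_zero_of_natDegree_lt (by omega)]; simp

theorem good_vdm {k C : ℕ} {g : Polynomial ℤ} (hk : 1 ≤ k) (hg : Good k C g) {p : ℕ} (hp : p.Prime) (j : ℕ)
    (s : Fin k → ℤ) (hs : ∀ i, (p:ℤ) ^ j ∣ (Polynomial.derivative g).eval (s i)) :
    (p:ℤ) ^ j ∣ vdm k s * ((k.factorial * C : ℕ) : ℤ) := by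
  have hd : (Polynomial.derivative g).natDegree < k := by
    have := Polynomial.natDegree_derivative_le g
    rw [hg.1] at this; omega
  have h1 := hg.2.2.2 p hp j (vdm k s * (k.factorial : ℤ)) ?_
  · push_cast; rw [← mul_assoc]; exact h1
  · intro i hi
    by_cases hik : i ≤ k
    · have h2 := vdm_dvd k _ hd s _ hs (i - 1)
      rw [Polynomial.coeff_derivative] at h2
      have h3 : i - 1 + 1 = i := by omega
      rw [h3] at h2
      have h4 : ((i - 1 : ℕ) : ℤ) + 1 = i := by exact_mod_cast h3
      rw [h4] at h2
      obtain ⟨c, hc⟩ : (i:ℤ) ∣ (k.factorial : ℤ) := by exact_mod_cast Nat.dvd_factorial hi hik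
      rw [hc]
      have : vdm k s * (i * c) * g.coeff i = vdm k s * (g.coeff i * i) * c := by ring
      rw [this]; exact Dvd.dvd.mul_right h2 _
    · rw [Polynomial.coeff_eq_zero_of_natDegree_lt (by rw [hg.1]; omega)]; simp

theorem strip1 {p : ℕ} (hp : p.Prime) (i j : ℕ) (x A : ℤ) (hx : ¬ (p:ℤ) ^ (i + 1) ∣ x)
    (h : (p:ℤ) ^ j ∣ x * A) : (p:ℤ) ^ j ∣ (p:ℤ) ^ i * A := by
  have hpz : Prime (p:ℤ) := Nat.prime_iff_prime_int.mp hp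
  have hx0 : x ≠ 0 := by rintro rfl; simp at hx
  obtain ⟨n, y, hy, rfl⟩ := WfDvdMonoid.max_power_factor hx0 hpz.irreducible
  have hn : n ≤ i := by
    by_contra hn
    exact hx (Dvd.dvd.mul_right (pow_dvd_pow _ (by omega)) _)
  have h1 : IsCoprime ((p:ℤ) ^ j) y := (hpz.coprime_iff_not_dvd.mpr hy).pow_left
  have h2 : (p:ℤ) ^ j ∣ (p:ℤ) ^ n * A := by
    apply h1.dvd_of_dvd_mul_left
    rwa [← mul_assoc, mul_comm y]
  refine h2.trans (mul_dvd_mul (pow_dvd_pow _ hn) dvd_rfl)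

theorem strip {p : ℕ} (hp : p.Prime) (i j : ℕ) {ι : Type*} (T : Finset ι) (x : ι → ℤ) :
    ∀ A : ℤ, (∀ t ∈ T, ¬ (p:ℤ) ^ (i + 1) ∣ x t) →
    (p:ℤ) ^ j ∣ (∏ t ∈ T, x t) * A → (p:ℤ) ^ j ∣ (p:ℤ) ^ (i * T.card) * A := by
  classical
  induction T using Finset.induction_on with
  | empty => intro A _ h; simpa using h
  | insert a T ha ih =>
    intro A hx h
    rw [Finset.prod_insert ha] at h
    rw [mul_assoc] at h
    have h1 := strip1 hp i j _ _ (hx a (Finset.mem_insert_self _ _)) h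
    rw [mul_left_comm] at h1
    have h2 := ih _ (fun t ht => hx t (Finset.mem_insert_of_mem ht)) h1
    rw [Finset.card_insert_of_notMem ha, mul_add, pow_add]
    rw [← mul_assoc] at h2
    simpa using h2

noncomputable def Kp (k C : ℕ) : ℕ := (vdm k (fun i => (i:ℤ))).natAbs * (k.factorial * C)

theorem vdm_ne (k : ℕ) (s : Fin k → ℤ) (hs : Function.Injective s) : vdm k s ≠ 0 := by
  unfold vdm
  rw [Finset.prod_ne_zero_iff]
  intro i _
  rw [Finset.prod_ne_zero_iff]
  intro j hj h
  have := hs (sub_eq_zero.mp h)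
  rw [this] at hj
  simp at hj

theorem Kp_pos (k C : ℕ) (hC : 1 ≤ C) : 1 ≤ Kp k C := by
  unfold Kp
  have h1 := vdm_ne k (fun i => (i:ℤ)) (by intro a b h; exact Fin.ext (by simp only at h; exact_mod_cast h))
  have h2 : 0 < (vdm k (fun i => (i:ℤ))).natAbs := Int.natAbs_pos.mpr h1
  have := Nat.factorial_pos k
  exact Nat.mul_pos h2 (Nat.mul_pos this hC)

theorem good_Kp {k C : ℕ} {g : Polynomial ℤ} (hk : 1 ≤ k) (hg : Good k C g) {p : ℕ} (hp : p.Prime) (j : ℕ)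
    (hs : ∀ n : ℤ, (p:ℤ) ^ j ∣ (Polynomial.derivative g).eval n) : p ^ j ∣ Kp k C := by
  have := good_vdm hk hg hp j (fun i => (i:ℤ)) (fun i => hs _)
  rw [← Int.natAbs_dvd_natAbs, Int.natAbs_mul, Int.natAbs_natCast] at this
  unfold Kp; simpa [Int.natAbs_pow] using this

theorem gamma_set {k C : ℕ} {g : Polynomial ℤ} (hk : 1 ≤ k) (hC : 1 ≤ C) (hg : Good k C g) {p : ℕ} (hp : p.Prime) :
    1 ≤ gammaExp g p ∧ (∃ n : ℤ, ¬ (p:ℤ) ^ gammaExp g p ∣ (Polynomial.derivative g).eval n) ∧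
      p ^ (gammaExp g p - 1) ∣ Kp k C := by
  have hne : {c : ℕ | 0 < c ∧ ¬ ∀ n : ℤ, ((p : ℤ) ^ c) ∣ (Polynomial.derivative g).eval n}.Nonempty := by
    refine ⟨Kp k C, Kp_pos k C hC, fun h => ?_⟩
    have h1 := Nat.le_of_dvd (Kp_pos k C hC) (good_Kp hk hg hp _ h)
    have := Nat.lt_pow_self (n := Kp k C) hp.one_lt
    omega
  have hmem := Nat.sInf_mem hne
  have hlt : ∀ c < gammaExp g p, 0 < c → ∀ n : ℤ, ((p : ℤ) ^ c) ∣ (Polynomial.derivative g).eval n := by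
    intro c hc hc0
    by_contra h
    exact Nat.notMem_of_lt_sInf hc ⟨hc0, h⟩
  change 0 < gammaExp g p ∧ ¬ ∀ n : ℤ, ((p : ℤ) ^ gammaExp g p) ∣ (Polynomial.derivative g).eval n at hmem
  refine ⟨hmem.1, by simpa using hmem.2, ?_⟩
  rcases Nat.eq_zero_or_pos (gammaExp g p - 1) with h | h
  · rw [h]; simp
  · exact good_Kp hk hg hp _ (hlt _ (by omega) h)

open scoped Classical in
theorem prop_count {k C : ℕ} {g : Polynomial ℤ} (hk : 1 ≤ k) (hg : Good k C g) {p : ℕ} (hp : p.Prime)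
    (i j : ℕ) (hj : ¬ p ^ j ∣ p ^ (i * (k * k)) * (k.factorial * C)) :
    ((Finset.range (p ^ (i + 1))).filter (fun s : ℕ => ∃ t : ℤ, t ≡ (s:ℤ) [ZMOD p ^ (i + 1)] ∧
      (p:ℤ) ^ j ∣ (Polynomial.derivative g).eval t)).card < k := by
  by_contra hcon
  push Not at hcon
  obtain ⟨T, hT, hTc⟩ := Finset.exists_subset_card_eq hcon
  have hex : ∀ s ∈ T, ∃ t : ℤ, t ≡ s [ZMOD p ^ (i + 1)] ∧ (p:ℤ) ^ j ∣ (Polynomial.derivative g).eval t :=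
    fun s hs => (Finset.mem_filter.mp (hT hs)).2
  choose! t ht1 ht2 using hex
  let o := T.orderIsoOfFin hTc
  have h1 := good_vdm hk hg hp j (fun l => t (o l)) (fun l => ht2 _ (o l).2)
  have h2 : ∀ l l', l ≠ l' → ¬ (p:ℤ) ^ (i + 1) ∣ t (o l) - t (o l') := by
    intro l l' hne hd
    have h3 : (((o l).1 : ℕ) : ℤ) ≡ ((o l').1 : ℕ) [ZMOD p ^ (i + 1)] :=
      ((ht1 _ (o l).2).symm.trans (Int.modEq_iff_dvd.mpr hd).symm).trans (ht1 _ (o l').2)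
    have h4 : (o l).1 ≡ (o l').1 [MOD p ^ (i + 1)] := by
      rw [← Int.natCast_modEq_iff]; exact_mod_cast h3
    have h5 := Nat.ModEq.eq_of_lt_of_lt h4 (Finset.mem_range.mp (Finset.mem_filter.mp (hT (o l).2)).1)
      (Finset.mem_range.mp (Finset.mem_filter.mp (hT (o l').2)).1)
    exact hne (o.injective (Subtype.ext h5))
  unfold vdm at h1
  rw [Finset.prod_sigma'] at h1
  have h3 := strip hp i j _ _ _ ?_ h1
  · apply hj
    have h4 : (p:ℤ) ^ j ∣ ((p ^ (i * (k * k)) * (k.factorial * C) : ℕ) : ℤ) := by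
      refine h3.trans ?_
      push_cast
      apply mul_dvd_mul _ dvd_rfl
      apply pow_dvd_pow
      apply Nat.mul_le_mul_left
      rw [Finset.card_sigma]
      calc ∑ a : Fin k, (Finset.Ioi a).card ≤ ∑ a : Fin k, k := Finset.sum_le_sum fun a _ => by
              simpa using Finset.card_le_univ (Finset.Ioi a)
        _ = k * k := by simp
    exact_mod_cast h4
  · rintro ⟨a, b⟩ hab
    simp only [Finset.mem_sigma, Finset.mem_univ, Finset.mem_Ioi, true_and] at hab
    exact h2 b a hab.ne'

theorem sum_shift (u : ℕ → ℂ) (R : ℕ) (hu : Function.Periodic u R) (x : ℕ) :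
    ∑ m ∈ Finset.range R, u (m + x) = ∑ m ∈ Finset.range R, u m := by
  induction x with
  | zero => simp
  | succ x ih =>
    rw [← ih]
    have h1 := Finset.sum_range_succ (fun m => u (m + x)) R
    have h2 := Finset.sum_range_succ' (fun m => u (m + x)) R
    rw [h1] at h2
    have h3 : u (R + x) = u (0 + x) := by rw [add_comm, hu, zero_add]
    rw [h3] at h2
    have := add_right_cancel h2
    rw [this]
    apply Finset.sum_congr rfl; intro m _; congr 1; ring

noncomputable def ev (g : Polynomial ℤ) (a : ℤ) (q : ℕ) (m : ℕ) : ℂ := e ((a * g.eval (m:ℤ) : ℤ) / (q:ℝ))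

theorem norm_ev (g : Polynomial ℤ) (a : ℤ) (q m : ℕ) : ‖ev g a q m‖ = 1 := norm_e _

theorem e_div_congr (x y : ℤ) (q : ℕ) (hq : 0 < q) (h : (q:ℤ) ∣ x - y) : e ((x:ℝ) / q) = e ((y:ℝ) / q) := by
  obtain ⟨c, hc⟩ := h
  have : (x:ℝ) / q = (y:ℝ) / q + (c:ℤ) := by
    have h1 : (x:ℝ) = y + q * c := by exact_mod_cast (by linarith : x = y + q * c)
    have : (q:ℝ) ≠ 0 := by exact_mod_cast hq.ne'
    rw [h1]; field_simp
  rw [this, e_add_int]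

theorem ev_periodic (g : Polynomial ℤ) (a : ℤ) (q : ℕ) (hq : 0 < q) : Function.Periodic (ev g a q) q := by
  intro m
  apply e_div_congr _ _ _ hq
  rw [← mul_sub]
  apply Dvd.dvd.mul_left
  have := Polynomial.sub_dvd_eval_sub ((m + q : ℕ):ℤ) (m:ℤ) g
  simpa using this

theorem geom_zero (x : ℤ) (q : ℕ) (hq : 0 < q) (h : ¬ (q:ℤ) ∣ x) :
    ∑ l ∈ Finset.range q, e (l * ((x:ℝ) / q)) = 0 := by
  have hq' : (q:ℝ) ≠ 0 := by exact_mod_cast hq.ne'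
  simp_rw [e_nsmul]
  have h1 : e ((x:ℝ) / q) ≠ 1 := by
    intro h1
    rw [e_eq_one_iff] at h1
    obtain ⟨n, hn⟩ := h1
    apply h
    refine ⟨n, ?_⟩
    rw [div_eq_iff hq'] at hn
    have : x = n * q := by exact_mod_cast hn
    rw [this, mul_comm]
  have h2 : e ((x:ℝ) / q) ^ q = 1 := by
    rw [← e_nsmul, mul_div_cancel₀ _ hq', e_int]
  have h3 := geom_sum_mul (e ((x:ℝ) / q)) q
  rw [h2, sub_self] at h3
  rcases mul_eq_zero.mp h3 with h4 | h4
  · exact h4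
  · exact absurd (sub_eq_zero.mp h4) h1

open scoped Classical in
theorem ind_periodic (g : Polynomial ℤ) (D : ℕ) :
    Function.Periodic (fun m : ℕ => if (D:ℤ) ∣ (Polynomial.derivative g).eval (m:ℤ) then (0:ℂ) else 1) D := by
  intro m
  have : (D:ℤ) ∣ (Polynomial.derivative g).eval ((m + D : ℕ):ℤ) ↔ (D:ℤ) ∣ (Polynomial.derivative g).eval (m:ℤ) := by
    have := Polynomial.sub_dvd_eval_sub ((m + D : ℕ):ℤ) (m:ℤ) (Polynomial.derivative g)
    rw [show (((m + D : ℕ):ℤ) - (m:ℤ)) = D by push_cast; ring] at this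
    exact (dvd_iff_dvd_of_dvd_sub this)
  simp only [this]

open scoped Classical in
theorem vanish (g : Polynomial ℤ) (p : ℕ) (hp : p.Prime) (j v : ℕ) (hv : 2 * j ≤ v) (a : ℤ)
    (ha : ¬ (p:ℤ) ∣ a) :
    ∑ m ∈ Finset.range (p ^ v), (if ((p ^ j : ℕ):ℤ) ∣ (Polynomial.derivative g).eval (m:ℤ) then (0:ℂ) else 1) * ev g a (p ^ v) m = 0 := by
  set u : ℕ → ℂ := fun m => (if ((p ^ j : ℕ):ℤ) ∣ (Polynomial.derivative g).eval (m:ℤ) then (0:ℂ) else 1) * ev g a (p ^ v) m with hu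
  have hper : Function.Periodic u (p ^ v) :=
    (periodic_of_dvd _ _ _ (ind_periodic g (p ^ j)) (pow_dvd_pow p (by omega))).mul (ev_periodic g a (p ^ v) (pow_pos hp.pos _))
  have hpj : 0 < p ^ j := pow_pos hp.pos _
  have key : ∀ l m : ℕ, u (m + l * p ^ (v - j)) = u m * e (l * ((a * (Polynomial.derivative g).eval (m:ℤ) : ℤ) / ((p ^ j : ℕ):ℝ))) := by
    intro l m
    have hind := (periodic_of_dvd _ _ (l * p ^ (v - j)) (ind_periodic g (p ^ j))
      (Dvd.dvd.mul_left (pow_dvd_pow p (by omega)) l)) m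
    simp only [hu]
    rw [hind, mul_assoc]
    congr 1
    unfold ev
    obtain ⟨c, hc⟩ := Polynomial.binomExpansion g (m:ℤ) (l * p ^ (v - j) : ℤ)
    have h1 : g.eval ((m + l * p ^ (v - j) : ℕ):ℤ) = g.eval (m:ℤ) + (Polynomial.derivative g).eval (m:ℤ) * (l * p ^ (v - j)) + c * (l * p ^ (v - j)) ^ 2 := by
      push_cast; exact hc
    rw [h1, ← e_add]
    have h2 : (l:ℝ) * (((a * (Polynomial.derivative g).eval (m:ℤ) : ℤ):ℝ) / ((p ^ j : ℕ):ℝ))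
        = ((a * (Polynomial.derivative g).eval (m:ℤ) * l * p ^ (v - j) : ℤ):ℝ) / ((p ^ v : ℕ):ℝ) := by
      have : p ^ v = p ^ j * p ^ (v - j) := by rw [← pow_add]; congr 1; omega
      rw [this]
      have h3 : (p:ℝ) ≠ 0 := by exact_mod_cast hp.ne_zero
      push_cast
      field_simp
    rw [h2, ← add_div, ← Int.cast_add]
    apply e_div_congr _ _ _ (pow_pos hp.pos _)
    have h4 : a * (g.eval (m:ℤ) + (Polynomial.derivative g).eval (m:ℤ) * (l * p ^ (v - j)) + c * (l * p ^ (v - j)) ^ 2) - (a * g.eval (m:ℤ) + a * (Polynomial.derivative g).eval (m:ℤ) * l * p ^ (v - j)) = (p:ℤ) ^ (2 * (v - j)) * (a * c * l ^ 2) := by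
      rw [pow_mul']; ring
    rw [h4]
    push_cast
    exact Dvd.dvd.mul_right (pow_dvd_pow _ (by omega)) _
  have h1 : ((p ^ j : ℕ):ℂ) * ∑ m ∈ Finset.range (p ^ v), u m = 0 := by
    calc ((p ^ j : ℕ):ℂ) * ∑ m ∈ Finset.range (p ^ v), u m
        = ∑ l ∈ Finset.range (p ^ j), ∑ m ∈ Finset.range (p ^ v), u m := by simp
      _ = ∑ l ∈ Finset.range (p ^ j), ∑ m ∈ Finset.range (p ^ v), u m * e (l * ((a * (Polynomial.derivative g).eval (m:ℤ) : ℤ) / ((p ^ j : ℕ):ℝ))) := by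
          apply Finset.sum_congr rfl; intro l _
          rw [← sum_shift u _ hper (l * p ^ (v - j))]
          exact Finset.sum_congr rfl fun m _ => key l m
      _ = 0 := by
          rw [Finset.sum_comm]
          apply Finset.sum_eq_zero
          intro m _
          rw [← Finset.mul_sum]
          by_cases hd : ((p ^ j : ℕ):ℤ) ∣ (Polynomial.derivative g).eval (m:ℤ)
          · simp only [hu]; rw [if_pos hd]; simp
          · rw [geom_zero _ _ hpj, mul_zero]
            intro hd2
            apply hd
            refine IsCoprime.dvd_of_dvd_mul_left ?_ hd2
            have hpz : Prime (p:ℤ) := Nat.prime_iff_prime_int.mp hp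
            push_cast
            exact (hpz.coprime_iff_not_dvd.mpr ha).pow_left
  rcases mul_eq_zero.mp h1 with h2 | h2
  · exact absurd h2 (by exact_mod_cast hpj.ne')
  · exact h2

open scoped Classical in
theorem prop_mean {k C : ℕ} {g : Polynomial ℤ} (hk : 1 ≤ k) (hg : Good k C g) {p : ℕ} (hp : p.Prime)
    (i j : ℕ) (hj : ¬ p ^ j ∣ p ^ (i * (k * k)) * (k.factorial * C)) (v : ℕ) (hv : i + 1 ≤ v) :
    (((Finset.range (p ^ v)).filter (fun m : ℕ => ((p ^ j : ℕ):ℤ) ∣ (Polynomial.derivative g).eval (m:ℤ))).card : ℝ)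
      ≤ k / (p:ℝ) ^ (i + 1) * (p:ℝ) ^ v := by
  have h1 := prop_count hk hg hp i j hj
  set A := ((Finset.range (p ^ (i + 1))).filter (fun s : ℕ => ∃ t : ℤ, t ≡ (s:ℤ) [ZMOD p ^ (i + 1)] ∧
      (p:ℤ) ^ j ∣ (Polynomial.derivative g).eval t)) with hA
  have hpi : 0 < p ^ (i + 1) := pow_pos hp.pos _
  have h2 : ((Finset.range (p ^ v)).filter (fun m : ℕ => ((p ^ j : ℕ):ℤ) ∣ (Polynomial.derivative g).eval (m:ℤ))).card
      ≤ (A ×ˢ Finset.range (p ^ (v - (i + 1)))).card := by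
    apply Finset.card_le_card_of_injOn (fun m => (m % p ^ (i + 1), m / p ^ (i + 1)))
    · intro m hm
      simp only [Finset.coe_filter, Set.mem_ofPred_eq, Finset.mem_range] at hm
      simp only [Finset.coe_product, Set.mem_prod, Finset.mem_coe, hA, Finset.mem_filter, Finset.mem_range]
      refine ⟨⟨Nat.mod_lt _ hpi, m, ?_, by exact_mod_cast hm.2⟩, ?_⟩
      · push_cast; exact (Int.mod_modEq _ _).symm
      · rw [Nat.div_lt_iff_lt_mul hpi, ← pow_add]
        rw [show v - (i + 1) + (i + 1) = v by omega]; exact hm.1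
    · intro m _ m' _ h
      simp only [Prod.mk.injEq] at h
      rw [← Nat.div_add_mod m (p ^ (i + 1)), ← Nat.div_add_mod m' (p ^ (i + 1)), h.1, h.2]
  rw [Finset.card_product, Finset.card_range] at h2
  have hp0 : (0:ℝ) < p := by exact_mod_cast hp.pos
  have h3 : (p:ℝ) ^ v = (p:ℝ) ^ (i + 1) * (p:ℝ) ^ (v - (i + 1)) := by
    rw [← pow_add]; congr 1; omega
  have h4 : (k:ℝ) / (p:ℝ) ^ (i + 1) * (p:ℝ) ^ v = k * (p:ℝ) ^ (v - (i + 1)) := by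
    rw [h3]; field_simp
  rw [h4]
  calc _ ≤ ((A.card * p ^ (v - (i + 1)) : ℕ) : ℝ) := by exact_mod_cast h2
    _ ≤ _ := by push_cast; gcongr

open scoped Classical in
theorem ev_mean_le {k C : ℕ} {g : Polynomial ℤ} (hk : 1 ≤ k) (hg : Good k C g) {p : ℕ} (hp : p.Prime)
    (i j : ℕ) (hj : ¬ p ^ j ∣ p ^ (i * (k * k)) * (k.factorial * C)) (v : ℕ) (hv : i + 1 ≤ v) (hv2 : 2 * j ≤ v)
    (a : ℤ) (ha : ¬ (p:ℤ) ∣ a) : ‖pmean (ev g a (p ^ v)) (p ^ v)‖ ≤ k / (p:ℝ) ^ (i + 1) := by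
  have h0 := vanish g p hp j v hv2 a ha
  have h1 := prop_mean hk hg hp i j hj v hv
  have hp0 : (0:ℝ) < p := by exact_mod_cast hp.pos
  have h2 : ∑ m ∈ Finset.range (p ^ v), ev g a (p ^ v) m = ∑ m ∈ Finset.range (p ^ v), (if ((p ^ j : ℕ):ℤ) ∣ (Polynomial.derivative g).eval (m:ℤ) then (1:ℂ) else 0) * ev g a (p ^ v) m := by
    refine Eq.trans ?_ (add_zero _)
    refine Eq.trans ?_ (congrArg _ h0)
    rw [← Finset.sum_add_distrib]
    apply Finset.sum_congr rfl
    intro m _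
    split_ifs <;> simp
  unfold pmean
  rw [h2, norm_div, Complex.norm_natCast]
  rw [div_le_iff₀ (by exact_mod_cast pow_pos hp.pos v)]
  push_cast
  refine le_trans ?_ h1
  refine (norm_sum_le _ _).trans ?_
  rw [Finset.card_filter]
  push_cast
  apply Finset.sum_le_sum
  intro m _
  rw [norm_mul, norm_ev]
  split_ifs <;> simp

section mordell
variable {p : ℕ} [hpf : Fact p.Prime]

noncomputable def esy {m : ℕ} (x : Fin m → ZMod p) (n : ℕ) : ZMod p :=
  ∑ t ∈ (Finset.univ : Finset (Fin m)).powersetCard n, ∏ i ∈ t, x i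

theorem ac_sum {ι : Type*} (s : Finset ι) (f : ι → ZMod p) :
    (ZMod.stdAddChar (∑ i ∈ s, f i) : ℂ) = ∏ i ∈ s, ZMod.stdAddChar (f i) := by
  classical
  induction s using Finset.induction_on with
  | empty => simp
  | insert a s ha ih => rw [Finset.sum_insert ha, Finset.prod_insert ha, AddChar.map_add_eq_mul, ih]

theorem esy_newton {m : ℕ} (x : Fin m → ZMod p) (n : ℕ) :
    (n : ZMod p) * esy x n = (-1) ^ (n + 1) *
      ∑ a ∈ (Finset.HasAntidiagonal.antidiagonal n).filter (fun a : ℕ × ℕ => a.1 < n), (-1) ^ a.1 * esy x a.1 * ∑ i, x i ^ a.2 := by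
  have h := congrArg (MvPolynomial.aeval x) (MvPolynomial.mul_esymm_eq_sum (Fin m) (ZMod p) n)
  simpa [MvPolynomial.esymm, MvPolynomial.psum, esy] using h

theorem esy_eq {m : ℕ} (hm : m < p) (x y : Fin m → ZMod p)
    (h : ∀ j : Fin m, ∑ i, x i ^ (j.1 + 1) = ∑ i, y i ^ (j.1 + 1)) (n : ℕ) (hn : n ≤ m) : esy x n = esy y n := by
  induction n using Nat.strong_induction_on with
  | _ n ih =>
    rcases Nat.eq_zero_or_pos n with h0 | h0
    · subst h0; simp [esy]
    · have hn0 : (n : ZMod p) ≠ 0 := by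
        intro h1
        rw [ZMod.natCast_eq_zero_iff] at h1
        have := Nat.le_of_dvd h0 h1
        omega
      apply mul_left_cancel₀ hn0
      rw [esy_newton, esy_newton]
      congr 1
      apply Finset.sum_congr rfl
      intro a ha
      simp only [Finset.mem_filter, Finset.HasAntidiagonal.mem_antidiagonal] at ha
      rw [ih a.1 ha.2 (by omega)]
      have := h ⟨a.2 - 1, by omega⟩
      simp only [show a.2 - 1 + 1 = a.2 by omega] at this
      rw [this]

theorem prod_esy {m : ℕ} (x : Fin m → ZMod p) (t : ZMod p) :
    ∏ i, (x i + t) = ∑ n ∈ Finset.range (m + 1), esy x n * t ^ (m - n) := by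
  rw [Finset.prod_add, Finset.sum_powerset]
  simp only [Finset.card_univ, Fintype.card_fin]
  apply Finset.sum_congr rfl
  intro n hn
  unfold esy
  rw [Finset.sum_mul]
  apply Finset.sum_congr rfl
  intro s hs
  rw [Finset.prod_const, Finset.card_sdiff_of_subset (Finset.subset_univ _), (Finset.mem_powersetCard.mp hs).2]
  simp

theorem newton_perm {m : ℕ} (hm : m < p) (x y : Fin m → ZMod p)
    (h : ∀ j : Fin m, ∑ i, x i ^ (j.1 + 1) = ∑ i, y i ^ (j.1 + 1)) :
    ∃ τ : Fin m → Fin m, y = x ∘ τ := by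
  have h1 : ∀ t, ∏ i, (x i + t) = ∏ i, (y i + t) := by
    intro t
    rw [prod_esy, prod_esy]
    apply Finset.sum_congr rfl
    intro n hn
    rw [esy_eq hm x y h n (by have := Finset.mem_range.mp hn; omega)]
  have h2 : ∀ i, ∃ l, y i = x l := by
    intro i
    have h3 := h1 (-y i)
    rw [Finset.prod_eq_zero (f := fun l => y l + -y i) (Finset.mem_univ i) (by ring), Finset.prod_eq_zero_iff] at h3
    obtain ⟨l, _, hl⟩ := h3
    exact ⟨l, by linear_combination -hl⟩
  choose τ hτ using h2
  exact ⟨τ, funext hτ⟩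

open scoped Classical in
theorem newton_count {m : ℕ} (hm : m < p) :
    ((Finset.univ : Finset ((Fin m → ZMod p) × (Fin m → ZMod p))).filter
      (fun z => ∀ j : Fin m, ∑ i, z.1 i ^ (j.1 + 1) = ∑ i, z.2 i ^ (j.1 + 1))).card ≤ p ^ m * m ^ m := by
  calc _ ≤ ((Finset.univ : Finset ((Fin m → ZMod p) × (Fin m → Fin m))).image
        (fun z => (z.1, z.1 ∘ z.2))).card := by
        apply Finset.card_le_card
        rintro ⟨x, y⟩ hz
        simp only [Finset.mem_filter, Finset.mem_univ, true_and] at hz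
        obtain ⟨τ, hτ⟩ := newton_perm hm x y hz
        rw [Finset.mem_image]
        exact ⟨(x, τ), Finset.mem_univ _, by rw [hτ]⟩
    _ ≤ _ := Finset.card_image_le
    _ = _ := by simp [ZMod.card]

noncomputable def Sc {m : ℕ} (c : Fin m → ZMod p) : ℂ :=
  ∑ x : ZMod p, ZMod.stdAddChar (∑ j : Fin m, c j * x ^ (j.1 + 1))

open scoped Classical in
theorem orth {m : ℕ} (d : Fin m → ZMod p) :
    ∑ c : Fin m → ZMod p, ZMod.stdAddChar (∑ j, c j * d j) = if (∀ j, d j = 0) then (p:ℂ) ^ m else 0 := by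
  have h1 : ∀ c : Fin m → ZMod p, ZMod.stdAddChar (∑ j, c j * d j) = ∏ j, (ZMod.stdAddChar (c j * d j) : ℂ) := by
    intro c; rw [ac_sum]
  simp_rw [h1]
  have h2 := Finset.prod_univ_sum (fun _ : Fin m => (Finset.univ : Finset (ZMod p))) (fun j c => (ZMod.stdAddChar (c * d j) : ℂ))
  rw [Fintype.piFinset_univ] at h2
  rw [← h2]
  simp_rw [AddChar.sum_mulShift _ (ZMod.isPrimitive_stdAddChar p)]
  split_ifs with h
  · simp [h, ZMod.card]
  · push Not at h
    obtain ⟨j, hj⟩ := h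
    exact Finset.prod_eq_zero (Finset.mem_univ j) (by simp [hj])

theorem Sc_pow {m : ℕ} (c : Fin m → ZMod p) (n : ℕ) :
    Sc c ^ n = ∑ x : Fin n → ZMod p, ZMod.stdAddChar (∑ j : Fin m, c j * ∑ i, x i ^ (j.1 + 1)) := by
  unfold Sc
  rw [Fintype.sum_pow]
  apply Finset.sum_congr rfl
  intro x _
  rw [← ac_sum, Finset.sum_comm]
  simp_rw [Finset.mul_sum]

theorem moment {m : ℕ} (hm : m < p) : ∑ c : Fin m → ZMod p, ‖Sc c‖ ^ (2 * m) ≤ (p:ℝ) ^ m * ((p:ℝ) ^ m * (m:ℝ) ^ m) := by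
  classical
  have h1 : ((∑ c : Fin m → ZMod p, ‖Sc c‖ ^ (2 * m) : ℝ) : ℂ) = (p:ℂ) ^ m *
      (((Finset.univ : Finset ((Fin m → ZMod p) × (Fin m → ZMod p))).filter
      (fun z => ∀ j : Fin m, ∑ i, z.1 i ^ (j.1 + 1) = ∑ i, z.2 i ^ (j.1 + 1))).card : ℂ) := by
    push_cast
    have h2 : ∀ c : Fin m → ZMod p, ((‖Sc c‖:ℂ)) ^ (2 * m) = ∑ z : (Fin m → ZMod p) × (Fin m → ZMod p),
        ZMod.stdAddChar (∑ j : Fin m, c j * (∑ i, z.1 i ^ (j.1 + 1) - ∑ i, z.2 i ^ (j.1 + 1))) := by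
      intro c
      rw [pow_mul, ← Complex.mul_conj', mul_pow, ← map_pow, Sc_pow, map_sum, Finset.sum_mul_sum, Fintype.sum_prod_type]
      apply Finset.sum_congr rfl; intro x _
      apply Finset.sum_congr rfl; intro y _
      rw [← AddChar.map_neg_eq_conj, ← AddChar.map_add_eq_mul]
      congr 1
      simp_rw [mul_sub]
      rw [Finset.sum_sub_distrib, sub_eq_add_neg]
    simp_rw [h2]
    rw [Finset.sum_comm]
    simp_rw [orth, sub_eq_zero]
    rw [← Finset.sum_filter, Finset.sum_const, nsmul_eq_mul, mul_comm]
  have h3 : (∑ c : Fin m → ZMod p, ‖Sc c‖ ^ (2 * m) : ℝ) = (p:ℝ) ^ m *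
      (((Finset.univ : Finset ((Fin m → ZMod p) × (Fin m → ZMod p))).filter
      (fun z => ∀ j : Fin m, ∑ i, z.1 i ^ (j.1 + 1) = ∑ i, z.2 i ^ (j.1 + 1))).card : ℝ) := by exact_mod_cast h1
  rw [h3]
  gcongr
  exact_mod_cast newton_count hm
end mordell

section mordell2
variable {p : ℕ} [hpf : Fact p.Prime]

noncomputable def orb (f : Polynomial (ZMod p)) (m : ℕ) (z : ZMod p × ZMod p) : Fin m → ZMod p :=
  fun j => (Polynomial.taylor z.2 f).coeff (j.1 + 1) * z.1 ^ (j.1 + 1)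

theorem orb_eval (f : Polynomial (ZMod p)) (m : ℕ) (hf : f.natDegree = m) (z : ZMod p × ZMod p) (x : ZMod p) :
    ∑ j : Fin m, orb f m z j * x ^ (j.1 + 1) = f.eval (z.1 * x + z.2) - f.eval z.2 := by
  rw [← Polynomial.taylor_eval, Polynomial.eval_eq_sum_range, Polynomial.natDegree_taylor, hf,
    Finset.sum_range_succ', ← Fin.sum_univ_eq_sum_range (fun i => (Polynomial.taylor z.2 f).coeff (i + 1) * (z.1 * x) ^ (i + 1))]
  simp only [Polynomial.taylor_coeff_zero, pow_zero, mul_one, add_sub_cancel_right]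
  apply Finset.sum_congr rfl
  intro j _
  unfold orb; rw [mul_pow]; ring

theorem orb_norm (f : Polynomial (ZMod p)) (m : ℕ) (hf : f.natDegree = m) (z : ZMod p × ZMod p) (hz : z.1 ≠ 0) :
    ‖Sc (orb f m z)‖ = ‖∑ x : ZMod p, (ZMod.stdAddChar (f.eval x) : ℂ)‖ := by
  unfold Sc
  simp_rw [orb_eval f m hf z]
  have h1 : ∀ x, (ZMod.stdAddChar (f.eval (z.1 * x + z.2) - f.eval z.2) : ℂ) =
      ZMod.stdAddChar (f.eval (z.1 * x + z.2)) * ZMod.stdAddChar (- f.eval z.2) := by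
    intro x; rw [sub_eq_add_neg, AddChar.map_add_eq_mul]
  simp_rw [h1]
  rw [← Finset.sum_mul, norm_mul, AddChar.norm_apply, mul_one]
  congr 1
  have hb : Function.Bijective (fun x : ZMod p => z.1 * x + z.2) := by
    rw [← Finite.injective_iff_bijective]
    intro x y h
    simp only [add_left_inj] at h
    exact mul_left_cancel₀ hz h
  exact Function.Bijective.sum_comp hb (fun x => (ZMod.stdAddChar (f.eval x) : ℂ))

theorem taylor_next (f : Polynomial (ZMod p)) (m : ℕ) (hf : f.natDegree = m + 1) (v : ZMod p) :
    (Polynomial.taylor v f).coeff m = f.coeff m + (m + 1) * f.coeff (m + 1) * v := by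
  rw [Polynomial.taylor_coeff]
  have hd : (Polynomial.hasseDeriv m f).natDegree < 2 := by
    have := Polynomial.natDegree_hasseDeriv_le f m
    omega
  rw [Polynomial.eval_eq_sum_range' hd]
  simp [Finset.sum_range_succ, Polynomial.hasseDeriv_coeff]
  left; rw [add_comm 1 m]
  simp

open scoped Classical in
theorem orb_fiber (f : Polynomial (ZMod p)) (m : ℕ) (hf : f.natDegree = m + 2) (hm : m + 2 < p)
    (c : Fin (m + 2) → ZMod p) :
    (((Finset.univ : Finset (ZMod p × ZMod p)).filter (fun z => z.1 ≠ 0)).filter (fun z => orb f (m + 2) z = c)).card ≤ m + 2 := by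
  have hl : f.coeff (m + 2) ≠ 0 := by
    rw [← hf]; exact Polynomial.leadingCoeff_ne_zero.mpr (by rintro rfl; simp at hf)
  have hm0 : ((m:ZMod p) + 1 + 1) ≠ 0 := by
    intro h
    have : ((m + 2 : ℕ) : ZMod p) = 0 := by push_cast; rw [← h]; ring
    rw [ZMod.natCast_eq_zero_iff] at this
    have := Nat.le_of_dvd (by omega) this
    omega
  have htop : ∀ z, orb f (m + 2) z = c → z.1 ^ (m + 2) = c ⟨m + 1, by omega⟩ / f.coeff (m + 2) := by
    intro z hz
    rw [← hz]
    unfold orb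
    have : (Polynomial.taylor z.2 f).coeff (m + 1 + 1) = f.coeff (m + 2) := by
      have := Polynomial.coeff_taylor_natDegree z.2 f
      rw [hf] at this; exact this.trans (by rw [Polynomial.leadingCoeff, hf])
    simp only [this]
    rw [mul_div_cancel_left₀ _ hl]
  calc _ ≤ (Polynomial.nthRoots (m + 2) (c ⟨m + 1, by omega⟩ / f.coeff (m + 2))).toFinset.card := by
        apply Finset.card_le_card_of_injOn Prod.fst
        · intro z hz
          simp only [Finset.coe_filter, Set.mem_ofPred_eq, Finset.mem_filter, Finset.mem_univ, true_and] at hz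
          simp only [Finset.mem_coe, Multiset.mem_toFinset]
          rw [Polynomial.mem_nthRoots (by omega)]
          exact htop z hz.2
        · rintro ⟨u, v⟩ h1 ⟨u', v'⟩ h2 huu
          simp only [Finset.coe_filter, Set.mem_ofPred_eq, Finset.mem_filter, Finset.mem_univ, true_and] at h1 h2 huu
          subst huu
          have h3 := congrFun (h1.2.trans h2.2.symm) ⟨m, by omega⟩
          unfold orb at h3
          simp only [taylor_next f (m + 1) hf] at h3
          have h4 := mul_right_cancel₀ (pow_ne_zero _ h1.1) h3
          have h5 := add_left_cancel h4
          push_cast at h5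
          have h6 := mul_left_cancel₀ (mul_ne_zero hm0 hl) h5
          rw [h6]
    _ ≤ _ := Multiset.toFinset_card_le _
    _ ≤ _ := Polynomial.card_nthRoots _ _

theorem mordell_pow (f : Polynomial (ZMod p)) (m : ℕ) (hf : f.natDegree = m) (h1 : 1 ≤ m) (hm : m < p) :
    ‖∑ x : ZMod p, (ZMod.stdAddChar (f.eval x) : ℂ)‖ ^ (2 * m) ≤ 2 * (m:ℝ) ^ (m + 1) / (p:ℝ) ^ 2 * (p:ℝ) ^ (2 * m) := by
  classical
  have hp2 : 2 ≤ p := hpf.out.two_le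
  have hp2r : (2:ℝ) ≤ p := by exact_mod_cast hp2
  rcases Nat.lt_or_ge m 2 with h2 | h2
  · have : m = 1 := by omega
    subst this
    have hz : ∑ x : ZMod p, (ZMod.stdAddChar (f.eval x) : ℂ) = 0 := by
      have hl : f.coeff 1 ≠ 0 := by
        rw [← hf]; exact Polynomial.leadingCoeff_ne_zero.mpr (by rintro rfl; simp at hf)
      have : ∀ x, (ZMod.stdAddChar (f.eval x) : ℂ) = ZMod.stdAddChar (f.coeff 0) * ZMod.stdAddChar (x * f.coeff 1) := by
        intro x
        rw [← AddChar.map_add_eq_mul, Polynomial.eval_eq_sum_range, hf]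
        simp [Finset.sum_range_succ, mul_comm]
      simp_rw [this]
      rw [← Finset.mul_sum, AddChar.sum_mulShift _ (ZMod.isPrimitive_stdAddChar p), if_neg hl]
      simp
    rw [hz]; simp
  · obtain ⟨n, rfl⟩ : ∃ n, m = n + 2 := ⟨m - 2, by omega⟩
    set A := ‖∑ x : ZMod p, (ZMod.stdAddChar (f.eval x) : ℂ)‖ with hA
    set Z := (Finset.univ : Finset (ZMod p × ZMod p)).filter (fun z => z.1 ≠ 0) with hZ
    have hZc : Z.card = (p - 1) * p := by
      have : Z = (Finset.univ.erase (0:ZMod p)) ×ˢ (Finset.univ : Finset (ZMod p)) := by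
        ext z; simp [hZ]
      rw [this, Finset.card_product, Finset.card_erase_of_mem (Finset.mem_univ _)]
      simp [ZMod.card]
    have h3 : ∑ z ∈ Z, ‖Sc (orb f (n + 2) z)‖ ^ (2 * (n + 2)) = ((p:ℝ) - 1) * p * A ^ (2 * (n + 2)) := by
      rw [Finset.sum_congr rfl (fun z hz => by rw [orb_norm f (n + 2) hf z (Finset.mem_filter.mp hz).2])]
      rw [Finset.sum_const, hZc, nsmul_eq_mul]
      push_cast [Nat.cast_sub (by omega : 1 ≤ p)]
      rfl
    have h4 : ∑ z ∈ Z, ‖Sc (orb f (n + 2) z)‖ ^ (2 * (n + 2)) ≤ (n + 2 : ℕ) * ∑ c : Fin (n + 2) → ZMod p, ‖Sc c‖ ^ (2 * (n + 2)) := by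
      rw [← Finset.sum_fiberwise (s := Z) (g := orb f (n + 2)), Finset.mul_sum]
      apply Finset.sum_le_sum
      intro c _
      rw [Finset.sum_congr rfl (fun z hz => by rw [(Finset.mem_filter.mp hz).2] : ∀ z ∈ Z.filter (fun z => orb f (n + 2) z = c), ‖Sc (orb f (n + 2) z)‖ ^ (2 * (n + 2)) = ‖Sc c‖ ^ (2 * (n + 2)))]
      rw [Finset.sum_const, nsmul_eq_mul]
      gcongr
      exact orb_fiber f n hf hm c
    have h5 := moment hm
    rw [h3] at h4
    have h6 : ((p:ℝ) - 1) * p * A ^ (2 * (n + 2)) ≤ (n + 2 : ℕ) * ((p:ℝ) ^ (n + 2) * ((p:ℝ) ^ (n + 2) * ((n + 2 : ℕ):ℝ) ^ (n + 2))) := by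
      refine h4.trans ?_
      gcongr
    have h7 : (p:ℝ) ^ 2 / 2 * A ^ (2 * (n + 2)) ≤ ((p:ℝ) - 1) * p * A ^ (2 * (n + 2)) := by
      gcongr
      nlinarith
    have h8 := h7.trans h6
    have hpp : (0:ℝ) < (p:ℝ) ^ 2 := by positivity
    rw [div_mul_eq_mul_div, le_div_iff₀ hpp]
    have h9 : ((n + 2 : ℕ):ℝ) * ((p:ℝ) ^ (n + 2) * ((p:ℝ) ^ (n + 2) * ((n + 2 : ℕ):ℝ) ^ (n + 2))) = ((n + 2 : ℕ):ℝ) ^ (n + 2 + 1) * (p:ℝ) ^ (2 * (n + 2)) := by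
      rw [two_mul (n + 2), pow_add (p:ℝ), pow_succ _ (n + 2)]; ring
    rw [h9] at h8
    linarith
end mordell2

theorem sum_range_zmod (p : ℕ) [hpf : Fact p.Prime] (F : ZMod p → ℂ) :
    ∑ m ∈ Finset.range p, F (m : ZMod p) = ∑ x : ZMod p, F x := by
  refine Finset.sum_nbij' (fun m => (m : ZMod p)) (fun x => x.val) ?_ ?_ ?_ ?_ ?_
  · intro m _; exact Finset.mem_univ _
  · intro x _; exact Finset.mem_range.mpr (ZMod.val_lt x)
  · intro m hm; exact ZMod.val_cast_of_lt (Finset.mem_range.mp hm)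
  · intro x _; exact ZMod.natCast_zmod_val x
  · intro m _; rfl

theorem mordell_good {k C : ℕ} {g : Polynomial ℤ} (hk : 1 ≤ k) (hC : 1 ≤ C) (hg : Good k C g) {p : ℕ} (hp : p.Prime)
    (hpk : k < p) (hpC : C < p) (a : ℤ) (ha : ¬ (p:ℤ) ∣ a) :
    ‖pmean (ev g a p) p‖ ^ k ≤ 2 * (k:ℝ) ^ (k + 1) / p := by
  haveI : Fact p.Prime := ⟨hp⟩
  have hpz : Prime (p:ℤ) := Nat.prime_iff_prime_int.mp hp
  set f : Polynomial (ZMod p) := (Polynomial.C a * g).map (Int.castRingHom (ZMod p)) with hf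
  have hfc : ∀ i, f.coeff i = ((a * g.coeff i : ℤ) : ZMod p) := by
    intro i; rw [hf, Polynomial.coeff_map, Polynomial.coeff_C_mul]; rfl
  have hle : f.natDegree ≤ k := by
    rw [← hg.1]
    exact Polynomial.natDegree_map_le.trans (Polynomial.natDegree_C_mul_le _ _)
  have hge : 1 ≤ f.natDegree := by
    by_contra h0
    have h1 : ∀ i, 1 ≤ i → (p:ℤ) ^ 1 ∣ 1 * g.coeff i := by
      intro i hi
      have h2 : f.coeff i = 0 := Polynomial.coeff_eq_zero_of_natDegree_lt (by omega)
      rw [hfc, ZMod.intCast_zmod_eq_zero_iff_dvd] at h2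
      rw [pow_one, one_mul]
      exact (hpz.dvd_or_dvd h2).resolve_left ha
    have h3 := hg.2.2.2 p hp 1 1 h1
    rw [pow_one, one_mul] at h3
    have h4 := Nat.le_of_dvd hC (by exact_mod_cast h3)
    omega
  have hev : ∀ m : ℕ, ev g a p m = ZMod.stdAddChar (f.eval (m : ZMod p)) := by
    intro m
    have h1 : f.eval (m : ZMod p) = ((a * g.eval (m:ℤ) : ℤ) : ZMod p) := by
      have h2 := Polynomial.eval_intCast_map (Int.castRingHom (ZMod p)) (Polynomial.C a * g) (m:ℤ)
      rw [← hf] at h2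
      simpa using h2
    rw [h1, ZMod.stdAddChar_coe]
    unfold ev e
    congr 1
    push_cast
    ring
  have hs : ∑ m ∈ Finset.range p, ev g a p m = ∑ x : ZMod p, (ZMod.stdAddChar (f.eval x) : ℂ) := by
    rw [← sum_range_zmod p (fun x => (ZMod.stdAddChar (f.eval x) : ℂ))]
    exact Finset.sum_congr rfl fun m _ => hev m
  have h1 := mordell_pow f f.natDegree rfl hge (by omega)
  have hp0 : (0:ℝ) < p := by exact_mod_cast hp.pos
  set X := ‖pmean (ev g a p) p‖ with hX
  have hXS : X = ‖∑ x : ZMod p, (ZMod.stdAddChar (f.eval x) : ℂ)‖ / p := by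
    rw [hX]; unfold pmean; rw [hs, norm_div, Complex.norm_natCast]
  set m := f.natDegree
  have hX0 : 0 ≤ X := norm_nonneg _
  have hX1 : X ≤ 1 := norm_pmean_le_one _ _ (fun m => (norm_ev g a p m).le)
  have h2 : X ^ (2 * m) ≤ 2 * (m:ℝ) ^ (m + 1) / (p:ℝ) ^ 2 := by
    rw [hXS, div_pow, div_le_iff₀ (by positivity)]; exact h1
  have hkr : (1:ℝ) ≤ k := by exact_mod_cast hk
  have h3 : X ^ (2 * k) ≤ 2 * (k:ℝ) ^ (k + 1) / (p:ℝ) ^ 2 := by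
    refine (pow_le_pow_of_le_one hX0 hX1 (by omega : 2 * m ≤ 2 * k)).trans (h2.trans ?_)
    gcongr
    calc (m:ℝ) ^ (m + 1) ≤ (k:ℝ) ^ (m + 1) := by gcongr
      _ ≤ (k:ℝ) ^ (k + 1) := pow_le_pow_right₀ hkr (by omega)
  have h4 : (X ^ k) ^ 2 ≤ (2 * (k:ℝ) ^ (k + 1) / p) ^ 2 := by
    rw [← pow_mul, mul_comm k 2, div_pow]
    refine h3.trans ?_
    gcongr
    have : (1:ℝ) ≤ (k:ℝ) ^ (k + 1) := one_le_pow₀ hkr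
    nlinarith
  exact (pow_le_pow_iff_left₀ (by positivity) (by positivity) (by norm_num)).mp h4

open scoped Classical in
theorem jCount_eq (g : Polynomial ℤ) (p : ℕ) : jCount g p = ((Finset.range (p ^ gammaExp g p)).filter
    (fun s : ℕ => ((p ^ gammaExp g p : ℕ) : ℤ) ∣ (Polynomial.derivative g).eval (s : ℤ))).card := by
  unfold jCount
  rw [← Finset.card_image_of_injective ((Finset.range (p ^ gammaExp g p)).filter
    (fun s : ℕ => ((p ^ gammaExp g p : ℕ) : ℤ) ∣ (Polynomial.derivative g).eval (s : ℤ))) (Nat.cast_injective (R := ℤ))]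
  congr 1
  ext s
  simp only [Finset.mem_filter, Finset.mem_image, Finset.bind_def, Finset.pure_def, Finset.mem_sup, Finset.mem_singleton]
  constructor
  · rintro ⟨⟨a, ha, rfl⟩, h2⟩
    exact ⟨a, ⟨ha, by push_cast; exact h2⟩, rfl⟩
  · rintro ⟨a, ⟨ha, h2⟩, rfl⟩
    exact ⟨⟨a, ha, rfl⟩, by push_cast at h2; exact h2⟩

noncomputable def xg (g : Polynomial ℤ) (p : ℕ) : ℝ := (jCount g p : ℝ) / (p : ℝ) ^ gammaExp g p

open scoped Classical in
noncomputable def wt (g : Polynomial ℤ) (Y : ℝ) (p : ℕ) : ℝ := if (p:ℝ) ≤ Y then 1 - xg g p else 1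

open scoped Classical in
noncomputable def indw (g : Polynomial ℤ) (Y : ℝ) (p : ℕ) (m : ℕ) : ℂ :=
  if (p:ℝ) ≤ Y ∧ ((p ^ gammaExp g p : ℕ):ℤ) ∣ (Polynomial.derivative g).eval (m:ℤ) then 0 else 1

noncomputable def lf (g : Polynomial ℤ) (Y : ℝ) (p : ℕ) (a : ℤ) (v : ℕ) (m : ℕ) : ℂ :=
  indw g Y p m * ev g a (p ^ v) m

open scoped Classical in
theorem bad_periodic (g : Polynomial ℤ) (D : ℕ) :
    Function.Periodic (fun m : ℕ => if (D:ℤ) ∣ (Polynomial.derivative g).eval (m:ℤ) then (1:ℂ) else 0) D := by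
  intro m
  have := ind_periodic g D m
  simp only at this ⊢
  split_ifs at this ⊢ <;> simp_all

theorem indw_periodic (g : Polynomial ℤ) (Y : ℝ) (p : ℕ) :
    Function.Periodic (indw g Y p) (p ^ gammaExp g p) := by
  classical
  intro m
  unfold indw
  have := ind_periodic g (p ^ gammaExp g p) m
  simp only at this
  by_cases hY : (p:ℝ) ≤ Y
  · simp only [hY, true_and]
    split_ifs at this ⊢ <;> simp_all
  · simp [hY]

theorem lf_periodic (g : Polynomial ℤ) (Y : ℝ) (p : ℕ) (hp : p.Prime) (a : ℤ) (v : ℕ) :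
    Function.Periodic (lf g Y p a v) (p ^ (v + gammaExp g p)) := by
  apply Function.Periodic.mul
  · exact periodic_of_dvd _ _ _ (indw_periodic g Y p) (pow_dvd_pow _ (by omega))
  · exact periodic_of_dvd _ _ _ (ev_periodic g a (p ^ v) (pow_pos hp.pos _)) (pow_dvd_pow _ (by omega))

open scoped Classical in
theorem bad_mean (g : Polynomial ℤ) (p : ℕ) :
    pmean (fun m : ℕ => if ((p ^ gammaExp g p : ℕ):ℤ) ∣ (Polynomial.derivative g).eval (m:ℤ) then (1:ℂ) else 0) (p ^ gammaExp g p) = (xg g p : ℂ) := by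
  unfold pmean xg
  rw [Finset.sum_boole, jCount_eq]
  push_cast
  rfl

theorem xg_nonneg (g : Polynomial ℤ) (p : ℕ) : 0 ≤ xg g p := by unfold xg; positivity

theorem j_lt {k C : ℕ} {g : Polynomial ℤ} (hk : 1 ≤ k) (hC : 1 ≤ C) (hg : Good k C g) {p : ℕ} (hp : p.Prime) :
    jCount g p < p ^ gammaExp g p := by
  classical
  obtain ⟨h1, ⟨n, hn⟩, _⟩ := gamma_set hk hC hg hp
  have hpos : 0 < p ^ gammaExp g p := pow_pos hp.pos _
  have : jCount g p < (Finset.range (p ^ gammaExp g p)).card := by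
    rw [jCount_eq]
    apply Finset.card_lt_card
    refine ⟨Finset.filter_subset _ _, fun hsub => hn ?_⟩
    have hz : (0:ℤ) < ((p ^ gammaExp g p : ℕ):ℤ) := by exact_mod_cast hpos
    have hmem : (n % ((p ^ gammaExp g p : ℕ):ℤ)).toNat ∈ Finset.range (p ^ gammaExp g p) := by
      rw [Finset.mem_range]
      have h2 := Int.emod_lt_of_pos n hz
      have h3 := Int.emod_nonneg n hz.ne'
      omega
    have h4 := (Finset.mem_filter.mp (hsub hmem)).2
    rw [Int.toNat_of_nonneg (Int.emod_nonneg n hz.ne')] at h4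
    have h5 := Polynomial.sub_dvd_eval_sub n (n % ((p ^ gammaExp g p : ℕ):ℤ)) (Polynomial.derivative g)
    have h6 : ((p ^ gammaExp g p : ℕ):ℤ) ∣ n - n % ((p ^ gammaExp g p : ℕ):ℤ) := Int.dvd_self_sub_emod
    have h7 := h6.trans h5
    push_cast at h7 h4
    exact (dvd_iff_dvd_of_dvd_sub h7).mpr h4
  simpa using this

theorem xg_le_one_sub {k C : ℕ} {g : Polynomial ℤ} (hk : 1 ≤ k) (hC : 1 ≤ C) (hg : Good k C g) {p : ℕ} (hp : p.Prime) :
    xg g p ≤ 1 - 1 / (p:ℝ) ^ gammaExp g p := by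
  have h1 := j_lt hk hC hg hp
  have hp0 : (0:ℝ) < (p:ℝ) ^ gammaExp g p := pow_pos (by exact_mod_cast hp.pos) _
  unfold xg
  rw [le_sub_iff_add_le, ← add_div, div_le_one hp0]
  exact_mod_cast h1

theorem xg_lt_one {k C : ℕ} {g : Polynomial ℤ} (hk : 1 ≤ k) (hC : 1 ≤ C) (hg : Good k C g) {p : ℕ} (hp : p.Prime) :
    xg g p < 1 := by
  have h1 := xg_le_one_sub hk hC hg hp
  have hp0 : (0:ℝ) < (p:ℝ) ^ gammaExp g p := pow_pos (by exact_mod_cast hp.pos) _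
  have : 0 < 1 / (p:ℝ) ^ gammaExp g p := by positivity
  linarith

theorem gamma_le {k C : ℕ} {g : Polynomial ℤ} (hk : 1 ≤ k) (hC : 1 ≤ C) (hg : Good k C g) {p : ℕ} (hp : p.Prime) :
    gammaExp g p ≤ Kp k C := by
  obtain ⟨h1, _, h2⟩ := gamma_set hk hC hg hp
  have h3 := Nat.le_of_dvd (Kp_pos k C hC) h2
  have := Nat.lt_pow_self (n := gammaExp g p - 1) hp.one_lt
  omega

theorem gamma_pow_le {k C : ℕ} {g : Polynomial ℤ} (hk : 1 ≤ k) (hC : 1 ≤ C) (hg : Good k C g) {p : ℕ} (hp : p.Prime) :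
    p ^ gammaExp g p ≤ Kp k C * p := by
  obtain ⟨h1, _, h2⟩ := gamma_set hk hC hg hp
  have h3 := Nat.le_of_dvd (Kp_pos k C hC) h2
  rw [show gammaExp g p = gammaExp g p - 1 + 1 by omega, pow_succ]
  exact Nat.mul_le_mul_right _ h3

theorem gamma_eq_one {k C : ℕ} {g : Polynomial ℤ} (hk : 1 ≤ k) (hC : 1 ≤ C) (hg : Good k C g) {p : ℕ} (hp : p.Prime)
    (h : Kp k C < p) : gammaExp g p = 1 := by
  obtain ⟨h1, _, h2⟩ := gamma_set hk hC hg hp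
  have h3 := Nat.le_of_dvd (Kp_pos k C hC) h2
  by_contra h4
  have : p ^ 1 ≤ p ^ (gammaExp g p - 1) := Nat.pow_le_pow_right hp.pos (by omega)
  rw [pow_one] at this
  omega

theorem Kp_ge (k C : ℕ) : k.factorial * C ≤ Kp k C := by
  unfold Kp
  have h1 := vdm_ne k (fun i => (i:ℤ)) (by intro a b h; exact Fin.ext (by simp only at h; exact_mod_cast h))
  have h2 : 0 < (vdm k (fun i => (i:ℤ))).natAbs := Int.natAbs_pos.mpr h1
  exact Nat.le_mul_of_pos_left _ h2

theorem not_dvd_fac (k C i j p : ℕ) (hp : p.Prime) (hC : 1 ≤ C) (hj : i * (k * k) + k.factorial * C ≤ j) :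
    ¬ p ^ j ∣ p ^ (i * (k * k)) * (k.factorial * C) := by
  intro h
  have hpos : 0 < k.factorial * C := Nat.mul_pos (Nat.factorial_pos k) hC
  have h0 : p ^ (i * (k * k) + k.factorial * C) ∣ p ^ (i * (k * k)) * (k.factorial * C) := (pow_dvd_pow _ hj).trans h
  rw [pow_add] at h0
  have h1 := Nat.dvd_of_mul_dvd_mul_left (pow_pos hp.pos _) h0
  have h2 := Nat.le_of_dvd hpos h1
  have := Nat.lt_pow_self (n := k.factorial * C) hp.one_lt
  omega

theorem not_dvd_fac1 (k C p : ℕ) (hC : 1 ≤ C) (h : Kp k C < p) :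
    ¬ p ^ 1 ∣ p ^ (0 * (k * k)) * (k.factorial * C) := by
  intro h1
  have hpos : 0 < k.factorial * C := Nat.mul_pos (Nat.factorial_pos k) hC
  simp only [pow_one, zero_mul, pow_zero, one_mul] at h1
  have := Nat.le_of_dvd hpos h1
  have := Kp_ge k C
  omega

theorem xg_le {k C : ℕ} {g : Polynomial ℤ} (hk : 1 ≤ k) (hC : 1 ≤ C) (hg : Good k C g) {p : ℕ} (hp : p.Prime) :
    xg g p ≤ ((Kp k C + k : ℕ):ℝ) / p := by
  classical
  have hp0 : (0:ℝ) < p := by exact_mod_cast hp.pos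
  by_cases h : Kp k C < p
  · have hg1 := gamma_eq_one hk hC hg hp h
    have h1 := prop_mean hk hg hp 0 1 (not_dvd_fac1 k C p hC h) 1 (by norm_num)
    unfold xg
    rw [jCount_eq, hg1]
    simp only [pow_one, zero_add] at h1 ⊢
    rw [div_mul_cancel₀ _ hp0.ne'] at h1
    have h3 : (0:ℝ) ≤ (Kp k C : ℝ) := by positivity
    have h4 : (k:ℝ) ≤ ((Kp k C + k : ℕ):ℝ) := by push_cast; linarith
    exact div_le_div_of_nonneg_right (h1.trans h4) hp0.le
  · have h1 := xg_lt_one hk hC hg hp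
    refine h1.le.trans ?_
    rw [le_div_iff₀ hp0, one_mul]
    exact_mod_cast (by omega : p ≤ Kp k C + k)

theorem xg_le' {k C : ℕ} {g : Polynomial ℤ} (hk : 1 ≤ k) (hC : 1 ≤ C) (hg : Good k C g) {p : ℕ} (hp : p.Prime)
    (h : Kp k C < p) : xg g p ≤ k / p := by
  classical
  have hp0 : (0:ℝ) < p := by exact_mod_cast hp.pos
  have hg1 := gamma_eq_one hk hC hg hp h
  have h1 := prop_mean hk hg hp 0 1 (not_dvd_fac1 k C p hC h) 1 (by norm_num)
  unfold xg
  rw [jCount_eq, hg1]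
  simp only [pow_one, zero_add] at h1 ⊢
  rw [div_mul_cancel₀ _ hp0.ne'] at h1
  gcongr

theorem wt_pos {k C : ℕ} {g : Polynomial ℤ} (hk : 1 ≤ k) (hC : 1 ≤ C) (hg : Good k C g) {p : ℕ} (hp : p.Prime) (Y : ℝ) :
    0 < wt g Y p := by
  unfold wt
  split_ifs
  · linarith [xg_lt_one hk hC hg hp]
  · norm_num

theorem indw_mean (g : Polynomial ℤ) (Y : ℝ) (p : ℕ) (hp : p.Prime) : pmean (indw g Y p) (p ^ gammaExp g p) = (wt g Y p : ℂ) := by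
  classical
  have hne : ((p ^ gammaExp g p : ℕ):ℂ) ≠ 0 := by exact_mod_cast (pow_pos hp.pos _).ne'
  unfold wt
  split_ifs with h
  · have h1 := bad_mean g p
    push_cast
    rw [← h1]
    have h2 : indw g Y p = fun m => 1 - (fun m : ℕ => if ((p ^ gammaExp g p : ℕ):ℤ) ∣ (Polynomial.derivative g).eval (m:ℤ) then (1:ℂ) else 0) m := by
      funext m
      unfold indw
      simp only [h, true_and]
      split_ifs <;> simp
    rw [h2]
    unfold pmean
    rw [Finset.sum_sub_distrib, sub_div]
    congr 1
    simp only [Finset.sum_const, Finset.card_range, nsmul_eq_mul, mul_one]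
    exact div_self hne
  · have h2 : indw g Y p = fun m => 1 := by
      funext m; unfold indw; simp [h]
    rw [h2]
    unfold pmean
    simp only [Finset.sum_const, Finset.card_range, nsmul_eq_mul, mul_one]
    rw [div_self hne]; simp

theorem lf_le {g : Polynomial ℤ} {p : ℕ} (hp : p.Prime) (Y : ℝ) (a : ℤ) (v : ℕ) :
    ‖pmean (lf g Y p a v) (p ^ (v + gammaExp g p))‖ ≤ wt g Y p := by
  classical
  have h1 : pmean (indw g Y p) (p ^ (v + gammaExp g p)) = (wt g Y p : ℂ) := by
    rw [← indw_mean g Y p hp]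
    exact pmean_eq_of_dvd _ _ _ (indw_periodic g Y p) (pow_dvd_pow _ (by omega)) (pow_pos hp.pos _)
  have h2 := norm_pmean_le (lf g Y p a v) (p ^ (v + gammaExp g p)) (fun m => (indw g Y p m).re) (by
    intro m
    unfold lf
    rw [norm_mul, norm_ev, mul_one]
    unfold indw
    split_ifs <;> simp)
  refine h2.trans (le_of_eq ?_)
  have h3 := congrArg Complex.re h1
  rw [Complex.ofReal_re] at h3
  rw [← h3]
  unfold pmean
  rw [← Complex.re_sum, ← Complex.ofReal_natCast, Complex.div_ofReal_re]

theorem lf_zero {g : Polynomial ℤ} {p : ℕ} (hp : p.Prime) (Y : ℝ) (hY : (p:ℝ) ≤ Y)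
    (a : ℤ) (ha : ¬ (p:ℤ) ∣ a) (v : ℕ) (hv : 2 * gammaExp g p ≤ v) :
    pmean (lf g Y p a v) (p ^ (v + gammaExp g p)) = 0 := by
  classical
  have hper : Function.Periodic (lf g Y p a v) (p ^ v) := by
    apply Function.Periodic.mul
    · exact periodic_of_dvd _ _ _ (indw_periodic g Y p) (pow_dvd_pow _ (by omega))
    · exact ev_periodic g a (p ^ v) (pow_pos hp.pos _)
  rw [pmean_eq_of_dvd _ _ _ hper (pow_dvd_pow _ (by omega)) (pow_pos hp.pos _)]
  have := vanish g p hp (gammaExp g p) v hv a ha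
  unfold pmean
  have h2 : ∑ m ∈ Finset.range (p ^ v), lf g Y p a v m = 0 := by
    rw [← this]
    apply Finset.sum_congr rfl
    intro m _
    unfold lf indw
    simp only [hY, true_and]
  rw [h2, zero_div]

theorem lf_large {g : Polynomial ℤ} {p : ℕ} (hp : p.Prime) (Y : ℝ) (hY : ¬ (p:ℝ) ≤ Y) (a : ℤ) (v : ℕ) :
    pmean (lf g Y p a v) (p ^ (v + gammaExp g p)) = pmean (ev g a (p ^ v)) (p ^ v) := by
  have h2 : lf g Y p a v = ev g a (p ^ v) := by
    funext m; unfold lf indw; simp [hY]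
  rw [h2]
  exact pmean_eq_of_dvd _ _ _ (ev_periodic g a (p ^ v) (pow_pos hp.pos _)) (pow_dvd_pow _ (by omega)) (pow_pos hp.pos _)

theorem lf_small {k C : ℕ} {g : Polynomial ℤ} (hk : 1 ≤ k) (hC : 1 ≤ C) (hg : Good k C g) {p : ℕ} (hp : p.Prime)
    (h1 : (4 ^ k * (2 * k ^ (k + 1))) ^ (k + 1) ≤ p) (h2 : Kp k C < p) (h3 : k < p)
    (Y : ℝ) (a : ℤ) (ha : ¬ (p:ℤ) ∣ a) :
    (‖pmean (lf g Y p a 1) (p ^ (1 + gammaExp g p))‖ / wt g Y p) ^ (k + 1) ≤ 1 / p := by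
  classical
  have hCp : C < p := by
    have := Kp_ge k C
    have h5 : 1 * C ≤ k.factorial * C := Nat.mul_le_mul_right _ (Nat.factorial_pos k)
    omega
  have hp0 : (0:ℝ) < p := by exact_mod_cast hp.pos
  have hX := mordell_good hk hC hg hp h3 hCp a ha
  set X := ‖pmean (ev g a p) p‖ with hXd
  have hX0 : 0 ≤ X := norm_nonneg _
  obtain ⟨y, hy0, hy⟩ : ∃ y : ℝ, 0 ≤ y ∧ y ^ (k + 1) = p := by
    refine ⟨(p:ℝ) ^ ((1:ℝ) / ((k + 1 : ℕ):ℝ)), by positivity, ?_⟩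
    rw [← Real.rpow_natCast, ← Real.rpow_mul hp0.le, one_div_mul_cancel (by positivity), Real.rpow_one]
  have hyK : (4:ℝ) ^ k * (2 * k ^ (k + 1)) ≤ y := by
    have : ((4:ℝ) ^ k * (2 * k ^ (k + 1))) ^ (k + 1) ≤ y ^ (k + 1) := by rw [hy]; exact_mod_cast h1
    exact le_of_pow_le_pow_left₀ (by omega) hy0 this
  have hk1 : (1:ℝ) ≤ k := by exact_mod_cast hk
  have h4 : (4:ℝ) ≤ 4 ^ k := by
    calc (4:ℝ) = 4 ^ 1 := by norm_num
      _ ≤ 4 ^ k := pow_le_pow_right₀ (by norm_num) hk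
  have hkk : (k:ℝ) ≤ k ^ (k + 1) := by
    calc (k:ℝ) = k ^ 1 := by norm_num
      _ ≤ k ^ (k + 1) := pow_le_pow_right₀ hk1 (by omega)
  have hy4 : 4 * k ≤ y := by nlinarith
  have hy1 : 1 ≤ y := by linarith
  have hypos : 0 < y := by linarith
  have hX4 : X ≤ 1 / (4 * y) := by
    have : X ^ k ≤ (1 / (4 * y)) ^ k := by
      refine hX.trans ?_
      rw [← hy, div_pow, one_pow, mul_pow, div_le_div_iff₀ (by positivity) (by positivity), one_mul, pow_succ]
      have : 0 < y ^ k := by positivity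
      calc (2 * (k:ℝ) ^ (k + 1)) * (4 ^ k * y ^ k) = (4 ^ k * (2 * k ^ (k + 1))) * y ^ k := by ring
        _ ≤ y * y ^ k := by gcongr
        _ = _ := by ring
    exact le_of_pow_le_pow_left₀ (by omega) (by positivity) this
  have hyp : y * y ≤ p := by
    rw [← hy]
    calc y * y = y ^ 2 := by ring
      _ ≤ y ^ (k + 1) := pow_le_pow_right₀ hy1 (by omega)
  have hkp : (k:ℝ) / p ≤ 1 / (4 * y) := by
    rw [div_le_div_iff₀ hp0 (by positivity)]
    nlinarith
  have hkp2 : (k:ℝ) / p ≤ 1 / 2 := by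
    refine hkp.trans ?_
    rw [div_le_div_iff₀ (by positivity) (by norm_num)]
    linarith
  have hev : pmean (ev g a (p ^ 1)) (p ^ 1) = pmean (ev g a p) p := by rw [pow_one]
  have main : ‖pmean (lf g Y p a 1) (p ^ (1 + gammaExp g p))‖ / wt g Y p ≤ 1 / y := by
    by_cases hY : (p:ℝ) ≤ Y
    · have hx := xg_le' hk hC hg hp h2
      have hw : wt g Y p = 1 - xg g p := by unfold wt; simp [hY]
      have hd : ‖pmean (lf g Y p a 1) (p ^ (1 + gammaExp g p)) - pmean (ev g a (p ^ 1)) (p ^ (1 + gammaExp g p))‖ ≤ xg g p := by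
        have e1 : pmean (lf g Y p a 1) (p ^ (1 + gammaExp g p)) - pmean (ev g a (p ^ 1)) (p ^ (1 + gammaExp g p))
            = pmean (fun m => lf g Y p a 1 m - ev g a (p ^ 1) m) (p ^ (1 + gammaExp g p)) := by
          unfold pmean; rw [Finset.sum_sub_distrib, sub_div]
        rw [e1]
        refine (norm_pmean_le _ _ (fun m : ℕ => if ((p ^ gammaExp g p : ℕ):ℤ) ∣ (Polynomial.derivative g).eval (m:ℤ) then (1:ℝ) else 0) ?_).trans (le_of_eq ?_)
        · intro m
          unfold lf indw
          simp only [hY, true_and]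
          split_ifs
          · simp [norm_ev]
          · simp
        · have b1 := bad_mean g p
          rw [← pmean_eq_of_dvd _ _ (p ^ (1 + gammaExp g p)) (bad_periodic g (p ^ gammaExp g p)) (pow_dvd_pow _ (by omega)) (pow_pos hp.pos _)] at b1
          have b2 := congrArg Complex.re b1
          rw [Complex.ofReal_re] at b2
          rw [← b2]
          unfold pmean
          rw [← Complex.ofReal_natCast, Complex.div_ofReal_re, Complex.re_sum]
          congr 1
          apply Finset.sum_congr rfl
          intro m _
          split_ifs <;> simp
      rw [pmean_eq_of_dvd _ _ _ (ev_periodic g a (p ^ 1) (pow_pos hp.pos _)) (pow_dvd_pow _ (by omega)) (pow_pos hp.pos _), hev] at hd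
      have h6 : ‖pmean (lf g Y p a 1) (p ^ (1 + gammaExp g p))‖ ≤ X + xg g p := by
        have := norm_le_insert' (pmean (lf g Y p a 1) (p ^ (1 + gammaExp g p))) (pmean (ev g a p) p)
        linarith
      rw [div_le_iff₀ (wt_pos hk hC hg hp Y), hw]
      have h7 : 1 / (4 * y) = (1 / y) / 4 := by field_simp
      rw [h7] at hX4 hkp
      have : 0 < 1 / y := by positivity
      nlinarith
    · have hw : wt g Y p = 1 := by unfold wt; simp [hY]
      rw [lf_large hp Y hY, hev, hw, div_one]
      refine hX4.trans ?_
      exact one_div_le_one_div_of_le hypos (by linarith)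
  calc _ ≤ (1 / y) ^ (k + 1) := by
        apply pow_le_pow_left₀ _ main
        exact div_nonneg (norm_nonneg _) (wt_pos hk hC hg hp Y).le
    _ = 1 / p := by rw [div_pow, one_pow, hy]

theorem pfrac (T : Finset ℕ) (hT : ∀ p ∈ T, p.Prime) (v : ℕ → ℕ) : ∀ a : ℤ,
    (∀ p ∈ T, 1 ≤ v p → ¬ (p:ℤ) ∣ a) →
    ∃ (A : ℕ → ℤ) (n : ℤ), (a:ℝ) / ((∏ p ∈ T, p ^ v p : ℕ):ℝ) = (∑ p ∈ T, (A p : ℝ) / ((p ^ v p : ℕ):ℝ)) + n ∧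
      ∀ p ∈ T, 1 ≤ v p → ¬ (p:ℤ) ∣ A p := by
  classical
  induction T using Finset.induction_on with
  | empty => intro a _; exact ⟨fun _ => 0, a, by simp, by simp⟩
  | insert p T hpT ih =>
    intro a ha
    have hp := hT p (Finset.mem_insert_self _ _)
    have hT' : ∀ p ∈ T, p.Prime := fun p' h => hT p' (Finset.mem_insert_of_mem h)
    have hco : IsCoprime ((p ^ v p : ℕ):ℤ) ((∏ p ∈ T, p ^ v p : ℕ):ℤ) := by
      rw [Nat.isCoprime_iff_coprime]
      apply Nat.Coprime.prod_right
      intro p' hp'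
      apply Nat.Coprime.pow
      rw [Nat.coprime_primes hp (hT' p' hp')]
      rintro rfl; exact hpT hp'
    obtain ⟨x, y, hxy⟩ := hco
    obtain ⟨A, n, h1, h2⟩ := ih hT' (a * x) (by
      intro p' hp' hv hd
      rcases (Nat.prime_iff_prime_int.mp (hT' p' hp')).dvd_or_dvd hd with h | h
      · exact ha p' (Finset.mem_insert_of_mem hp') hv h
      · have d1 : (p':ℤ) ∣ ((∏ p ∈ T, p ^ v p : ℕ):ℤ) := by
          exact_mod_cast (dvd_pow_self p' (by omega)).trans (Finset.dvd_prod_of_mem (fun p => p ^ v p) hp')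
        have : (p':ℤ) ∣ 1 := by rw [← hxy]; exact dvd_add (h.mul_right _) (d1.mul_left _)
        exact (Nat.prime_iff_prime_int.mp (hT' p' hp')).not_dvd_one this)
    refine ⟨fun p' => if p' = p then a * y else A p', n, ?_, ?_⟩
    · rw [Finset.prod_insert hpT, Finset.sum_insert hpT]
      have e1 : ∑ p' ∈ T, (((if p' = p then a * y else A p' : ℤ) : ℤ):ℝ) / ((p' ^ v p' : ℕ):ℝ) = ∑ p' ∈ T, (A p' : ℝ) / ((p' ^ v p' : ℕ):ℝ) := by
        apply Finset.sum_congr rfl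
        intro p' hp'
        rw [if_neg]
        rintro rfl; exact hpT hp'
      rw [e1, add_assoc, ← h1]
      simp only [if_true]
      have hP : ((p ^ v p : ℕ):ℝ) ≠ 0 := by exact_mod_cast (pow_pos hp.pos _).ne'
      have hQ : ((∏ p ∈ T, p ^ v p : ℕ):ℝ) ≠ 0 := by
        exact_mod_cast (Finset.prod_pos fun p' hp' => pow_pos (hT' p' hp').pos _).ne'
      have hxyr : (x:ℝ) * ((p ^ v p : ℕ):ℝ) + y * ((∏ p ∈ T, p ^ v p : ℕ):ℝ) = 1 := by exact_mod_cast hxy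
      rw [Nat.cast_mul]
      generalize ((p ^ v p : ℕ):ℝ) = P at *
      generalize ((∏ p ∈ T, p ^ v p : ℕ):ℝ) = Q at *
      push_cast
      rw [div_add_div _ _ hP hQ, div_eq_div_iff (mul_ne_zero hP hQ) (mul_ne_zero hP hQ)]
      linear_combination (-(a:ℝ) * P * Q) * hxyr
    · intro p' hp' hv
      simp only
      split_ifs with h
      · subst h
        intro hd
        rcases (Nat.prime_iff_prime_int.mp hp).dvd_or_dvd hd with h | h
        · exact ha _ hp' hv h
        · have d1 : (p':ℤ) ∣ ((p' ^ v p' : ℕ):ℤ) := by exact_mod_cast dvd_pow_self p' (by omega)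
          have : (p':ℤ) ∣ 1 := by rw [← hxy]; exact dvd_add (d1.mul_left _) (h.mul_right _)
          exact (Nat.prime_iff_prime_int.mp hp).not_dvd_one this
      · exact h2 p' ((Finset.mem_insert.mp hp').resolve_left h) hv

noncomputable def prY (Y : ℝ) : Finset ℕ := (Finset.range (⌊Y⌋₊ + 1)).filter Nat.Prime

theorem mem_prY {Y : ℝ} (hY : 0 ≤ Y) (p : ℕ) : p ∈ prY Y ↔ p.Prime ∧ (p:ℝ) ≤ Y := by
  unfold prY
  rw [Finset.mem_filter, Finset.mem_range, Nat.lt_succ_iff, Nat.le_floor_iff hY]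
  tauto

open scoped Classical in
noncomputable def indW (g : Polynomial ℤ) (Y : ℝ) (m : ℕ) : ℂ := if (m:ℤ) ∈ WSet g Y then 1 else 0

theorem indW_eq (g : Polynomial ℤ) (Y : ℝ) (hY : 0 ≤ Y) (T : Finset ℕ) (hT : ∀ p ∈ T, p.Prime) (hs : prY Y ⊆ T) (m : ℕ) :
    indW g Y m = ∏ p ∈ T, indw g Y p m := by
  classical
  unfold indW
  split_ifs with h
  · symm
    apply Finset.prod_eq_one
    intro p hp
    unfold indw
    rw [if_neg]
    rintro ⟨h1, h2⟩
    exact h p (hT p hp) h1 (by push_cast at h2; exact h2)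
  · symm
    have : ∃ p : ℕ, p.Prime ∧ (p:ℝ) ≤ Y ∧ ((p:ℤ) ^ gammaExp g p ∣ (Polynomial.derivative g).eval (m:ℤ)) := by
      by_contra hn
      push Not at hn
      exact h hn
    obtain ⟨p, hp, h1, h2⟩ := this
    apply Finset.prod_eq_zero (hs ((mem_prY hY p).mpr ⟨hp, h1⟩))
    unfold indw
    rw [if_pos]
    exact ⟨h1, by push_cast; exact h2⟩

theorem wProd_eq (g : Polynomial ℤ) (Y : ℝ) (hY : 0 ≤ Y) (T : Finset ℕ) (hT : ∀ p ∈ T, p.Prime) (hs : prY Y ⊆ T) :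
    wProd g Y = ∏ p ∈ T, wt g Y p := by
  classical
  have e1 : wProd g Y = ∏ p ∈ prY Y, wt g Y p := by
    unfold wProd prY
    apply Finset.prod_congr (by congr)
    intro p hp
    unfold wt xg
    rw [if_pos]
    exact ((mem_prY hY p).mp hp).2
  rw [e1]
  apply Finset.prod_subset hs
  intro p hp hn
  unfold wt
  rw [if_neg]
  intro h
  exact hn ((mem_prY hY p).mpr ⟨hT p hp, h⟩)

noncomputable def ell (g : Polynomial ℤ) (Y : ℝ) (p : ℕ) (a : ℤ) (v : ℕ) : ℝ :=
  ‖pmean (lf g Y p a v) (p ^ (v + gammaExp g p))‖ / wt g Y p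

theorem e_finsum (T : Finset ℕ) (f : ℕ → ℝ) : e (∑ p ∈ T, f p) = ∏ p ∈ T, e (f p) := by
  classical
  induction T using Finset.induction_on with
  | empty => simp [e_zero]
  | insert p T hp ih => rw [Finset.sum_insert hp, Finset.prod_insert hp, e_add, ih]

theorem ell_nonneg {k C : ℕ} {g : Polynomial ℤ} (hk : 1 ≤ k) (hC : 1 ≤ C) (hg : Good k C g) {p : ℕ} (hp : p.Prime) (Y : ℝ) (a : ℤ) (v : ℕ) :
    0 ≤ ell g Y p a v := div_nonneg (norm_nonneg _) (wt_pos hk hC hg hp Y).le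

theorem ell_le_one {k C : ℕ} {g : Polynomial ℤ} (hk : 1 ≤ k) (hC : 1 ≤ C) (hg : Good k C g) {p : ℕ} (hp : p.Prime) (Y : ℝ) (a : ℤ) (v : ℕ) :
    ell g Y p a v ≤ 1 := (div_le_one (wt_pos hk hC hg hp Y)).mpr (lf_le hp Y a v)

theorem complete {k C : ℕ} {g : Polynomial ℤ} (hk : 1 ≤ k) (hC : 1 ≤ C) (hg : Good k C g) (Y : ℝ) (hY : 0 ≤ Y)
    (q : ℕ) (hq : 0 < q) (a : ℤ) (ha : IsCoprime a (q:ℤ)) :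
    ∃ R : ℕ, 0 < R ∧ q ∣ R ∧ (∏ p ∈ prY Y, p ^ gammaExp g p) ∣ R ∧ ∃ A : ℕ → ℤ,
      (∀ p ∈ q.primeFactors, ¬ (p:ℤ) ∣ A p) ∧
      ‖pmean (fun m => indW g Y m * ev g a q m) R‖ ≤ wProd g Y * ∏ p ∈ q.primeFactors, ell g Y p (A p) (q.factorization p) := by
  classical
  set T := prY Y ∪ q.primeFactors with hTd
  have hT : ∀ p ∈ T, p.Prime := by
    intro p hp
    rcases Finset.mem_union.mp hp with h | h
    · exact ((mem_prY hY p).mp h).1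
    · exact Nat.prime_of_mem_primeFactors h
  have hs : prY Y ⊆ T := Finset.subset_union_left
  have hs2 : q.primeFactors ⊆ T := Finset.subset_union_right
  set v := q.factorization with hv
  have hqT : ∏ p ∈ T, p ^ v p = q := by
    rw [← Finset.prod_subset hs2]
    · exact Nat.prod_factorization_pow_eq_self hq.ne'
    · intro p _ hn
      have : v p = 0 := by rw [hv]; exact Finsupp.notMem_support_iff.mp hn
      rw [this, pow_zero]
  have hvp : ∀ p ∈ T, 1 ≤ v p → p ∣ q := by
    intro p hp h1
    rw [← hqT]
    exact (dvd_pow_self p (by omega)).trans (Finset.dvd_prod_of_mem (fun p => p ^ v p) hp)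
  obtain ⟨A, n, hA, hA2⟩ := pfrac T hT v a (by
    intro p hp h1 hd
    have h2 : (p:ℤ) ∣ (q:ℤ) := by exact_mod_cast hvp p hp h1
    have := ha.isUnit_of_dvd' hd h2
    exact (Nat.prime_iff_prime_int.mp (hT p hp)).not_isUnit this)
  rw [hqT] at hA
  have hfac : (fun m => indW g Y m * ev g a q m) = fun m => ∏ p ∈ T, lf g Y p (A p) (v p) m := by
    funext m
    unfold lf
    rw [Finset.prod_mul_distrib, ← indW_eq g Y hY T hT hs]
    congr 1
    unfold ev
    rw [← e_finsum]
    have : (((a * g.eval (m:ℤ) : ℤ):ℝ) / (q:ℝ)) = (∑ p ∈ T, ((A p * g.eval (m:ℤ) : ℤ):ℝ) / ((p ^ v p : ℕ):ℝ)) + ((n * g.eval (m:ℤ) : ℤ):ℝ) := by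
      push_cast
      rw [mul_div_right_comm, hA, add_mul, Finset.sum_mul]
      congr 1
      apply Finset.sum_congr rfl
      intro p _
      push_cast
      ring
    rw [this, e_add_int]
  refine ⟨∏ p ∈ T, p ^ (v p + gammaExp g p), Finset.prod_pos fun p hp => pow_pos (hT p hp).pos _, ?_, ?_, A, ?_, ?_⟩
  · rw [← hqT]
    exact Finset.prod_dvd_prod_of_dvd _ _ fun p _ => pow_dvd_pow _ (by omega)
  · refine (Finset.prod_dvd_prod_of_subset _ _ _ hs).trans ?_
    exact Finset.prod_dvd_prod_of_dvd _ _ fun p _ => pow_dvd_pow _ (by omega)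
  · intro p hp
    exact hA2 p (hs2 hp) (by
      have := (Nat.prime_of_mem_primeFactors hp).factorization_pos_of_dvd hq.ne' (Nat.dvd_of_mem_primeFactors hp)
      exact this)
  · rw [hfac, pmean_prod T (fun p => lf g Y p (A p) (v p)) (fun p => p ^ (v p + gammaExp g p))
      (fun p hp => pow_pos (hT p hp).pos _) (fun p hp => lf_periodic g Y p (hT p hp) _ _)
      (by
        intro p hp p' hp' hne
        exact Nat.Coprime.pow _ _ ((Nat.coprime_primes (hT p hp) (hT p' hp')).mpr hne)), norm_prod, wProd_eq g Y hY T hT hs]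
    have e1 : ∏ p ∈ T, ‖pmean (lf g Y p (A p) (v p)) (p ^ (v p + gammaExp g p))‖ = (∏ p ∈ T, wt g Y p) * ∏ p ∈ T, ell g Y p (A p) (v p) := by
      rw [← Finset.prod_mul_distrib]
      apply Finset.prod_congr rfl
      intro p hp
      unfold ell
      rw [mul_div_cancel₀ _ (wt_pos hk hC hg (hT p hp) Y).ne']
    rw [e1]
    apply mul_le_mul_of_nonneg_left _ (Finset.prod_nonneg fun p hp => (wt_pos hk hC hg (hT p hp) Y).le)
    exact Finset.prod_le_prod_of_subset_of_le_one hs2 (fun p hp => ell_nonneg hk hC hg (hT p hp) Y _ _)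
      (fun p hp _ => ell_le_one hk hC hg (hT p hp) Y _ _)

theorem prod_le_single (T : Finset ℕ) (f : ℕ → ℝ) (h0 : ∀ p ∈ T, 0 ≤ f p) (h1 : ∀ p ∈ T, f p ≤ 1) (p : ℕ) (hp : p ∈ T) :
    ∏ p ∈ T, f p ≤ f p := by
  have := Finset.prod_le_prod_of_subset_of_le_one (Finset.singleton_subset_iff.mpr hp) h0 (fun i hi _ => h1 i hi)
  rwa [Finset.prod_singleton] at this

noncomputable def P2 (k C : ℕ) : ℕ := (4 ^ k * (2 * k ^ (k + 1))) ^ (k + 1) + Kp k C + k + 5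

/-- Local estimates for large primes. -/
theorem ell_large {k C : ℕ} {g : Polynomial ℤ} (hk : 1 ≤ k) (hC : 1 ≤ C) (hg : Good k C g) {p : ℕ} (hp : p.Prime)
    (h : P2 k C ≤ p) (Y : ℝ) (a : ℤ) (ha : ¬ (p:ℤ) ∣ a) : ell g Y p a 1 ^ (k + 1) ≤ 1 / p := by
  unfold P2 at h
  exact lf_small hk hC hg hp (by omega) (by omega) (by omega) Y a ha

theorem ell_zero {g : Polynomial ℤ} {p : ℕ} (hp : p.Prime)
    (Y : ℝ) (hY : (p:ℝ) ≤ Y) (a : ℤ) (ha : ¬ (p:ℤ) ∣ a) (v : ℕ) (hv : 2 * gammaExp g p ≤ v) : ell g Y p a v = 0 := by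
  unfold ell; rw [lf_zero hp Y hY a ha v hv]; simp

theorem ell_gt {k C : ℕ} {g : Polynomial ℤ} (hk : 1 ≤ k) (hC : 1 ≤ C) (hg : Good k C g) {p : ℕ} (hp : p.Prime)
    (Y : ℝ) (hY : ¬ (p:ℝ) ≤ Y) (a : ℤ) (ha : ¬ (p:ℤ) ∣ a) (v i : ℕ)
    (hv : i + 1 + 2 * (i * (k * k) + k.factorial * C) ≤ v) : ell g Y p a v ≤ k / (p:ℝ) ^ (i + 1) := by
  unfold ell
  have hw : wt g Y p = 1 := by unfold wt; simp [hY]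
  rw [lf_large hp Y hY, hw, div_one]
  exact ev_mean_le hk hg hp i _ (not_dvd_fac k C i _ p hp hC le_rfl) v (by omega) (by omega) a ha

theorem ell_gt1 {k C : ℕ} {g : Polynomial ℤ} (hk : 1 ≤ k) (hC : 1 ≤ C) (hg : Good k C g) {p : ℕ} (hp : p.Prime)
    (h : P2 k C ≤ p)
    (Y : ℝ) (hY : ¬ (p:ℝ) ≤ Y) (a : ℤ) (ha : ¬ (p:ℤ) ∣ a) (v : ℕ)
    (hv : 2 ≤ v) : ell g Y p a v ≤ k / (p:ℝ) := by
  unfold ell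
  have hw : wt g Y p = 1 := by unfold wt; simp [hY]
  rw [lf_large hp Y hY, hw, div_one]
  have := ev_mean_le hk hg hp 0 1 (not_dvd_fac1 k C p hC (by unfold P2 at h; omega)) v (by omega) (by omega) a ha
  simpa using this

theorem q_le (q B n : ℕ) (hq : 0 < q) (hn : 1 ≤ n) (hB : 1 ≤ B)
    (h : ∀ p ∈ q.primeFactors, p < n → p ^ q.factorization p ≤ B) :
    q ≤ B ^ n * ∏ p ∈ q.primeFactors.filter (fun p => n ≤ p), p ^ q.factorization p := by
  classical
  have h1 : ∏ p ∈ q.primeFactors, p ^ q.factorization p = q := Nat.prod_factorization_pow_eq_self hq.ne'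
  conv_lhs => rw [← h1]
  rw [← Finset.prod_filter_mul_prod_filter_not q.primeFactors (fun p => p < n)]
  simp only [not_lt]
  apply Nat.mul_le_mul_right
  calc ∏ p ∈ q.primeFactors.filter (fun p => p < n), p ^ q.factorization p ≤ ∏ p ∈ q.primeFactors.filter (fun p => p < n), B := by
        apply Finset.prod_le_prod'
        intro p hp
        rw [Finset.mem_filter] at hp
        exact h p hp.1 hp.2
    _ = B ^ (q.primeFactors.filter (fun p => p < n)).card := by rw [Finset.prod_const]
    _ ≤ B ^ n := by
        apply Nat.pow_le_pow_right hB
        calc _ ≤ (Finset.range n).card := Finset.card_le_card (by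
              intro p hp; rw [Finset.mem_filter] at hp; exact Finset.mem_range.mpr hp.2)
          _ = n := Finset.card_range n

theorem ell_prod (k C : ℕ) (hk : 1 ≤ k) (hC : 1 ≤ C) (r : ℝ) (hr : 0 < r) :
    ∃ κ0 : ℝ, 0 < κ0 ∧ ∀ g : Polynomial ℤ, Good k C g → ∀ σ : ℝ, 0 < σ → σ ≤ 1 → ∀ q : ℕ, 0 < q →
      κ0 / σ ^ (k + 1) < q → ∀ A : ℕ → ℤ, (∀ p ∈ q.primeFactors, ¬ (p:ℤ) ∣ A p) →
      ∏ p ∈ q.primeFactors, ell g (σ ^ (-((k:ℝ) + 2))) p (A p) (q.factorization p) ≤ r * σ := by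
  classical
  set p2 := P2 k C with hp2
  have hp25 : 5 ≤ p2 := by rw [hp2]; unfold P2; omega
  have hk1 : (1:ℝ) ≤ k := by exact_mod_cast hk
  -- choose the threshold
  obtain ⟨σ0, hσ0, hσ01, hσ0a, hσ0b⟩ : ∃ σ0 : ℝ, 0 < σ0 ∧ σ0 ≤ 1 ∧ σ0 * p2 ≤ 1 ∧ σ0 * k ≤ r := by
    refine ⟨1 / (p2 + k / r + 1), by positivity, ?_, ?_, ?_⟩
    · rw [div_le_one (by positivity)]
      have : 0 < k / r := by positivity
      have : (0:ℝ) ≤ p2 := by positivity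
      linarith
    · rw [div_mul_eq_mul_div, one_mul, div_le_one (by positivity)]
      have : 0 < k / r := by positivity
      linarith
    · rw [div_mul_eq_mul_div, one_mul, div_le_iff₀ (by positivity)]
      have h1 : r * (k / r) = k := by field_simp
      have : (0:ℝ) ≤ p2 := by positivity
      nlinarith
  set η := r * σ0 with hη
  have hη0 : 0 < η := by positivity
  obtain ⟨i0, hi0⟩ : ∃ i0 : ℕ, k / (2:ℝ) ^ (i0 + 1) ≤ η := by
    obtain ⟨n, hn⟩ := pow_unbounded_of_one_lt (k / η) (by norm_num : (1:ℝ) < 2)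
    refine ⟨n, ?_⟩
    rw [div_lt_iff₀ hη0] at hn
    rw [div_le_iff₀ (by positivity), pow_succ]
    nlinarith [pow_pos (by norm_num : (0:ℝ) < 2) n]
  obtain ⟨p1, hp1, hp1a, hp1b⟩ : ∃ p1 : ℕ, p2 ≤ p1 ∧ k / η ≤ p1 ∧ 1 / η ^ (k + 1) ≤ p1 := by
    obtain ⟨n, hn⟩ := exists_nat_ge (k / η)
    obtain ⟨n', hn'⟩ := exists_nat_ge (1 / η ^ (k + 1))
    refine ⟨p2 + n + n', by omega, ?_, ?_⟩
    · push_cast; have : (0:ℝ) ≤ p2 := by positivity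
      have : (0:ℝ) ≤ n' := by positivity
      linarith
    · push_cast; have : (0:ℝ) ≤ p2 := by positivity
      have : (0:ℝ) ≤ n := by positivity
      linarith
  set v0 := i0 + 1 + 2 * (i0 * (k * k) + k.factorial * C) + 2 * Kp k C with hv0
  set C2 : ℕ := (p2 ^ (2 * Kp k C)) ^ p2 with hC2
  set C3 : ℕ := (p1 ^ v0) ^ p1 with hC3
  have hC2pos : (0:ℝ) < C2 := by
    rw [hC2]; exact_mod_cast pow_pos (pow_pos (by omega) _) _
  refine ⟨C2 / r ^ (k + 1) + C3, by positivity, ?_⟩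
  intro g hg σ hσ hσ1 q hq hqκ A hA
  set Y := σ ^ (-((k:ℝ) + 2)) with hY
  have hprime : ∀ p ∈ q.primeFactors, p.Prime := fun p hp => Nat.prime_of_mem_primeFactors hp
  have hf0 : ∀ p ∈ q.primeFactors, 0 ≤ ell g Y p (A p) (q.factorization p) :=
    fun p hp => ell_nonneg hk hC hg (hprime p hp) _ _ _
  have hf1 : ∀ p ∈ q.primeFactors, ell g Y p (A p) (q.factorization p) ≤ 1 :=
    fun p hp => ell_le_one hk hC hg (hprime p hp) _ _ _
  have hvpos : ∀ p ∈ q.primeFactors, 1 ≤ q.factorization p := fun p hp =>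
    (hprime p hp).factorization_pos_of_dvd hq.ne' (Nat.dvd_of_mem_primeFactors hp)
  have hσk : 0 < σ ^ (k + 1) := by positivity
  have hYinv : Y * σ ^ (k + 2) = 1 := by
    rw [hY, ← Real.rpow_natCast σ (k + 2), ← Real.rpow_add hσ]
    push_cast
    rw [show -((k:ℝ) + 2) + (k + 2) = 0 by ring, Real.rpow_zero]
  have hgam : ∀ p ∈ q.primeFactors, p2 ≤ p → gammaExp g p = 1 := fun p hp h =>
    gamma_eq_one hk hC hg (hprime p hp) (by rw [hp2] at h; unfold P2 at h; omega)
  have hY0 : 0 < Y := by rw [hY]; exact Real.rpow_pos_of_pos hσ _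
  by_cases hσs : σ ≤ σ0
  · -- small σ
    have hYp2 : (p2:ℝ) ≤ Y := by
      have h1 : σ * p2 ≤ 1 := by
        refine le_trans ?_ hσ0a
        gcongr
      have h2 : σ ^ (k + 2) ≤ σ := pow_le_of_le_one hσ.le hσ1 (by omega)
      have h3 : 1 ≤ Y * σ := by rw [← hYinv]; gcongr
      by_contra hcon
      push Not at hcon
      nlinarith
    by_cases hA1 : ∃ p ∈ q.primeFactors, ¬ (p:ℝ) ≤ Y ∧ 2 ≤ q.factorization p
    · obtain ⟨p, hp, h1, h2⟩ := hA1
      have hp0 : (0:ℝ) < p := by exact_mod_cast (hprime p hp).pos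
      push Not at h1
      refine (prod_le_single _ _ hf0 hf1 p hp).trans ?_
      have hpp : P2 k C ≤ p := by
        rw [← hp2]
        exact_mod_cast (hYp2.trans h1.le)
      refine (ell_gt1 hk hC hg (hprime p hp) hpp Y (not_le.mpr h1) _ (hA p hp) _ h2).trans ?_
      rw [div_le_iff₀ hp0]
      have h3 : σ ^ (k + 2) ≤ σ ^ 2 := pow_le_pow_of_le_one hσ.le hσ1 (by omega)
      have h4 : 1 ≤ Y * σ ^ 2 := by rw [← hYinv]; gcongr
      have h5 : σ * k ≤ r := le_trans (by gcongr) hσ0b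
      have h6 : 1 ≤ p * σ ^ 2 := h4.trans (by gcongr)
      calc (k:ℝ) ≤ k * (p * σ ^ 2) := le_mul_of_one_le_right (by positivity) h6
        _ = (σ * k) * (σ * p) := by ring
        _ ≤ r * (σ * p) := by gcongr
        _ = _ := by ring
    by_cases hA2 : ∃ p ∈ q.primeFactors, (p:ℝ) ≤ Y ∧ 2 * gammaExp g p ≤ q.factorization p
    · obtain ⟨p, hp, h1, h2⟩ := hA2
      refine (prod_le_single _ _ hf0 hf1 p hp).trans ?_
      rw [ell_zero (hprime p hp) Y h1 _ (hA p hp) _ h2]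
      positivity
    push Not at hA1 hA2
    have hv1 : ∀ p ∈ q.primeFactors, p2 ≤ p → q.factorization p = 1 := by
      intro p hp h
      have h0 := hvpos p hp
      by_cases hpY : (p:ℝ) ≤ Y
      · have h1 := hA2 p hp hpY
        rw [hgam p hp h] at h1
        omega
      · have h1 := hA1 p hp (not_le.mp hpY)
        omega
    have hvs : ∀ p ∈ q.primeFactors, p < p2 → p ^ q.factorization p ≤ p2 ^ (2 * Kp k C) := by
      intro p hp h
      have hpY : (p:ℝ) ≤ Y := le_trans (by exact_mod_cast h.le) hYp2
      have h1 := hA2 p hp hpY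
      have h2 := gamma_le hk hC hg (hprime p hp)
      calc p ^ q.factorization p ≤ p ^ (2 * Kp k C) := Nat.pow_le_pow_right (hprime p hp).pos (by omega)
        _ ≤ _ := Nat.pow_le_pow_left h.le _
    have hql := q_le q (p2 ^ (2 * Kp k C)) p2 hq (by omega) (Nat.pow_pos (by omega)) hvs
    set F := q.primeFactors.filter (fun p => p2 ≤ p) with hF
    have hFs : F ⊆ q.primeFactors := Finset.filter_subset _ _
    have hPi : ∏ p ∈ F, p ^ q.factorization p = ∏ p ∈ F, p := by
      apply Finset.prod_congr rfl
      intro p hp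
      rw [hv1 p (hFs hp) (Finset.mem_filter.mp hp).2, pow_one]
    rw [hPi, ← hC2] at hql
    have hE : (∏ p ∈ q.primeFactors, ell g Y p (A p) (q.factorization p)) ^ (k + 1) ≤ (r * σ) ^ (k + 1) := by
      have s1 : ∏ p ∈ q.primeFactors, ell g Y p (A p) (q.factorization p) ≤ ∏ p ∈ F, ell g Y p (A p) 1 := by
        refine (Finset.prod_le_prod_of_subset_of_le_one hFs hf0 (fun i hi _ => hf1 i hi)).trans (le_of_eq ?_)
        apply Finset.prod_congr rfl
        intro p hp
        rw [hv1 p (hFs hp) (Finset.mem_filter.mp hp).2]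
      have hPpos : (0:ℝ) < ((∏ p ∈ F, p : ℕ):ℝ) := by
        exact_mod_cast Finset.prod_pos fun p hp => (hprime p (hFs hp)).pos
      have s2 : (∏ p ∈ F, ell g Y p (A p) 1) ^ (k + 1) ≤ 1 / ((∏ p ∈ F, p : ℕ):ℝ) := by
        rw [← Finset.prod_pow, Nat.cast_prod, one_div, ← Finset.prod_inv_distrib]
        apply Finset.prod_le_prod
        · intro p hp
          exact pow_nonneg (ell_nonneg hk hC hg (hprime p (hFs hp)) _ _ _) _
        · intro p hp
          rw [← one_div]
          exact ell_large hk hC hg (hprime p (hFs hp)) (Finset.mem_filter.mp hp).2 Y _ (hA p (hFs hp))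
      refine (pow_le_pow_left₀ (Finset.prod_nonneg hf0) s1 _).trans (s2.trans ?_)
      rw [div_le_iff₀ hPpos, mul_pow]
      have s3 : (q:ℝ) ≤ C2 * ((∏ p ∈ F, p : ℕ):ℝ) := by exact_mod_cast hql
      rw [div_lt_iff₀ hσk] at hqκ
      have s4 : (C2:ℝ) / r ^ (k + 1) ≤ q * σ ^ (k + 1) := by
        have : (0:ℝ) ≤ C3 := by positivity
        linarith
      rw [div_le_iff₀ (by positivity)] at s4
      have s5 : (C2:ℝ) * 1 ≤ C2 * (r ^ (k + 1) * σ ^ (k + 1) * ((∏ p ∈ F, p : ℕ):ℝ)) := by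
        calc (C2:ℝ) * 1 ≤ q * σ ^ (k + 1) * r ^ (k + 1) := by rw [mul_one]; exact s4
          _ ≤ (C2 * ((∏ p ∈ F, p : ℕ):ℝ)) * σ ^ (k + 1) * r ^ (k + 1) := by gcongr
          _ = _ := by ring
      exact le_of_mul_le_mul_left s5 hC2pos
    exact le_of_pow_le_pow_left₀ (by omega) (by positivity) hE
  · -- large σ
    push Not at hσs
    have hησ : η ≤ r * σ := by rw [hη]; gcongr
    refine le_trans ?_ hησ
    by_cases hB1 : ∃ p ∈ q.primeFactors, p1 ≤ p
    · obtain ⟨p, hp, h1⟩ := hB1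
      have hpr := hprime p hp
      have hp0 : (0:ℝ) < p := by exact_mod_cast hpr.pos
      have hpp1 : (p1:ℝ) ≤ p := by exact_mod_cast h1
      refine (prod_le_single _ _ hf0 hf1 p hp).trans ?_
      rcases (hvpos p hp).eq_or_lt with h2 | h2
      · rw [← h2]
        have h3 := ell_large hk hC hg hpr (hp1.trans h1) Y (A p) (hA p hp)
        have h4 : 1 / (p:ℝ) ≤ η ^ (k + 1) := by
          rw [div_le_iff₀ (by positivity)] at hp1b ⊢
          calc (1:ℝ) ≤ p1 * η ^ (k + 1) := hp1b
            _ ≤ p * η ^ (k + 1) := by gcongr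
            _ = _ := by ring
        exact le_of_pow_le_pow_left₀ (by omega) hη0.le (h3.trans h4)
      · by_cases hpY : (p:ℝ) ≤ Y
        · rw [ell_zero hpr Y hpY _ (hA p hp) _ (by rw [hgam p hp (hp1.trans h1)]; omega)]
          exact hη0.le
        · refine (ell_gt1 hk hC hg hpr (hp1.trans h1) Y hpY _ (hA p hp) _ h2).trans ?_
          rw [div_le_iff₀ hp0]
          rw [div_le_iff₀ hη0] at hp1a
          nlinarith
    by_cases hB2 : ∃ p ∈ q.primeFactors, v0 ≤ q.factorization p
    · obtain ⟨p, hp, h1⟩ := hB2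
      have hpr := hprime p hp
      refine (prod_le_single _ _ hf0 hf1 p hp).trans ?_
      by_cases hpY : (p:ℝ) ≤ Y
      · rw [ell_zero hpr Y hpY _ (hA p hp) _ (by have := gamma_le hk hC hg hpr; omega)]
        exact hη0.le
      · refine (ell_gt hk hC hg hpr Y hpY _ (hA p hp) _ i0 (by omega)).trans (le_trans ?_ hi0)
        have : (2:ℝ) ≤ p := by exact_mod_cast hpr.two_le
        gcongr
    exfalso
    push Not at hB1 hB2
    have hql := q_le q (p1 ^ v0) p1 hq (by omega) (Nat.pow_pos (by omega)) (by
      intro p hp h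
      calc p ^ q.factorization p ≤ p ^ v0 := Nat.pow_le_pow_right (hprime p hp).pos (hB2 p hp).le
        _ ≤ _ := Nat.pow_le_pow_left h.le _)
    have hemp : q.primeFactors.filter (fun p => p1 ≤ p) = ∅ := by
      apply Finset.filter_eq_empty_iff.mpr
      intro p hp
      exact not_le.mpr (hB1 p hp)
    rw [hemp, Finset.prod_empty, mul_one, ← hC3] at hql
    have h1 : (q:ℝ) ≤ C3 := by exact_mod_cast hql
    rw [div_lt_iff₀ hσk] at hqκ
    have h2 : σ ^ (k + 1) ≤ 1 := pow_le_one₀ hσ.le hσ1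
    have h3 : (q:ℝ) * σ ^ (k + 1) ≤ q := mul_le_of_le_one_right (by positivity) h2
    have h4 : (0:ℝ) < C2 / r ^ (k + 1) := by positivity
    linarith

theorem mono_D (M n : ℝ) (hn : 1 ≤ n) (hM : n ≤ M) (i : ℕ) :
    0 ≤ n ^ i - (n - 1) ^ i ∧ M * (n ^ i - (n - 1) ^ i) ≤ i * M ^ i := by
  induction i with
  | zero => simp
  | succ i ih =>
    obtain ⟨h1, h2⟩ := ih
    have e1 : n ^ (i + 1) - (n - 1) ^ (i + 1) = n * (n ^ i - (n - 1) ^ i) + (n - 1) ^ i := by ring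
    have h0 : 0 ≤ (n - 1) ^ i := pow_nonneg (by linarith) _
    have h3 : (n - 1) ^ i ≤ M ^ i := pow_le_pow_left₀ (by linarith) (by linarith) _
    rw [e1]
    refine ⟨by nlinarith, ?_⟩
    have h4 : n * (M * (n ^ i - (n - 1) ^ i)) ≤ M * (i * M ^ i) :=
      mul_le_mul hM h2 (mul_nonneg (by linarith) h1) (by linarith)
    have h5 : M * (n - 1) ^ i ≤ M * M ^ i := mul_le_mul_of_nonneg_left h3 (by linarith)
    push_cast
    rw [pow_succ]
    nlinarith

theorem mono_E (M n : ℝ) (hn : 1 ≤ n) (hM : n ≤ M) (i : ℕ) :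
    0 ≤ i * n ^ (i - 1) - (n ^ i - (n - 1) ^ i) ∧
      M ^ 2 * (i * n ^ (i - 1) - (n ^ i - (n - 1) ^ i)) ≤ (i:ℝ) ^ 2 * M ^ i := by
  induction i with
  | zero => simp
  | succ i ih =>
    obtain ⟨h1, h2⟩ := ih
    obtain ⟨h3, h4⟩ := mono_D M n hn hM i
    have e1 : ((i + 1 : ℕ):ℝ) * n ^ (i + 1 - 1) - (n ^ (i + 1) - (n - 1) ^ (i + 1)) =
        n * (i * n ^ (i - 1) - (n ^ i - (n - 1) ^ i)) + (n ^ i - (n - 1) ^ i) := by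
      rcases i with _ | i
      · simp
      · simp only [Nat.add_sub_cancel]; push_cast; ring
    rw [e1]
    have hM0 : 0 ≤ M := by linarith
    refine ⟨by nlinarith, ?_⟩
    have h5 : n * (M ^ 2 * (i * n ^ (i - 1) - (n ^ i - (n - 1) ^ i))) ≤ M * ((i:ℝ) ^ 2 * M ^ i) :=
      mul_le_mul hM h2 (mul_nonneg (by positivity) h1) hM0
    have h6 : M * (M * (n ^ i - (n - 1) ^ i)) ≤ M * (i * M ^ i) := mul_le_mul_of_nonneg_left h4 hM0
    have h7 : 0 ≤ M * M ^ i := by positivity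
    have h8 : (0:ℝ) ≤ i := by positivity
    push_cast
    rw [pow_succ M i]
    nlinarith

theorem poly_lin {k C : ℕ} {g : Polynomial ℤ} (hg : Good k C g) (M : ℝ) (t : ℕ → ℝ) (X : ℝ) (hX : 0 ≤ X)
    (ht : ∀ i ≤ k, X * |t i| ≤ (k + 1 : ℝ) ^ 2 * M ^ k) :
    X * |∑ i ∈ Finset.range (k + 1), (g.coeff i : ℝ) * t i| ≤ (k + 1 : ℝ) ^ 3 * C * (g.leadingCoeff * M ^ k) := by
  obtain ⟨_, hb, hc, _⟩ := hg
  have hb' : (0:ℝ) < g.leadingCoeff := by exact_mod_cast hb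
  calc X * |∑ i ∈ Finset.range (k + 1), (g.coeff i : ℝ) * t i|
      ≤ X * ∑ i ∈ Finset.range (k + 1), |(g.coeff i : ℝ) * t i| := by
        gcongr; exact Finset.abs_sum_le_sum_abs _ _
    _ = ∑ i ∈ Finset.range (k + 1), |(g.coeff i : ℝ)| * (X * |t i|) := by
        rw [Finset.mul_sum]; apply Finset.sum_congr rfl; intro i _; rw [abs_mul]; ring
    _ ≤ ∑ i ∈ Finset.range (k + 1), ((C:ℝ) * g.leadingCoeff) * ((k + 1 : ℝ) ^ 2 * M ^ k) := by
        apply Finset.sum_le_sum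
        intro i hi
        apply mul_le_mul _ (ht i (by rw [Finset.mem_range] at hi; omega)) (by positivity) (by positivity)
        have := hc i
        exact_mod_cast this
    _ = _ := by rw [Finset.sum_const, Finset.card_range, nsmul_eq_mul]; push_cast; ring

theorem eval_sum {k C : ℕ} {g : Polynomial ℤ} (hg : Good k C g) (m : ℤ) :
    ((g.eval m : ℤ):ℝ) = ∑ i ∈ Finset.range (k + 1), (g.coeff i : ℝ) * (m:ℝ) ^ i := by
  rw [Polynomial.eval_eq_sum_range, hg.1]; push_cast; rfl

theorem deval_sum {k C : ℕ} {g : Polynomial ℤ} (hg : Good k C g) (m : ℤ) :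
    (((Polynomial.derivative g).eval m : ℤ):ℝ) = ∑ i ∈ Finset.range (k + 1), (g.coeff i : ℝ) * (i * (m:ℝ) ^ (i - 1)) := by
  rw [Polynomial.derivative_eval, Polynomial.sum_over_range' _ (by simp) (k + 1) (by rw [hg.1]; omega)]
  push_cast
  apply Finset.sum_congr rfl
  intro i _
  ring

noncomputable def KA (k C : ℕ) : ℝ := (k + 1 : ℝ) ^ 3 * C

/-- Elementary size bounds on `[0,M]`. -/
theorem g_bounds {k C : ℕ} {g : Polynomial ℤ} (hk : 1 ≤ k) (hg : Good k C g) (N : ℝ) (M : ℕ) (hM : 1 ≤ M)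
    (hN : (g.leadingCoeff:ℝ) * (M:ℝ) ^ k ≤ N) :
    (∀ m : ℕ, m ≤ M → M * |(((Polynomial.derivative g).eval (m:ℤ) : ℤ):ℝ)| ≤ KA k C * N) ∧
    (∀ m : ℕ, m + 1 ≤ M → M * |((g.eval ((m + 1 : ℕ):ℤ) : ℤ):ℝ) - ((g.eval (m:ℤ) : ℤ):ℝ)| ≤ KA k C * N) ∧
    (∀ m : ℕ, m + 1 ≤ M → (M:ℝ) ^ 2 * |(((Polynomial.derivative g).eval ((m + 1 : ℕ):ℤ) : ℤ):ℝ) - (((Polynomial.derivative g).eval (m:ℤ) : ℤ):ℝ)| ≤ KA k C * N) ∧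
    (∀ m : ℕ, m + 1 ≤ M → (M:ℝ) ^ 2 * |(((Polynomial.derivative g).eval ((m + 1 : ℕ):ℤ) : ℤ):ℝ) - (((g.eval ((m + 1 : ℕ):ℤ) : ℤ):ℝ) - ((g.eval (m:ℤ) : ℤ):ℝ))| ≤ KA k C * N) := by
  have hM1 : (1:ℝ) ≤ M := by exact_mod_cast hM
  have hM0 : (0:ℝ) ≤ M := by linarith
  have hkN : KA k C * ((g.leadingCoeff:ℝ) * (M:ℝ) ^ k) ≤ KA k C * N := by
    apply mul_le_mul_of_nonneg_left hN; unfold KA; positivity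
  have hup : ∀ i ≤ k, (M:ℝ) ^ i ≤ (M:ℝ) ^ k := fun i hi => pow_le_pow_right₀ hM1 hi
  have hi1 : ∀ i ≤ k, (i:ℝ) * (M:ℝ) ^ i ≤ (k + 1 : ℝ) ^ 2 * (M:ℝ) ^ k := by
    intro i hi
    have : (i:ℝ) ≤ k := by exact_mod_cast hi
    have h2 : (i:ℝ) ≤ (k + 1 : ℝ) ^ 2 := by nlinarith
    exact mul_le_mul h2 (hup i hi) (by positivity) (by positivity)
  have hi2 : ∀ i ≤ k, (i:ℝ) ^ 2 * (M:ℝ) ^ i ≤ (k + 1 : ℝ) ^ 2 * (M:ℝ) ^ k := by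
    intro i hi
    have : (i:ℝ) ≤ k + 1 := by exact_mod_cast (by omega : i ≤ k + 1)
    exact mul_le_mul (by gcongr) (hup i hi) (by positivity) (by positivity)
  have hcast : ∀ m : ℕ, (((m + 1 : ℕ):ℤ):ℝ) = (m:ℝ) + 1 := by intro m; push_cast; rfl
  refine ⟨?_, ?_, ?_, ?_⟩
  · intro m hm
    rw [deval_sum hg]
    refine (poly_lin hg M _ _ hM0 ?_).trans hkN
    intro i hi
    refine le_trans ?_ (hi1 i hi)
    have hmM : (m:ℝ) ≤ M := by exact_mod_cast hm
    rw [Int.cast_natCast, abs_of_nonneg (by positivity)]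
    rcases i with _ | i
    · simp
    · simp only [Nat.add_sub_cancel]
      have : (m:ℝ) ^ i ≤ (M:ℝ) ^ i := pow_le_pow_left₀ (by positivity) hmM _
      rw [pow_succ]
      have h3 : (0:ℝ) ≤ M * ((i + 1 : ℕ):ℝ) := by positivity
      nlinarith
  · intro m hm
    have hmM : (m:ℝ) + 1 ≤ M := by exact_mod_cast hm
    rw [eval_sum hg, eval_sum hg, ← Finset.sum_sub_distrib]
    simp only [← mul_sub]
    refine (poly_lin hg M _ _ hM0 ?_).trans hkN
    intro i hi
    refine le_trans ?_ (hi1 i hi)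
    have h := mono_D M (m + 1) (by have : (0:ℝ) ≤ m := by positivity
                                   linarith) hmM i
    rw [hcast, Int.cast_natCast]
    rw [add_sub_cancel_right] at h
    rw [abs_of_nonneg h.1]
    exact h.2
  · intro m hm
    have hmM : (m:ℝ) + 1 ≤ M := by exact_mod_cast hm
    rw [deval_sum hg, deval_sum hg, ← Finset.sum_sub_distrib]
    simp only [← mul_sub]
    refine (poly_lin hg M _ _ (by positivity) ?_).trans hkN
    intro i hi
    refine le_trans ?_ (hi2 i hi)
    have h := mono_D M (m + 1) (by have : (0:ℝ) ≤ m := by positivity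
                                   linarith) hmM (i - 1)
    rw [hcast, Int.cast_natCast]
    rw [add_sub_cancel_right] at h
    rw [abs_mul, abs_of_nonneg h.1, abs_of_nonneg (by positivity : (0:ℝ) ≤ (i:ℝ))]
    rcases i with _ | i
    · simp
    · simp only [Nat.add_sub_cancel] at h ⊢
      have h5 := mul_le_mul_of_nonneg_left h.2 (mul_nonneg hM0 (by positivity : (0:ℝ) ≤ ((i + 1 : ℕ):ℝ)))
      have h6 : (0:ℝ) ≤ M * M ^ i := by positivity
      have h7 : (0:ℝ) ≤ i := by positivity
      rw [pow_succ (M:ℝ) i]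
      push_cast at h5 ⊢
      nlinarith
  · intro m hm
    have hmM : (m:ℝ) + 1 ≤ M := by exact_mod_cast hm
    rw [deval_sum hg, eval_sum hg, eval_sum hg, ← Finset.sum_sub_distrib, ← Finset.sum_sub_distrib]
    simp only [← mul_sub]
    refine (poly_lin hg M _ _ (by positivity) ?_).trans hkN
    intro i hi
    refine le_trans ?_ (hi2 i hi)
    have h := mono_E M (m + 1) (by have : (0:ℝ) ≤ m := by positivity
                                   linarith) hmM i
    rw [hcast, Int.cast_natCast]
    rw [add_sub_cancel_right] at h
    rw [abs_of_nonneg h.1]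
    exact h.2

theorem tel_Icc (f : ℕ → ℂ) (M : ℕ) : ∑ m ∈ Finset.Icc 1 M, (f m - f (m - 1)) = f M - f 0 := by
  induction M with
  | zero => simp
  | succ M ih => rw [Finset.sum_Icc_succ_top (by omega), ih, Nat.add_sub_cancel]; ring

noncomputable def FF (g : Polynomial ℤ) (β : ℝ) (m : ℕ) : ℂ :=
  ((((Polynomial.derivative g).eval (m:ℤ) : ℤ):ℝ):ℂ) * e (β * ((g.eval (m:ℤ) : ℤ):ℝ))

noncomputable def VV (k C : ℕ) (N : ℝ) (M : ℕ) (β : ℝ) : ℝ := KA k C * N / M * (2 + 20 * KA k C * |β| * N)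

theorem FF_bounds {k C : ℕ} {g : Polynomial ℤ} (hk : 1 ≤ k) (hg : Good k C g) (N : ℝ) (M : ℕ) (hM : 1 ≤ M)
    (hN : (g.leadingCoeff:ℝ) * (M:ℝ) ^ k ≤ N) (β : ℝ) :
    (∀ m ≤ M, ‖FF g β m‖ ≤ KA k C * N / M) ∧
    ‖FF g β M‖ + ∑ m ∈ Finset.Ico 1 M, ‖FF g β (m + 1) - FF g β m‖ ≤ VV k C N M β ∧
    (β ≠ 0 → ‖∑ m ∈ Finset.Icc 1 M, FF g β m‖ ≤ 1 / (Real.pi * |β|) + VV k C N M β) ∧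
    ‖∑ m ∈ Finset.Icc 1 M, FF g β m‖ ≤ KA k C * N := by
  obtain ⟨b1, b2, b3, b4⟩ := g_bounds hk hg N M hM hN
  have hM0 : (0:ℝ) < M := by exact_mod_cast hM
  set K := KA k C with hK
  have hKN : 0 ≤ K * N := le_trans (by positivity) (b1 0 (by omega))
  have hpi := Real.pi_pos
  have hpi4 := Real.pi_le_four
  have hpi3 : Real.pi < 3.15 := Real.pi_lt_d2
  have c1 : ∀ m ≤ M, ‖FF g β m‖ ≤ K * N / M := by
    intro m hm
    unfold FF
    rw [norm_mul, norm_e, mul_one, Complex.norm_real, Real.norm_eq_abs, le_div_iff₀ hM0, mul_comm]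
    exact b1 m hm
  have hKNM : 0 ≤ K * N / M := by positivity
  refine ⟨c1, ?_, ?_, ?_⟩
  · have hd : ∀ m ∈ Finset.Ico 1 M, ‖FF g β (m + 1) - FF g β m‖ ≤ K * N / M ^ 2 + K * N / M * (2 * Real.pi * (|β| * (K * N / M))) := by
      intro m hm
      have hm' : m + 1 ≤ M := (Finset.mem_Ico.mp hm).2
      unfold FF
      set x := (((Polynomial.derivative g).eval ((m + 1 : ℕ):ℤ) : ℤ):ℝ)
      set y := (((Polynomial.derivative g).eval (m:ℤ) : ℤ):ℝ)
      set u := ((g.eval ((m + 1 : ℕ):ℤ) : ℤ):ℝ)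
      set w := ((g.eval (m:ℤ) : ℤ):ℝ)
      have e1 : (x:ℂ) * e (β * u) - (y:ℂ) * e (β * w) = ((x - y : ℝ):ℂ) * e (β * u) + (y:ℂ) * (e (β * u) - e (β * w)) := by
        push_cast; ring
      rw [e1]
      refine (norm_add_le _ _).trans ?_
      rw [norm_mul, norm_mul, norm_e, mul_one, Complex.norm_real, Complex.norm_real, Real.norm_eq_abs, Real.norm_eq_abs]
      have h1 : |x - y| ≤ K * N / M ^ 2 := by
        rw [le_div_iff₀ (by positivity), mul_comm]; exact b3 m hm'
      have h2 : |y| ≤ K * N / M := by rw [le_div_iff₀ hM0, mul_comm]; exact b1 m (by omega)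
      have h3 : |u - w| ≤ K * N / M := by rw [le_div_iff₀ hM0, mul_comm]; exact b2 m hm'
      have h4 : ‖e (β * u) - e (β * w)‖ ≤ 2 * Real.pi * (|β| * (K * N / M)) := by
        refine (norm_e_sub_e_le _ _).trans ?_
        rw [← mul_sub, abs_mul]
        gcongr
      gcongr
    refine (add_le_add (c1 M le_rfl) (Finset.sum_le_sum hd)).trans ?_
    rw [Finset.sum_const, Nat.card_Ico, nsmul_eq_mul]
    have hcard : ((M - 1 : ℕ):ℝ) ≤ M := by exact_mod_cast Nat.sub_le M 1
    have hpos : 0 ≤ K * N / (M:ℝ) ^ 2 + K * N / M * (2 * Real.pi * (|β| * (K * N / M))) := by positivity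
    refine (add_le_add le_rfl (mul_le_mul_of_nonneg_right hcard hpos)).trans ?_
    unfold VV
    rw [← hK]
    have e2 : K * N / M + M * (K * N / (M:ℝ) ^ 2 + K * N / M * (2 * Real.pi * (|β| * (K * N / M))))
        = K * N / M * (2 + (2 * Real.pi) * (|β| * (K * N))) := by
      field_simp; ring
    rw [e2]
    apply mul_le_mul_of_nonneg_left _ hKNM
    have : 0 ≤ |β| * (K * N) := by positivity
    nlinarith
  · intro hβ
    have hβ0 : 0 < |β| := abs_pos.mpr hβ
    have htel := tel_Icc (fun m : ℕ => e (β * ((g.eval (m:ℤ) : ℤ):ℝ))) M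
    have herr : ∀ m ∈ Finset.Icc 1 M, ‖(2 * Real.pi * Complex.I * β : ℂ) * FF g β m - (e (β * ((g.eval (m:ℤ) : ℤ):ℝ)) - e (β * ((g.eval ((m - 1 : ℕ):ℤ) : ℤ):ℝ)))‖
        ≤ 2 * Real.pi * |β| * (K * N / M ^ 2) + 3 * (2 * Real.pi * (|β| * (K * N / M))) ^ 2 := by
      intro m hm
      obtain ⟨hm1, hm2⟩ := Finset.mem_Icc.mp hm
      obtain ⟨m, rfl⟩ : ∃ m', m = m' + 1 := ⟨m - 1, by omega⟩
      have B2 := b2 m hm2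
      have B4 := b4 m hm2
      rw [Nat.add_sub_cancel]
      unfold FF
      generalize (((Polynomial.derivative g).eval ((m + 1 : ℕ):ℤ) : ℤ):ℝ) = x at *
      generalize ((g.eval ((m + 1 : ℕ):ℤ) : ℤ):ℝ) = u at *
      generalize ((g.eval (m:ℤ) : ℤ):ℝ) = w at *
      have ew : e (β * w) = e (β * u) * e (β * (w - u)) := by rw [← e_add]; congr 1; ring
      have e1 : (2 * Real.pi * Complex.I * β : ℂ) * ((x:ℂ) * e (β * u)) - (e (β * u) - e (β * w))
          = (2 * Real.pi * Complex.I * β : ℂ) * ((x - (u - w) : ℝ):ℂ) * e (β * u)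
            + e (β * u) * (e (β * (w - u)) - 1 - 2 * Real.pi * Complex.I * ((β * (w - u) : ℝ):ℂ)) := by
        rw [ew]; push_cast; ring
      rw [e1]
      refine (norm_add_le _ _).trans ?_
      have n1 : ‖(2 * Real.pi * Complex.I * β : ℂ)‖ = 2 * Real.pi * |β| := by
        simp [abs_of_pos hpi]
      have n2 : ‖(2 * Real.pi * Complex.I * β : ℂ) * ((x - (u - w) : ℝ):ℂ) * e (β * u)‖ = 2 * Real.pi * |β| * |x - (u - w)| := by
        rw [norm_mul, norm_e, mul_one, norm_mul, n1, Complex.norm_real, Real.norm_eq_abs]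
      rw [n2, norm_mul, norm_e, one_mul]
      have h1 : |x - (u - w)| ≤ K * N / M ^ 2 := by
        rw [le_div_iff₀ (by positivity), mul_comm]; exact B4
      have h3 : |w - u| ≤ K * N / M := by rw [abs_sub_comm, le_div_iff₀ hM0, mul_comm]; exact B2
      have h4 := norm_e_taylor (β * (w - u))
      rw [abs_mul] at h4
      have h5 : 3 * (2 * Real.pi * (|β| * |w - u|)) ^ 2 ≤ 3 * (2 * Real.pi * (|β| * (K * N / M))) ^ 2 := by gcongr
      have h6 : 2 * Real.pi * |β| * |x - (u - w)| ≤ 2 * Real.pi * |β| * (K * N / M ^ 2) := by gcongr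
      exact add_le_add h6 (h4.trans h5)
    have hsum := (norm_sum_le _ _).trans (Finset.sum_le_sum herr)
    rw [Finset.sum_sub_distrib, htel, ← Finset.mul_sum, Finset.sum_const, Nat.card_Icc, nsmul_eq_mul, Nat.add_sub_cancel] at hsum
    have n1 : ‖(2 * Real.pi * Complex.I * β : ℂ)‖ = 2 * Real.pi * |β| := by
      simp [abs_of_pos hpi]
    have h7 : 2 * Real.pi * |β| * ‖∑ m ∈ Finset.Icc 1 M, FF g β m‖ ≤ 2 + M * (2 * Real.pi * |β| * (K * N / M ^ 2) + 3 * (2 * Real.pi * (|β| * (K * N / M))) ^ 2) := by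
      have e5 : 2 * Real.pi * |β| * ‖∑ m ∈ Finset.Icc 1 M, FF g β m‖ = ‖(2 * Real.pi * Complex.I * β : ℂ) * ∑ m ∈ Finset.Icc 1 M, FF g β m‖ := by
        rw [norm_mul, n1]
      rw [e5]
      refine (norm_le_insert' _ (e (β * ((g.eval (M:ℤ) : ℤ):ℝ)) - e (β * ((g.eval ((0 : ℕ):ℤ) : ℤ):ℝ)))).trans ?_
      have h8 := norm_sub_le (e (β * ((g.eval (M:ℤ) : ℤ):ℝ))) (e (β * ((g.eval ((0 : ℕ):ℤ) : ℤ):ℝ)))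
      rw [norm_e, norm_e] at h8
      refine (add_le_add h8 hsum).trans (le_of_eq ?_)
      ring
    have h9 : 2 * Real.pi * |β| * ‖∑ m ∈ Finset.Icc 1 M, FF g β m‖ ≤ 2 * Real.pi * |β| * (1 / (Real.pi * |β|) + VV k C N M β) := by
      refine h7.trans ?_
      unfold VV
      rw [← hK]
      have e2 : 2 + M * (2 * Real.pi * |β| * (K * N / (M:ℝ) ^ 2) + 3 * (2 * Real.pi * (|β| * (K * N / M))) ^ 2)
          = 2 * Real.pi * |β| * (1 / (Real.pi * |β|) + K * N / M * (1 + 6 * Real.pi * (|β| * (K * N)))) := by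
        field_simp; ring
      rw [e2]
      apply mul_le_mul_of_nonneg_left _ (by positivity)
      apply add_le_add le_rfl
      apply mul_le_mul_of_nonneg_left _ hKNM
      have : 0 ≤ |β| * (K * N) := by positivity
      nlinarith
    exact le_of_mul_le_mul_left h9 (by positivity)
  · refine (norm_sum_le _ _).trans ((Finset.sum_le_sum (fun m hm => c1 m (Finset.mem_Icc.mp hm).2)).trans ?_)
    rw [Finset.sum_const, Nat.card_Icc, nsmul_eq_mul, Nat.add_sub_cancel]
    rw [mul_div_cancel₀ _ hM0.ne']

def badp (g : Polynomial ℤ) (m p : ℕ) : Prop := ((p ^ gammaExp g p : ℕ):ℤ) ∣ (Polynomial.derivative g).eval (m:ℤ)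

open scoped Classical in
noncomputable def indA (g : Polynomial ℤ) (S : Finset ℕ) (m : ℕ) : ℝ := if ∀ p ∈ S, badp g m p then 1 else 0

noncomputable def DS (g : Polynomial ℤ) (S : Finset ℕ) : ℕ := ∏ p ∈ S, p ^ gammaExp g p

noncomputable def xS (g : Polynomial ℤ) (S : Finset ℕ) : ℝ := ∏ p ∈ S, xg g p

noncomputable def fam (Y : ℝ) (t : ℕ) : Finset (Finset ℕ) := (prY Y).powerset.filter (fun S => S.card < t)

theorem indA_eq (g : Polynomial ℤ) (S : Finset ℕ) (m : ℕ) : indA g S m = ∏ p ∈ S, (open scoped Classical in if badp g m p then (1:ℝ) else 0) := by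
  classical
  unfold indA
  rw [Finset.prod_ite_zero]
  simp

theorem indA_nonneg (g : Polynomial ℤ) (S : Finset ℕ) (m : ℕ) : 0 ≤ indA g S m := by
  unfold indA; split_ifs <;> norm_num
theorem indA_le (g : Polynomial ℤ) (S : Finset ℕ) (m : ℕ) : indA g S m ≤ 1 := by
  unfold indA; split_ifs <;> norm_num

theorem norm_indA (g : Polynomial ℤ) (S : Finset ℕ) (m : ℕ) : ‖(indA g S m : ℂ)‖ = indA g S m := by
  rw [Complex.norm_real, Real.norm_eq_abs, abs_of_nonneg (indA_nonneg g S m)]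

theorem indA_periodic (g : Polynomial ℤ) (S : Finset ℕ) : Function.Periodic (fun m => (indA g S m : ℂ)) (DS g S) := by
  classical
  have h := periodic_prod S (fun p m => if badp g m p then (1:ℂ) else 0) (fun p => p ^ gammaExp g p)
    (fun p _ => by convert bad_periodic g (p ^ gammaExp g p) using 1; funext m; unfold badp; congr)
  have e1 : (fun m => (indA g S m : ℂ)) = fun m => ∏ p ∈ S, (if badp g m p then (1:ℂ) else 0) := by
    funext m; rw [indA_eq]; push_cast; apply Finset.prod_congr rfl; intro p _; split_ifs <;> simp
  rw [e1]; exact h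

theorem indA_mean (g : Polynomial ℤ) (S : Finset ℕ) (hS : ∀ p ∈ S, p.Prime) : pmean (fun m => (indA g S m : ℂ)) (DS g S) = (xS g S : ℂ) := by
  classical
  have h := pmean_prod S (fun p m => if badp g m p then (1:ℂ) else 0) (fun p => p ^ gammaExp g p)
    (fun p hp => pow_pos (hS p hp).pos _) (fun p _ => by convert bad_periodic g (p ^ gammaExp g p) using 1; funext m; unfold badp; congr) (by
      intro p hp p' hp' hne
      exact Nat.Coprime.pow _ _ ((Nat.coprime_primes (hS p hp) (hS p' hp')).mpr hne))
  have e1 : (fun m => (indA g S m : ℂ)) = fun m => ∏ p ∈ S, (if badp g m p then (1:ℂ) else 0) := by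
    funext m; rw [indA_eq]; push_cast; apply Finset.prod_congr rfl; intro p _; split_ifs <;> simp
  rw [e1]
  unfold DS xS
  rw [h]
  push_cast
  apply Finset.prod_congr rfl
  intro p _
  convert bad_mean g p using 1
  congr 1; funext m; unfold badp; congr

theorem indW_bonf (g : Polynomial ℤ) (Y : ℝ) (hY : 0 ≤ Y) (t : ℕ) (ht : 1 ≤ t) (m : ℕ) :
    ‖indW g Y m - ∑ S ∈ fam Y t, (-1 : ℂ) ^ S.card * (indA g S m : ℂ)‖ ≤ ∑ S ∈ (prY Y).powersetCard t, indA g S m := by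
  classical
  have h := bonf (prY Y) (badp g m) t ht
  have e1 : indW g Y m = ((if ∀ p ∈ prY Y, ¬ badp g m p then (1:ℝ) else 0 : ℝ):ℂ) := by
    unfold indW
    have : (m:ℤ) ∈ WSet g Y ↔ ∀ p ∈ prY Y, ¬ badp g m p := by
      constructor
      · intro h p hp hb
        obtain ⟨h1, h2⟩ := (mem_prY hY p).mp hp
        exact h p h1 h2 (by unfold badp at hb; push_cast at hb; exact hb)
      · intro h p h1 h2 hb
        exact h p ((mem_prY hY p).mpr ⟨h1, h2⟩) (by unfold badp; push_cast; exact hb)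
    simp only [this]
    split_ifs <;> simp
  have e2 : indW g Y m - ∑ S ∈ fam Y t, (-1 : ℂ) ^ S.card * (indA g S m : ℂ) =
      (((if ∀ p ∈ prY Y, ¬ badp g m p then (1:ℝ) else 0) -
      ∑ S ∈ (prY Y).powerset.filter (fun S => S.card < t), (-1 : ℝ) ^ S.card * (if ∀ p ∈ S, badp g m p then 1 else 0) : ℝ):ℂ) := by
    rw [e1]; unfold fam indA; push_cast
    congr 1
  rw [e2, Complex.norm_real, Real.norm_eq_abs]
  refine h.trans (le_of_eq ?_)
  apply Finset.sum_congr rfl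
  intro S _
  unfold indA
  split_ifs <;> rfl

noncomputable def epsB (g : Polynomial ℤ) (Y : ℝ) (t : ℕ) : ℝ := Real.exp (-(2 * t)) * Real.exp (8 * ∑ p ∈ prY Y, xg g p)

theorem xS_le (g : Polynomial ℤ) (Y : ℝ) (t : ℕ) : ∑ S ∈ (prY Y).powersetCard t, xS g S ≤ epsB g Y t :=
  rankin (prY Y) (xg g) (fun p _ => xg_nonneg g p) t

theorem prime_sub {Y : ℝ} (hY : 0 ≤ Y) {S : Finset ℕ} (hS : S ⊆ prY Y) : ∀ p ∈ S, p.Prime :=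
  fun p hp => ((mem_prY hY p).mp (hS hp)).1

theorem bonf_mean (g : Polynomial ℤ) (Y : ℝ) (hY : 0 ≤ Y) (t : ℕ) (ht : 1 ≤ t) (u : ℕ → ℂ) (hu : ∀ m, ‖u m‖ ≤ 1)
    (R : ℕ) (hR : 0 < R) (hD : (∏ p ∈ prY Y, p ^ gammaExp g p) ∣ R) :
    ‖pmean (fun m => indW g Y m * u m) R - ∑ S ∈ fam Y t, (-1 : ℂ) ^ S.card * pmean (fun m => (indA g S m : ℂ) * u m) R‖ ≤ epsB g Y t := by
  classical
  refine le_trans ?_ (xS_le g Y t)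
  have e1 : pmean (fun m => indW g Y m * u m) R - ∑ S ∈ fam Y t, (-1 : ℂ) ^ S.card * pmean (fun m => (indA g S m : ℂ) * u m) R
      = pmean (fun m => (indW g Y m - ∑ S ∈ fam Y t, (-1 : ℂ) ^ S.card * (indA g S m : ℂ)) * u m) R := by
    unfold pmean
    simp only [sub_mul, Finset.sum_mul, Finset.sum_sub_distrib, sub_div]
    congr 1
    rw [Finset.sum_comm, Finset.sum_div]
    apply Finset.sum_congr rfl
    intro S _
    rw [← mul_div_assoc, Finset.mul_sum]
    congr 1
    apply Finset.sum_congr rfl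
    intro m _
    ring
  rw [e1]
  refine (norm_pmean_le _ _ (fun m => ∑ S ∈ (prY Y).powersetCard t, indA g S m) ?_).trans (le_of_eq ?_)
  · intro m
    rw [norm_mul]
    have h1 := indW_bonf g Y hY t ht m
    calc _ ≤ (∑ S ∈ (prY Y).powersetCard t, indA g S m) * 1 :=
          mul_le_mul h1 (hu m) (norm_nonneg _) ((norm_nonneg _).trans h1)
      _ = _ := mul_one _
  · rw [Finset.sum_comm, Finset.sum_div]
    apply Finset.sum_congr rfl
    intro S hS
    rw [Finset.mem_powersetCard] at hS
    have h1 := indA_mean g S (prime_sub hY hS.1)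
    have hDS : DS g S ∣ R := (Finset.prod_dvd_prod_of_subset _ _ _ hS.1).trans hD
    rw [← pmean_eq_of_dvd _ _ R (indA_periodic g S) hDS hR] at h1
    unfold pmean at h1
    have h2 : (((∑ m ∈ Finset.range R, indA g S m) / (R:ℝ) : ℝ):ℂ) = ((xS g S : ℝ):ℂ) := by
      rw [← h1]; push_cast; rfl
    exact_mod_cast h2

theorem bonf_sum (g : Polynomial ℤ) (Y : ℝ) (hY : 0 ≤ Y) (t : ℕ) (ht : 1 ≤ t) (u : ℕ → ℂ) (B : ℝ) (M : ℕ) (hu : ∀ m ≤ M, ‖u m‖ ≤ B)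
    (D : ℕ) (hD : ∀ S ∈ (prY Y).powersetCard t, DS g S ≤ D) (hc : ((prY Y).powersetCard t).card ≤ D) :
    ‖∑ m ∈ Finset.Icc 1 M, indW g Y m * u m - ∑ S ∈ fam Y t, (-1 : ℂ) ^ S.card * ∑ m ∈ Finset.Icc 1 M, (indA g S m : ℂ) * u m‖ ≤
      B * (M * epsB g Y t + 4 * D * D) := by
  classical
  have hB : 0 ≤ B := (norm_nonneg _).trans (hu 0 (by omega))
  have e1 : ∑ m ∈ Finset.Icc 1 M, indW g Y m * u m - ∑ S ∈ fam Y t, (-1 : ℂ) ^ S.card * ∑ m ∈ Finset.Icc 1 M, (indA g S m : ℂ) * u m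
      = ∑ m ∈ Finset.Icc 1 M, (indW g Y m - ∑ S ∈ fam Y t, (-1 : ℂ) ^ S.card * (indA g S m : ℂ)) * u m := by
    simp only [sub_mul, Finset.sum_mul, Finset.sum_sub_distrib]
    congr 1
    rw [Finset.sum_comm]
    apply Finset.sum_congr rfl
    intro S _
    rw [Finset.mul_sum]
    apply Finset.sum_congr rfl
    intro m _
    ring
  rw [e1]
  calc _ ≤ ∑ m ∈ Finset.Icc 1 M, (∑ S ∈ (prY Y).powersetCard t, indA g S m) * B := by
        refine (norm_sum_le _ _).trans (Finset.sum_le_sum ?_)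
        intro m hm
        rw [norm_mul]
        have h1 := indW_bonf g Y hY t ht m
        exact mul_le_mul h1 (hu m (Finset.mem_Icc.mp hm).2) (norm_nonneg _) ((norm_nonneg _).trans h1)
    _ = B * ∑ S ∈ (prY Y).powersetCard t, ∑ m ∈ Finset.Icc 1 M, indA g S m := by
        rw [← Finset.sum_mul, Finset.sum_comm, mul_comm]
    _ ≤ B * ∑ S ∈ (prY Y).powersetCard t, (M * xS g S + 4 * D) := by
        apply mul_le_mul_of_nonneg_left _ hB
        apply Finset.sum_le_sum
        intro S hS
        have hS' := Finset.mem_powersetCard.mp hS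
        have hpr := prime_sub hY hS'.1
        have hpos : 0 < DS g S := Finset.prod_pos fun p hp => pow_pos (hpr p hp).pos _
        have h1 := partial_sum' (fun m => (indA g S m : ℂ)) (DS g S) hpos (indA_periodic g S)
          (fun m => by rw [norm_indA]; exact indA_le g S m) M
        rw [indA_mean g S hpr, Finset.sum_sub_distrib, Finset.sum_const, Nat.card_Icc, Nat.add_sub_cancel, nsmul_eq_mul] at h1
        have h2 : ‖(((∑ m ∈ Finset.Icc 1 M, indA g S m) - M * xS g S : ℝ):ℂ)‖ ≤ 4 * DS g S := by
          push_cast; exact h1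
        rw [Complex.norm_real, Real.norm_eq_abs] at h2
        have h3 : (DS g S : ℝ) ≤ D := by exact_mod_cast hD S hS
        have := le_abs_self ((∑ m ∈ Finset.Icc 1 M, indA g S m) - M * xS g S)
        linarith
    _ ≤ _ := by
        apply mul_le_mul_of_nonneg_left _ hB
        rw [Finset.sum_add_distrib, ← Finset.mul_sum, Finset.sum_const, nsmul_eq_mul]
        have h1 := xS_le g Y t
        have h2 : (((prY Y).powersetCard t).card : ℝ) ≤ D := by exact_mod_cast hc
        have h3 : (0:ℝ) ≤ 4 * D := by positivity
        have h4 : (0:ℝ) ≤ M := by positivity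
        nlinarith

structure SizeOK (g : Polynomial ℤ) (Y : ℝ) (t D : ℕ) : Prop where
  ds : ∀ S ⊆ prY Y, S.card ≤ t → DS g S ≤ D
  c1 : (fam Y t).card ≤ D
  c2 : ((prY Y).powersetCard t).card ≤ D

theorem mem_fam {Y : ℝ} {t : ℕ} {S : Finset ℕ} : S ∈ fam Y t ↔ S ⊆ prY Y ∧ S.card < t := by
  unfold fam; rw [Finset.mem_filter, Finset.mem_powerset]

theorem bonf_sum' {g : Polynomial ℤ} {Y : ℝ} (hY : 0 ≤ Y) {t D : ℕ} (ht : 1 ≤ t) (hD : SizeOK g Y t D) (u : ℕ → ℂ) (B : ℝ) (M : ℕ) (hu : ∀ m ≤ M, ‖u m‖ ≤ B) :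
    ‖∑ m ∈ Finset.Icc 1 M, indW g Y m * u m - ∑ S ∈ fam Y t, (-1 : ℂ) ^ S.card * ∑ m ∈ Finset.Icc 1 M, (indA g S m : ℂ) * u m‖ ≤
      B * (M * epsB g Y t + 4 * D * D) := by
  apply bonf_sum g Y hY t ht u B M hu D _ hD.c2
  intro S hS
  rw [Finset.mem_powersetCard] at hS
  exact hD.ds S hS.1 hS.2.le

theorem norm_fam_sum {Y : ℝ} {t D : ℕ} (hc : (fam Y t).card ≤ D) (f : Finset ℕ → ℂ) (E : ℝ) (hE : 0 ≤ E) (h : ∀ S ∈ fam Y t, ‖f S‖ ≤ E) :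
    ‖∑ S ∈ fam Y t, (-1 : ℂ) ^ S.card * f S‖ ≤ D * E := by
  refine (norm_sum_le_of_le _ (f := fun S => (-1 : ℂ) ^ S.card * f S) (n := fun _ => E) ?_).trans ?_
  · intro S hS
    rw [norm_mul, norm_pow, norm_neg, norm_one, one_pow, one_mul]
    exact h S hS
  · rw [Finset.sum_const, nsmul_eq_mul]
    have : ((fam Y t).card : ℝ) ≤ D := by exact_mod_cast hc
    gcongr

theorem major {k C : ℕ} {g : Polynomial ℤ} (hk : 1 ≤ k) (hg : Good k C g) (N : ℝ) (M : ℕ) (hM : 1 ≤ M)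
    (hN : (g.leadingCoeff:ℝ) * (M:ℝ) ^ k ≤ N) (β : ℝ) {Y : ℝ} (hY : 0 ≤ Y) {t D : ℕ} (ht : 1 ≤ t) (hD : SizeOK g Y t D)
    (q : ℕ) (hq : 0 < q) (a : ℤ) (R : ℕ) (hR : 0 < R) (hqR : q ∣ R) (hDR : (∏ p ∈ prY Y, p ^ gammaExp g p) ∣ R) :
    ‖∑ m ∈ Finset.Icc 1 M, indW g Y m * (ev g a q m * FF g β m)‖ ≤
      (‖pmean (fun m => indW g Y m * ev g a q m) R‖ + epsB g Y t) * ‖∑ m ∈ Finset.Icc 1 M, FF g β m‖ +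
      D * (4 * q * D * VV k C N M β) + KA k C * N / M * (M * epsB g Y t + 4 * D * D) := by
  obtain ⟨F1, F2, F3, F4⟩ := FF_bounds hk hg N M hM hN β
  set Φ := ∑ m ∈ Finset.Icc 1 M, FF g β m with hΦ
  set mu := pmean (fun m => indW g Y m * ev g a q m) R with hmu
  set V := VV k C N M β with hV
  have hV0 : 0 ≤ V := le_trans (by positivity) F2
  have h1 := bonf_sum' hY ht hD (fun m => ev g a q m * FF g β m) (KA k C * N / M) M (by
    intro m hm; rw [norm_mul, norm_ev, one_mul]; exact F1 m hm)
  have h2 := bonf_mean g Y hY t ht (ev g a q) (fun m => (norm_ev g a q m).le) R hR hDR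
  have h3 : ∀ S ∈ fam Y t, ‖∑ m ∈ Finset.Icc 1 M, (indA g S m : ℂ) * (ev g a q m * FF g β m) -
      pmean (fun m => (indA g S m : ℂ) * ev g a q m) R * Φ‖ ≤ 4 * q * D * V := by
    intro S hS
    rw [mem_fam] at hS
    have hpr := prime_sub hY hS.1
    have hpos : 0 < DS g S := Finset.prod_pos fun p hp => pow_pos (hpr p hp).pos _
    have hDS : DS g S ∣ R := (Finset.prod_dvd_prod_of_subset _ _ _ hS.1).trans hDR
    set l := Nat.lcm q (DS g S) with hl
    have hl0 : 0 < l := Nat.lcm_pos hq hpos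
    have hlR : l ∣ R := Nat.lcm_dvd hqR hDS
    set u : ℕ → ℂ := fun m => (indA g S m : ℂ) * ev g a q m with hu
    have hper : Function.Periodic u l :=
      (periodic_of_dvd _ _ l (indA_periodic g S) (Nat.dvd_lcm_right _ _)).mul
        (periodic_of_dvd _ _ l (ev_periodic g a q hq) (Nat.dvd_lcm_left _ _))
    have hu1 : ∀ m, ‖u m‖ ≤ 1 := by
      intro m; simp only [hu]; rw [norm_mul, norm_ev, mul_one, norm_indA]; exact indA_le g S m
    have hm := pmean_eq_of_dvd u l R hper hlR hR
    have hle : (l:ℝ) ≤ q * D := by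
      have a1 : l ≤ q * DS g S := Nat.le_of_dvd (by positivity) (Nat.lcm_dvd_mul _ _)
      have a2 := hD.ds S hS.1 hS.2.le
      exact_mod_cast a1.trans (Nat.mul_le_mul_left _ a2)
    have e1 : ∑ m ∈ Finset.Icc 1 M, (indA g S m : ℂ) * (ev g a q m * FF g β m) - pmean u R * Φ =
        ∑ m ∈ Finset.Icc 1 M, (u m - pmean u l) * FF g β m := by
      rw [hm, hΦ, Finset.mul_sum, ← Finset.sum_sub_distrib]
      apply Finset.sum_congr rfl
      intro m _
      simp only [hu]; ring
    rw [e1]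
    refine (abel_bound _ _ M (4 * l) (fun x _ => partial_sum' u l hl0 hper hu1 x)).trans ?_
    calc (4 * (l:ℝ)) * _ ≤ (4 * (q * D)) * V := by
          apply mul_le_mul (by linarith) F2 (by positivity) (by positivity)
      _ = _ := by ring
  have h4 := norm_fam_sum hD.c1 (fun S => ∑ m ∈ Finset.Icc 1 M, (indA g S m : ℂ) * (ev g a q m * FF g β m) -
      pmean (fun m => (indA g S m : ℂ) * ev g a q m) R * Φ) (4 * q * D * V) (by positivity) h3
  simp only [mul_sub, Finset.sum_sub_distrib] at h4
  set A := ∑ m ∈ Finset.Icc 1 M, indW g Y m * (ev g a q m * FF g β m)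
  set B := ∑ S ∈ fam Y t, (-1 : ℂ) ^ S.card * ∑ m ∈ Finset.Icc 1 M, (indA g S m : ℂ) * (ev g a q m * FF g β m)
  have e2 : ∑ S ∈ fam Y t, (-1 : ℂ) ^ S.card * (pmean (fun m => (indA g S m : ℂ) * ev g a q m) R * Φ) =
    (∑ S ∈ fam Y t, (-1 : ℂ) ^ S.card * pmean (fun m => (indA g S m : ℂ) * ev g a q m) R) * Φ := by
    rw [Finset.sum_mul]; apply Finset.sum_congr rfl; intro S _; ring
  rw [e2] at h4
  set P := ∑ S ∈ fam Y t, (-1 : ℂ) ^ S.card * pmean (fun m => (indA g S m : ℂ) * ev g a q m) R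
  have h5 : ‖P‖ ≤ ‖mu‖ + epsB g Y t := by
    have := norm_sub_norm_le P mu
    rw [norm_sub_rev] at this
    linarith
  have h6 : A = (A - B) + (B - P * Φ) + P * Φ := by ring
  rw [h6]
  refine (norm_add₃_le).trans ?_
  rw [norm_mul]
  have h7 : ‖P‖ * ‖Φ‖ ≤ (‖mu‖ + epsB g Y t) * ‖Φ‖ := by gcongr
  linarith

theorem minor {k C : ℕ} {g : Polynomial ℤ} (hk : 1 ≤ k) (hg : Good k C g) (N : ℝ) (M : ℕ) (hM : 1 ≤ M)
    (hN : (g.leadingCoeff:ℝ) * (M:ℝ) ^ k ≤ N) (γ : ℝ) {Y : ℝ} (hY : 0 ≤ Y) {t D : ℕ} (ht : 1 ≤ t) (hD : SizeOK g Y t D)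
    (E : ℝ) (hE0 : 0 ≤ E) (hE : ∀ S ∈ fam Y t, ∀ x ≤ M, ‖∑ m ∈ Finset.Icc 1 x, (indA g S m : ℂ) * e (γ * ((g.eval (m:ℤ) : ℤ):ℝ))‖ ≤ E) :
    ‖∑ m ∈ Finset.Icc 1 M, indW g Y m * FF g γ m‖ ≤
      D * (E * (KA k C * N / M * 2)) + KA k C * N / M * (M * epsB g Y t + 4 * D * D) := by
  obtain ⟨F1, F2, F3, F4⟩ := FF_bounds hk hg N M hM hN 0
  obtain ⟨G1, -⟩ := FF_bounds hk hg N M hM hN γ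
  have hV : VV k C N M 0 = KA k C * N / M * 2 := by unfold VV; rw [abs_zero]; ring
  rw [hV] at F2
  have hF0 : ∀ m, FF g 0 m = ((((Polynomial.derivative g).eval (m:ℤ) : ℤ):ℝ):ℂ) := by
    intro m; unfold FF; rw [zero_mul, e_zero, mul_one]
  have h1 := bonf_sum' hY ht hD (fun m => FF g γ m) (KA k C * N / M) M G1
  have h2 := norm_fam_sum hD.c1 (fun S => ∑ m ∈ Finset.Icc 1 M, (indA g S m : ℂ) * FF g γ m) (E * (KA k C * N / M * 2))
    (mul_nonneg hE0 (le_trans (by positivity) F2)) (by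
      intro S hS
      have h3 := abel_bound (fun m => (indA g S m : ℂ) * e (γ * ((g.eval (m:ℤ) : ℤ):ℝ))) (FF g 0) M E (hE S hS)
      refine le_trans (le_of_eq ?_) (h3.trans (mul_le_mul_of_nonneg_left F2 hE0))
      congr 1
      apply Finset.sum_congr rfl
      intro m _
      rw [hF0]; unfold FF; ring)
  set A := ∑ m ∈ Finset.Icc 1 M, indW g Y m * FF g γ m
  set B := ∑ S ∈ fam Y t, (-1 : ℂ) ^ S.card * ∑ m ∈ Finset.Icc 1 M, (indA g S m : ℂ) * FF g γ m
  have := norm_sub_norm_le A B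
  linarith

theorem ap_split (f : ℕ → ℂ) (X D s : ℕ) (hs : s < D) :
    ∃ L ≤ X, ∑ m ∈ (Finset.range X).filter (fun m : ℕ => m % D = s), f m = ∑ n ∈ Finset.range L, f (s + D * n) := by
  have hD : 0 < D := by omega
  have key : ∀ n, n < (X + (D - 1 - s)) / D ↔ s + D * n < X := by
    intro n
    rw [← Nat.succ_le_iff, Nat.le_div_iff_mul_le hD, Nat.succ_mul, mul_comm n D]
    omega
  refine ⟨(X + (D - 1 - s)) / D, ?_, ?_⟩
  · by_contra hc
    push Not at hc
    have := (key X).mp hc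
    nlinarith
  · apply Finset.sum_nbij' (fun m => m / D) (fun n => s + D * n)
    · intro m hm
      rw [Finset.mem_filter, Finset.mem_range] at hm
      rw [Finset.mem_range, key]
      have := Nat.mod_add_div m D
      rw [hm.2] at this; omega
    · intro n hn
      rw [Finset.mem_range, key] at hn
      rw [Finset.mem_filter, Finset.mem_range]
      exact ⟨hn, by rw [Nat.add_mul_mod_self_left, Nat.mod_eq_of_lt hs]⟩
    · intro m hm
      rw [Finset.mem_filter, Finset.mem_range] at hm
      have := Nat.mod_add_div m D
      rw [hm.2] at this; exact this
    · intro n _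
      rw [Nat.add_mul_div_left _ _ hD, Nat.div_eq_of_lt hs, zero_add]
    · intro m hm
      rw [Finset.mem_filter, Finset.mem_range] at hm
      have := Nat.mod_add_div m D
      rw [hm.2] at this; rw [this]

theorem weyl_ap (k : ℕ) (hk : 1 ≤ k) : ∃ Cw : ℕ, 1 ≤ Cw ∧ ∀ T : ℝ, 1 ≤ T → ∀ g : Polynomial ℤ, g.natDegree = k → ∀ S : Finset ℕ, 0 < DS g S →
    ∀ M : ℕ, ∀ γ : ℝ, (∀ x ≤ M, ‖∑ m ∈ Finset.Icc 1 x, (indA g S m : ℂ) * e (γ * ((g.eval (m:ℤ) : ℤ):ℝ))‖ ≤ DS g S * (M + 1) / T + 1) ∨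
    ∃ q : ℕ, 1 ≤ q ∧ (q:ℝ) ≤ Cw * T ^ Cw ∧ ∃ a : ℤ, |q * (γ * g.leadingCoeff * DS g S ^ k) - a| ≤ Cw * T ^ Cw / (M + 1) ^ k := by
  classical
  obtain ⟨Cw, hCw, H⟩ := weyl k hk
  refine ⟨Cw, hCw, ?_⟩
  intro T hT g hgk S hD M γ
  by_cases hall : ∀ x ≤ M, ‖∑ m ∈ Finset.Icc 1 x, (indA g S m : ℂ) * e (γ * ((g.eval (m:ℤ) : ℤ):ℝ))‖ ≤ DS g S * (M + 1) / T + 1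
  · exact Or.inl hall
  right
  push Not at hall
  obtain ⟨x, hx, hlt⟩ := hall
  set D := DS g S with hDd
  set f : ℕ → ℂ := fun m => (indA g S m : ℂ) * e (γ * ((g.eval (m:ℤ) : ℤ):ℝ)) with hf
  have hf1 : ‖f 0‖ ≤ 1 := by simp only [hf]; rw [norm_mul, norm_e, mul_one, norm_indA]; exact indA_le g S 0
  have e1 : ∑ m ∈ Finset.range (x + 1), f m = f 0 + ∑ m ∈ Finset.Icc 1 x, f m := by
    have : Finset.range (x + 1) = insert 0 (Finset.Icc 1 x) := by
      ext m; simp only [Finset.mem_range, Finset.mem_insert, Finset.mem_Icc]; omega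
    rw [this, Finset.sum_insert (by simp)]
  have e2 : ∑ m ∈ Finset.range (x + 1), f m = ∑ s ∈ Finset.range D, ∑ m ∈ (Finset.range (x + 1)).filter (fun m : ℕ => m % D = s), f m := by
    symm
    apply Finset.sum_fiberwise_of_maps_to
    intro m _; exact Finset.mem_range.mpr (Nat.mod_lt _ hD)
  have h1 : D * (M + 1) / T < ‖∑ m ∈ Finset.range (x + 1), f m‖ := by
    have a1 : ∑ m ∈ Finset.Icc 1 x, f m = ∑ m ∈ Finset.range (x + 1), f m - f 0 := by rw [e1]; ring
    rw [a1] at hlt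
    have := norm_sub_le (∑ m ∈ Finset.range (x + 1), f m) (f 0)
    linarith
  have h2 : ∃ s ∈ Finset.range D, ((M:ℝ) + 1) / T < ‖∑ m ∈ (Finset.range (x + 1)).filter (fun m : ℕ => m % D = s), f m‖ := by
    by_contra hc
    push Not at hc
    have := (norm_sum_le _ _).trans (Finset.sum_le_sum hc)
    rw [← e2, Finset.sum_const, Finset.card_range, nsmul_eq_mul, ← mul_div_assoc] at this
    linarith
  obtain ⟨s, hs, h3⟩ := h2
  rw [Finset.mem_range] at hs
  obtain ⟨L, hL, h4⟩ := ap_split f (x + 1) D s hs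
  rw [h4] at h3
  set fp : Polynomial ℝ := Polynomial.C γ * ((g.map (Int.castRingHom ℝ)).comp (Polynomial.C (D:ℝ) * Polynomial.X + Polynomial.C (s:ℝ))) with hfp
  have hev : ∀ n : ℕ, fp.eval (n:ℝ) = γ * ((g.eval ((s + D * n : ℕ):ℤ) : ℤ):ℝ) := by
    intro n
    rw [hfp]
    simp only [Polynomial.eval_mul, Polynomial.eval_C, Polynomial.eval_comp, Polynomial.eval_add, Polynomial.eval_X]
    have : ((D:ℝ) * n + s) = (Int.castRingHom ℝ) ((s + D * n : ℕ):ℤ) := by simp; ring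
    rw [this, Polynomial.eval_map, Polynomial.eval₂_at_apply]; rfl
  have hper : ∀ n, f (s + D * n) = (indA g S s : ℂ) * e (fp.eval (n:ℝ)) := by
    intro n
    simp only [hf]
    rw [hev]
    congr 1
    have := (indA_periodic g S).nat_mul n s
    rw [← this, mul_comm]
    simp [hDd]
  have h5 : ((M:ℝ) + 1) / T < ‖∑ n ∈ Finset.range L, e (fp.eval (n:ℝ))‖ := by
    simp only [hper] at h3
    rw [← Finset.mul_sum, norm_mul, norm_indA] at h3
    refine h3.trans_le ?_
    exact mul_le_of_le_one_left (norm_nonneg _) (indA_le g S s)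
  have hnd : (Polynomial.C (D:ℝ) * Polynomial.X + Polynomial.C (s:ℝ)).natDegree = 1 :=
    Polynomial.natDegree_linear (by exact_mod_cast hD.ne')
  have hnd2 : (g.map (Int.castRingHom ℝ)).natDegree = k := by
    rw [Polynomial.natDegree_map_eq_of_injective (RingHom.injective_int _), hgk]
  have hcoef : fp.coeff k = γ * g.leadingCoeff * D ^ k := by
    rw [hfp, Polynomial.coeff_C_mul]
    have hc := Polynomial.coeff_comp_degree_mul_degree (p := g.map (Int.castRingHom ℝ)) (q := Polynomial.C (D:ℝ) * Polynomial.X + Polynomial.C (s:ℝ)) (by rw [hnd]; norm_num)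
    rw [hnd, hnd2, mul_one, Polynomial.leadingCoeff_linear (by exact_mod_cast hD.ne'), Polynomial.leadingCoeff_map_of_injective (RingHom.injective_int _)] at hc
    rw [hc, mul_assoc]; rfl
  have h6 := H T hT (M + 1) L (by omega) (by omega) fp (by
    rw [hfp]
    refine (Polynomial.natDegree_C_mul_le _ _).trans ?_
    rw [Polynomial.natDegree_comp, hnd, hnd2, mul_one]) (by
      rw [div_lt_iff₀ (by linarith)] at h5
      push_cast; linarith)
  rw [hcoef] at h6
  push_cast at h6
  exact h6

theorem fam_count {Y : ℝ} (hY : 0 ≤ Y) (t : ℕ) (F : Finset (Finset ℕ)) (hF : ∀ S ∈ F, S ⊆ prY Y ∧ S.card ≤ t) :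
    F.card ≤ (⌊Y⌋₊ + 1) ^ t := by
  have h1 : ∀ S ∈ F, ∀ p ∈ S, p.Prime := fun S hS => prime_sub hY (hF S hS).1
  calc F.card ≤ (Finset.Icc 1 ((⌊Y⌋₊ + 1) ^ t)).card := by
        apply Finset.card_le_card_of_injOn (fun S => ∏ p ∈ S, p)
        · intro S hS
          rw [Finset.mem_coe, Finset.mem_Icc]
          refine ⟨Finset.prod_pos fun p hp => (h1 S hS p hp).pos, ?_⟩
          calc ∏ p ∈ S, p ≤ ∏ _p ∈ S, (⌊Y⌋₊ + 1) := by
                apply Finset.prod_le_prod' 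
                intro p hp
                have := (hF S hS).1 hp
                unfold prY at this
                rw [Finset.mem_filter, Finset.mem_range] at this
                omega
            _ = (⌊Y⌋₊ + 1) ^ S.card := by rw [Finset.prod_const]
            _ ≤ _ := Nat.pow_le_pow_right (by omega) (hF S hS).2
        · intro S hS S' hS' he
          have a := Nat.primeFactors_prod (h1 S hS)
          have b := Nat.primeFactors_prod (h1 S' hS')
          simp only at he
          rw [← a, ← b, he]
    _ = _ := by rw [Nat.card_Icc]; omega

theorem sizeOK {k C : ℕ} {g : Polynomial ℤ} (hk : 1 ≤ k) (hC : 1 ≤ C) (hg : Good k C g) {Y : ℝ} (hY : 0 ≤ Y) (t : ℕ) :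
    SizeOK g Y t ((Kp k C * (⌊Y⌋₊ + 1)) ^ t) := by
  have hK := Kp_pos k C hC
  have h0 : (⌊Y⌋₊ + 1) ^ t ≤ (Kp k C * (⌊Y⌋₊ + 1)) ^ t := Nat.pow_le_pow_left (Nat.le_mul_of_pos_left _ hK) _
  refine ⟨?_, ?_, ?_⟩
  · intro S hS hc
    unfold DS
    calc ∏ p ∈ S, p ^ gammaExp g p ≤ ∏ _p ∈ S, (Kp k C * (⌊Y⌋₊ + 1)) := by
          apply Finset.prod_le_prod' 
          intro p hp
          refine (gamma_pow_le hk hC hg (prime_sub hY hS p hp)).trans ?_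
          apply Nat.mul_le_mul_left
          have := hS hp
          unfold prY at this
          rw [Finset.mem_filter, Finset.mem_range] at this
          omega
      _ = (Kp k C * (⌊Y⌋₊ + 1)) ^ S.card := by rw [Finset.prod_const]
      _ ≤ _ := Nat.pow_le_pow_right (Nat.mul_pos hK (by omega)) hc
  · exact (fam_count hY t _ (fun S hS => by rw [mem_fam] at hS; exact ⟨hS.1, hS.2.le⟩)).trans h0
  · exact (fam_count hY t _ (fun S hS => by rw [Finset.mem_powersetCard] at hS; exact ⟨hS.1, hS.2.le⟩)).trans h0

theorem sum_inv_prY (Y : ℝ) (hY : 1 ≤ Y) : ∑ p ∈ prY Y, 1 / (p:ℝ) ≤ 1 + Real.log Y := by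
  refine le_trans ?_ (harmonic_floor_le_one_add_log Y hY)
  rw [harmonic_eq_sum_Icc]
  push_cast
  simp only [one_div]
  apply Finset.sum_le_sum_of_subset_of_nonneg
  · intro p hp
    rw [mem_prY (by linarith)] at hp
    rw [Finset.mem_Icc]
    exact ⟨hp.1.pos, Nat.le_floor hp.2⟩
  · intro p _ _; positivity

theorem w_low (k C : ℕ) (hk : 1 ≤ k) (hC : 1 ≤ C) : ∃ A : ℝ, 0 < A ∧ ∀ g : Polynomial ℤ, Good k C g → ∀ Y : ℝ, 1 ≤ Y →
    ∑ p ∈ prY Y, xg g p ≤ A * (1 + Real.log Y) ∧ Real.exp (-(A * (1 + Real.log Y))) ≤ wProd g Y ∧ wProd g Y ≤ 1 := by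
  classical
  set K := Kp k C with hKd
  have hK := Kp_pos k C hC
  set P := K + 2 * k with hP
  set A : ℝ := ((P * (K * P) + K + 2 * k : ℕ) : ℝ) with hA
  have hA0 : 0 < A := by rw [hA]; exact_mod_cast (by omega)
  refine ⟨A, hA0, ?_⟩
  intro g hg Y hY
  have hY0 : 0 ≤ Y := by linarith
  have hs := sum_inv_prY Y hY
  refine ⟨?_, ?_, ?_⟩
  · calc ∑ p ∈ prY Y, xg g p ≤ ∑ p ∈ prY Y, A * (1 / (p:ℝ)) := by
          apply Finset.sum_le_sum
          intro p hp
          have hp := ((mem_prY hY0 p).mp hp).1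
          refine (xg_le hk hC hg hp).trans ?_
          rw [mul_one_div]
          gcongr
          rw [hA]; exact_mod_cast (by omega)
      _ ≤ _ := by rw [← Finset.mul_sum]; gcongr
  · rw [wProd_eq g Y hY0 (prY Y) (fun p hp => ((mem_prY hY0 p).mp hp).1) le_rfl]
    calc Real.exp (-(A * (1 + Real.log Y))) ≤ Real.exp (∑ p ∈ prY Y, -(A * (1 / (p:ℝ)))) := by
          apply Real.exp_le_exp.mpr
          rw [Finset.sum_neg_distrib, ← Finset.mul_sum]
          have := mul_le_mul_of_nonneg_left hs hA0.le
          linarith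
      _ = ∏ p ∈ prY Y, Real.exp (-(A * (1 / (p:ℝ)))) := Real.exp_sum _ _
      _ ≤ _ := by
        apply Finset.prod_le_prod (fun p _ => (Real.exp_pos _).le)
        intro p hp
        obtain ⟨hp, hpY⟩ := (mem_prY hY0 p).mp hp
        have hp0 : (0:ℝ) < p := by exact_mod_cast hp.pos
        unfold wt
        rw [if_pos hpY]
        by_cases hPp : P < p
        · have h1 : xg g p ≤ k / p := xg_le' hk hC hg hp (by omega)
          have h0 := xg_nonneg g p
          have h2 : (k:ℝ) / p ≤ 1 / 2 := by
            rw [div_le_div_iff₀ hp0 (by norm_num)]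
            exact_mod_cast (by omega : k * 2 ≤ 1 * p)
          have h3 : Real.exp (-(A * (1 / (p:ℝ)))) ≤ Real.exp (-(2 * xg g p)) := by
            apply Real.exp_le_exp.mpr
            apply neg_le_neg
            have : 2 * xg g p ≤ 2 * k * (1 / (p:ℝ)) := by rw [mul_assoc, mul_one_div]; linarith
            refine this.trans ?_
            gcongr
            rw [hA]; exact_mod_cast (by omega)
          refine h3.trans ?_
          rw [Real.exp_neg, inv_le_iff_one_le_mul₀ (Real.exp_pos _)]
          have h4 := Real.add_one_le_exp (2 * xg g p)
          have h5 : 0 < 1 - xg g p := by linarith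
          nlinarith
        · have h1 := xg_le_one_sub hk hC hg hp
          have h2 : (p:ℝ) ^ gammaExp g p ≤ K * P := by
            have := gamma_pow_le hk hC hg hp
            exact_mod_cast this.trans (Nat.mul_le_mul_left _ (by omega))
          have h3 : (1:ℝ) / (K * P) ≤ 1 / (p:ℝ) ^ gammaExp g p := by gcongr
          have h4 : Real.exp (-(A * (1 / (p:ℝ)))) ≤ 1 / (K * P) := by
            rw [Real.exp_neg, ← one_div]
            have hKP : (0:ℝ) < K * P := by
              have : 0 < K * P := Nat.mul_pos hK (by omega)
              exact_mod_cast this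
            apply one_div_le_one_div_of_le hKP
            have h5 : (K:ℝ) * P ≤ A * (1 / (p:ℝ)) := by
              rw [mul_one_div, le_div_iff₀ hp0, hA]
              have a1 : K * P * p ≤ P * (K * P) + K + 2 * k := by
                have : K * P * p ≤ K * P * P := Nat.mul_le_mul_left _ (by omega)
                nlinarith
              exact_mod_cast a1
            have := Real.add_one_le_exp (A * (1 / (p:ℝ)))
            linarith
          linarith
  · rw [wProd_eq g Y hY0 (prY Y) (fun p hp => ((mem_prY hY0 p).mp hp).1) le_rfl]
    apply Finset.prod_le_one
    · intro p hp
      exact (wt_pos hk hC hg ((mem_prY hY0 p).mp hp).1 Y).le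
    · intro p _
      unfold wt; split_ifs
      · have := xg_nonneg g p; linarith
      · exact le_rfl

theorem minor_beta {N : ℕ} {K Q γ : ℝ} (hγ : γ ∈ minorArcs N K Q) {q : ℕ} (hq : 0 < q) (hqQ : (q:ℝ) ≤ Q) {a : ℤ}
    (ha : IsCoprime a (q:ℤ)) {β : ℝ} (hb : γ = a / q + β) : K / N < |β| := by
  by_contra hc
  push Not at hc
  apply hγ.2
  have hq' : (0:ℤ) < q := by exact_mod_cast hq
  set r := (a - 1) % q with hr
  have h0 : 0 ≤ r := Int.emod_nonneg _ hq'.ne'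
  have h1 : r < q := Int.emod_lt_of_pos _ hq'
  have h2 := Int.emod_add_mul_ediv (a - 1) q
  set n := (a - 1) / (q:ℤ) with hn
  have h3 : a = (r + 1) + q * n := by rw [hr]; linarith
  refine ⟨q, hq, hqQ, (r + 1).toNat, by omega, by omega, ?_, ?_⟩
  · have h4 : IsCoprime (r + 1) (q:ℤ) := by
      rw [h3] at ha
      exact IsCoprime.of_add_mul_left_left ha
    have h5 : (((r + 1).toNat : ℕ):ℤ) = r + 1 := by omega
    rw [← h5, Nat.isCoprime_iff_coprime] at h4
    exact h4
  · have h5 : ((((r + 1).toNat : ℕ):ℤ):ℝ) = ((r + 1 : ℤ):ℝ) := by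
      congr 1; omega
    rw [Int.cast_natCast] at h5
    rw [h5]
    have hq0 : (q:ℝ) ≠ 0 := by exact_mod_cast hq.ne'
    have h6 : γ - ((r + 1 : ℤ):ℝ) / q = β + n := by
      rw [hb, h3]; push_cast; field_simp; ring
    rw [h6]
    unfold torusNorm
    refine le_trans (round_le _ n) ?_
    rw [add_sub_cancel_right]; exact hc

theorem M_facts {N b : ℝ} (hN : 0 ≤ N) (hb : 0 < b) {k : ℕ} (hk : 1 ≤ k) :
    b * (⌊(N / b) ^ ((1:ℝ) / k)⌋₊ : ℝ) ^ k ≤ N ∧ N ≤ b * ((⌊(N / b) ^ ((1:ℝ) / k)⌋₊ : ℝ) + 1) ^ k := by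
  set x := (N / b) ^ ((1:ℝ) / k) with hx
  have hx0 : 0 ≤ x := Real.rpow_nonneg (by positivity) _
  have h1 : x ^ k = N / b := by
    rw [hx, one_div]; exact Real.rpow_inv_natCast_pow (by positivity) (by omega)
  have h2 : b * x ^ k = N := by rw [h1]; field_simp
  constructor
  · calc b * (⌊x⌋₊ : ℝ) ^ k ≤ b * x ^ k := by gcongr; exact Nat.floor_le hx0
      _ = N := h2
  · calc N = b * x ^ k := h2.symm
      _ ≤ _ := by gcongr; exact (Nat.lt_floor_add_one x).le

theorem M_big {C u b : ℝ} {M k : ℕ} (hk : 1 ≤ k) (hC : 1 ≤ C) (hu : 2 * C ≤ u) (hb0 : 0 < b) (hb : b ≤ C * u) (h : u ^ (8 * k) ≤ b * ((M:ℝ) + 1) ^ k) :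
    u ^ 6 ≤ M := by
  by_contra hc
  push Not at hc
  have hu1 : 1 ≤ u := by linarith
  have h6 : 1 ≤ u ^ 6 := one_le_pow₀ hu1
  have h1 : (M:ℝ) + 1 < 2 * u ^ 6 := by linarith
  have h2 : ((M:ℝ) + 1) ^ k < (2 * u ^ 6) ^ k := pow_lt_pow_left₀ h1 (by positivity) (by omega)
  have h3 : b * ((M:ℝ) + 1) ^ k < C * u * (2 * u ^ 6) ^ k := by
    calc b * ((M:ℝ) + 1) ^ k < b * (2 * u ^ 6) ^ k := by gcongr
      _ ≤ _ := by gcongr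
  have h4 : C * u ≤ (C * u) ^ k := le_self_pow₀ (by nlinarith) (by omega)
  have h5 : C * u * (2 * u ^ 6) ^ k ≤ u ^ (8 * k) := by
    calc C * u * (2 * u ^ 6) ^ k ≤ (C * u) ^ k * (2 * u ^ 6) ^ k := by gcongr
      _ = ((2 * C * u) * u ^ 6) ^ k := by rw [← mul_pow]; ring
      _ ≤ ((u * u) * u ^ 6) ^ k := by gcongr
      _ = _ := by rw [pow_mul]; ring
  linarith

theorem approx {γ b Dk : ℝ} {bn dn q0 : ℕ} {a0 : ℤ} {W X : ℝ} (hb : (bn:ℝ) = b) (hd : (dn:ℝ) = Dk) (hb1 : 1 ≤ bn) (hd1 : 1 ≤ dn) (hq0 : 1 ≤ q0)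
    (h : |q0 * (γ * b * Dk) - a0| ≤ W / X) (hX : 0 < X) :
    ∃ q : ℕ, 0 < q ∧ q ≤ q0 * bn * dn ∧ ∃ a : ℤ, IsCoprime a (q:ℤ) ∧ ∃ β : ℝ, γ = a / q + β ∧ |β| * (b * X) ≤ W := by
  set Q := q0 * bn * dn with hQ
  have hQ0 : 0 < Q := by positivity
  set x : ℚ := (a0:ℚ) / (Q:ℚ) with hx
  have hden : (x.den : ℤ) ∣ (Q:ℤ) := by
    have := Rat.den_dvd a0 (Q:ℤ)
    rw [Rat.divInt_eq_div] at this
    simpa [hx] using this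
  have hQR : (0:ℝ) < Q := by exact_mod_cast hQ0
  have hcast : (x.num : ℝ) / x.den = a0 / Q := by
    have := Rat.cast_def (K := ℝ) x
    rw [← this, hx]; push_cast; rfl
  refine ⟨x.den, x.den_pos, Nat.le_of_dvd hQ0 (by exact_mod_cast hden), x.num, ?_, γ - a0 / Q, ?_, ?_⟩
  · rw [Int.isCoprime_iff_gcd_eq_one]
    exact x.reduced
  · rw [hcast]; ring
  · have e1 : γ - a0 / Q = (q0 * (γ * b * Dk) - a0) / Q := by
      have : (Q:ℝ) = q0 * b * Dk := by rw [hQ]; push_cast; rw [hb, hd]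
      rw [eq_div_iff hQR.ne', sub_mul, div_mul_cancel₀ _ hQR.ne', this]; ring
    rw [e1, abs_div, abs_of_pos hQR]
    have hW : 0 ≤ W := by
      have := (abs_nonneg _).trans h
      rw [le_div_iff₀ hX] at this; linarith
    have hb0 : 0 < b := by rw [← hb]; exact_mod_cast hb1
    have hbQ : b ≤ Q := by
      rw [← hb, hQ]
      have : bn ≤ q0 * bn * dn := by
        calc bn = 1 * bn * 1 := by ring
          _ ≤ _ := by gcongr
      exact_mod_cast this
    calc |q0 * (γ * b * Dk) - a0| / Q * (b * X) ≤ W / X / Q * (b * X) := by gcongr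
      _ = W * (b / Q) := by field_simp
      _ ≤ W * 1 := by gcongr; exact (div_le_one hQR).mpr hbQ
      _ = W := mul_one _

theorem KA_ge (k C : ℕ) (hC : 1 ≤ C) : (1:ℝ) ≤ KA k C := by
  unfold KA
  have h1 : (1:ℝ) ≤ C := by exact_mod_cast hC
  have h0 : (0:ℝ) ≤ k := by positivity
  have h2 : (1:ℝ) ≤ ((k:ℝ) + 1) ^ 3 := one_le_pow₀ (by linarith)
  nlinarith

theorem ev_FF {g : Polynomial ℤ} {γ β : ℝ} {a : ℤ} {q : ℕ} (h : γ = a / q + β) (m : ℕ) : FF g γ m = ev g a q m * FF g β m := by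
  unfold FF ev
  have : γ * ((g.eval (m:ℤ) : ℤ):ℝ) = ((a * g.eval (m:ℤ) : ℤ) / (q:ℝ)) + β * ((g.eval (m:ℤ) : ℤ):ℝ) := by
    rw [h]; push_cast; ring
  rw [this, e_add]; ring

theorem exps1 {k Cw : ℕ} (hk : 1 ≤ k) (hCw : 1 ≤ Cw) : 1 + (4 * Cw + k) ≤ 16 * k * Cw := by
  have h1 : Cw ≤ k * Cw := Nat.le_mul_of_pos_left _ hk
  have h2 : k ≤ k * Cw := Nat.le_mul_of_pos_right _ hCw
  rw [mul_assoc]; omega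

set_option maxHeartbeats 1000000 in
theorem core_alg {k C Cw : ℕ} (hk : 1 ≤ k) (hC : 1 ≤ C) (hCw : 1 ≤ Cw)
    (HW : ∀ T : ℝ, 1 ≤ T → ∀ g : Polynomial ℤ, g.natDegree = k → ∀ S : Finset ℕ, 0 < DS g S →
    ∀ M : ℕ, ∀ γ : ℝ, (∀ x ≤ M, ‖∑ m ∈ Finset.Icc 1 x, (indA g S m : ℂ) * e (γ * ((g.eval (m:ℤ) : ℤ):ℝ))‖ ≤ DS g S * (M + 1) / T + 1) ∨
    ∃ q : ℕ, 1 ≤ q ∧ (q:ℝ) ≤ Cw * T ^ Cw ∧ ∃ a : ℤ, |q * (γ * g.leadingCoeff * DS g S ^ k) - a| ≤ Cw * T ^ Cw / (M + 1) ^ k)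
    {κ r' : ℝ} (hκ : 0 < κ) (hr' : 0 ≤ r')
    (HE : ∀ g : Polynomial ℤ, Good k C g → ∀ σ : ℝ, 0 < σ → σ ≤ 1 → ∀ q : ℕ, 0 < q →
      κ / σ ^ (k + 1) < q → ∀ A : ℕ → ℤ, (∀ p ∈ q.primeFactors, ¬ (p:ℤ) ∣ A p) →
      ∏ p ∈ q.primeFactors, ell g (σ ^ (-((k:ℝ) + 2))) p (A p) (q.factorization p) ≤ r' * σ)
    {g : Polynomial ℤ} (hg : Good k C g) {s : ℝ} (hs1 : 1 ≤ s) (hs2 : Cw * C ≤ s) (hs3 : 2 * C ≤ s) {N : ℕ}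
    (hN : (N:ℝ) = (s ^ (16 * k * Cw)) ^ (8 * k)) (hb : (g.leadingCoeff:ℝ) ≤ C * s ^ (16 * k * Cw))
    {σ : ℝ} (hσ : 0 < σ) (hσ1 : σ ≤ 1) {t D : ℕ} (ht : 1 ≤ t) (hD : SizeOK g (σ ^ (-((k:ℝ) + 2))) t D) (hDs : (D:ℝ) ≤ s)
    {ε : ℝ} (he : epsB g (σ ^ (-((k:ℝ) + 2))) t ≤ ε) (hsε : 1 / s ≤ ε) (hw0 : 0 ≤ wProd g (σ ^ (-((k:ℝ) + 2)))) (hw1 : wProd g (σ ^ (-((k:ℝ) + 2))) ≤ 1)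
    {M : ℕ} (hM1 : (g.leadingCoeff:ℝ) * (M:ℝ) ^ k ≤ N) (hM2 : (N:ℝ) ≤ g.leadingCoeff * ((M:ℝ) + 1) ^ k)
    {γ : ℝ} (hγ : γ ∈ minorArcs N (κ / σ) (κ / σ ^ (k + 1))) :
    ‖∑ m ∈ Finset.Icc 1 M, indW g (σ ^ (-((k:ℝ) + 2))) m * FF g γ m‖ ≤
      (KA k C * r' + 1 / κ) * (σ * wProd g (σ ^ (-((k:ℝ) + 2))) * N) + 200 * KA k C ^ 2 * ε * N := by
  classical
  set Y := σ ^ (-((k:ℝ) + 2)) with hYd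
  have hY : 0 ≤ Y := Real.rpow_nonneg hσ.le _
  set u := s ^ (16 * k * Cw) with hu
  set w := wProd g Y with hw
  set K : ℝ := KA k C with hKd
  have hK1 : 1 ≤ K := KA_ge k C hC
  set b := g.leadingCoeff with hbd
  have hb0 : 0 < b := hg.2.1
  have hb1 : (1:ℝ) ≤ b := by exact_mod_cast hb0
  have hC1 : (1:ℝ) ≤ C := by exact_mod_cast hC
  have hCw1 : (1:ℝ) ≤ Cw := by exact_mod_cast hCw
  have hkk : 1 ≤ k * Cw := Nat.mul_pos hk hCw
  have hsu : s ≤ u := le_self_pow₀ hs1 (by rw [mul_assoc]; omega)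
  have hu1 : 1 ≤ u := hs1.trans hsu
  have hMu : u ^ 6 ≤ M := M_big hk hC1 (by linarith) (by linarith) hb (by rw [← hN]; exact hM2)
  have hM0 : (1:ℝ) ≤ M := (one_le_pow₀ hu1).trans hMu
  have hM : 1 ≤ M := by exact_mod_cast hM0
  have hN0 : (0:ℝ) < N := by rw [hN]; positivity
  have hε : 0 < ε := lt_of_lt_of_le (by positivity) hsε
  have hD0 : (0:ℝ) ≤ D := by positivity
  have hsε' : 1 ≤ ε * s := by rw [div_le_iff₀ (by linarith)] at hsε; exact hsε
  have hrest : K * N / M * (M * epsB g Y t + 4 * D * D) ≤ 5 * K ^ 2 * ε * N := by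
    have h1 : (4 * D * D : ℝ) ≤ 4 * ε * M := by
      have a1 : (D:ℝ) * D ≤ s * s := by gcongr
      have a2 : s * s ≤ ε * (s * s * s) := by
        have := mul_le_mul_of_nonneg_right hsε' (mul_self_nonneg s)
        linarith only [this]
      have a3 : s * s * s ≤ u ^ 6 := by
        calc s * s * s ≤ u * u * u := by gcongr
          _ = u ^ 3 := by ring
          _ ≤ u ^ 6 := pow_le_pow_right₀ hu1 (by norm_num)
      have a4 : ε * (s * s * s) ≤ ε * M := by gcongr; linarith
      linarith
    calc K * N / M * (M * epsB g Y t + 4 * D * D) ≤ K * N / M * (M * ε + 4 * ε * M) := by gcongr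
      _ = 5 * K * ε * N := by field_simp; ring
      _ ≤ 5 * K ^ 2 * ε * N := by
        have : K ≤ K ^ 2 := le_self_pow₀ hK1 (by norm_num)
        gcongr
  by_cases hall : ∀ S ∈ fam Y t, ∀ x ≤ M, ‖∑ m ∈ Finset.Icc 1 x, (indA g S m : ℂ) * e (γ * ((g.eval (m:ℤ) : ℤ):ℝ))‖ ≤ D * (M + 1) / s ^ 4 + 1
  · have h1 := minor hk hg N M hM hM1 γ hY ht hD (D * (M + 1) / s ^ 4 + 1) (by positivity) hall
    have h2 : (D:ℝ) * ((D * (M + 1) / s ^ 4 + 1) * (K * N / M * 2)) ≤ 6 * K ^ 2 * ε * N := by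
      have c1 : (D:ℝ) * (D * (M + 1) / s ^ 4 + 1) ≤ 3 * ε * M := by
        have a1 : (D:ℝ) * (M + 1) / s ^ 4 ≤ s * (2 * M) / s ^ 4 := by gcongr; linarith
        have a2 : (D:ℝ) * (D * (M + 1) / s ^ 4 + 1) ≤ s * (s * (2 * M) / s ^ 4 + 1) := by gcongr
        have a3 : s * (s * (2 * M) / s ^ 4 + 1) = 2 * M * (1 / s) * (1 / s) + s := by field_simp
        have a4 : 1 / s ≤ 1 := by rw [div_le_one (by linarith)]; exact hs1
        have a5 : 2 * M * (1 / s) * (1 / s) ≤ 2 * M * ε * 1 := by gcongr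
        have a6 : s ≤ ε * M := by
          have : s * s ≤ u ^ 6 := by
            calc s * s ≤ u * u := by gcongr
              _ = u ^ 2 := by ring
              _ ≤ u ^ 6 := pow_le_pow_right₀ hu1 (by norm_num)
          calc s = 1 * s := by ring
            _ ≤ ε * s * s := by gcongr
            _ = ε * (s * s) := by ring
            _ ≤ ε * M := by gcongr; linarith
        rw [a3] at a2
        linarith
      calc (D:ℝ) * ((D * (M + 1) / s ^ 4 + 1) * (K * N / M * 2)) = (D:ℝ) * (D * (M + 1) / s ^ 4 + 1) * (K * N / M * 2) := by ring
        _ ≤ 3 * ε * M * (K * N / M * 2) := by gcongr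
        _ = 6 * K * ε * N := by field_simp; ring
        _ ≤ 6 * K ^ 2 * ε * N := by
          have : K ≤ K ^ 2 := le_self_pow₀ hK1 (by norm_num)
          gcongr
    have h3 : 0 ≤ (K * r' + 1 / κ) * (σ * w * N) := by positivity
    have h4 : 0 ≤ K ^ 2 * ε * N := by positivity
    linarith
  · push Not at hall
    obtain ⟨S, hS, x, hx, hlt⟩ := hall
    rw [mem_fam] at hS
    have hpr := prime_sub hY hS.1
    have hpos : 0 < DS g S := Finset.prod_pos fun p hp => pow_pos (hpr p hp).pos _
    have hDS := hD.ds S hS.1 hS.2.le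
    have hDSR : (DS g S : ℝ) ≤ D := by exact_mod_cast hDS
    rcases HW (s ^ 4) (one_le_pow₀ hs1) g hg.1 S hpos M γ with h1 | h1
    · exfalso
      have := h1 x hx
      have h2 : (DS g S : ℝ) * (M + 1) / s ^ 4 ≤ D * (M + 1) / s ^ 4 := by gcongr
      linarith
    obtain ⟨q0, hq0, hq0le, a0, ha0⟩ := h1
    have hbn : ((b.toNat : ℕ):ℝ) = b := by
      have : ((b.toNat : ℕ):ℤ) = b := Int.toNat_of_nonneg hb0.le
      exact_mod_cast this
    obtain ⟨q, hq, hqle, a, hcop, β, hγβ, hβ⟩ := approx hbn (by push_cast; rfl : ((DS g S ^ k : ℕ):ℝ) = (DS g S : ℝ) ^ k)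
      (by omega) (Nat.pow_pos hpos) hq0 ha0 (by positivity)
    have hCT : (Cw:ℝ) * (s ^ 4) ^ Cw ≤ u := by
      calc (Cw:ℝ) * (s ^ 4) ^ Cw ≤ s * (s ^ 4) ^ Cw := by
            gcongr
            refine le_trans ?_ hs2
            exact le_mul_of_one_le_right (by linarith only [hCw1]) hC1
        _ = s ^ (1 + 4 * Cw) := by rw [← pow_mul, pow_add, pow_one]
        _ ≤ u := pow_le_pow_right₀ hs1 (by have := exps1 hk hCw; omega)
    have hβN : |β| * N ≤ u := by
      calc |β| * N ≤ |β| * (b * (M + 1) ^ k) := by gcongr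
        _ ≤ _ := hβ
        _ ≤ u := hCT
    have hqu : (q:ℝ) ≤ u ^ 2 := by
      calc (q:ℝ) ≤ ((q0 * b.toNat * DS g S ^ k : ℕ):ℝ) := by exact_mod_cast hqle
        _ = q0 * b * DS g S ^ k := by push_cast; rw [hbn]
        _ ≤ (Cw * (s ^ 4) ^ Cw) * (C * u) * s ^ k := by
          gcongr
          exact hDSR.trans hDs
        _ = (Cw * C) * ((s ^ 4) ^ Cw * s ^ k) * u := by ring
        _ ≤ s * ((s ^ 4) ^ Cw * s ^ k) * u := by gcongr
        _ = s ^ (1 + (4 * Cw + k)) * u := by rw [← pow_mul, ← pow_add, pow_add s 1, pow_one]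
        _ ≤ u * u := by
          gcongr
          exact pow_le_pow_right₀ hs1 (exps1 hk hCw)
        _ = u ^ 2 := by ring
    have hV : VV k C N M β ≤ 22 * K ^ 2 * N / u ^ 5 := by
      unfold VV
      have a1 : 2 + 20 * KA k C * |β| * N ≤ 22 * K * u := by
        have : 20 * KA k C * |β| * N ≤ 20 * K * u := by
          calc 20 * KA k C * |β| * N = 20 * K * (|β| * N) := by ring
            _ ≤ _ := by gcongr
        have h9 : (1:ℝ) ≤ K * u := one_le_mul_of_one_le_of_one_le hK1 hu1
        linarith only [h9, this]
      calc KA k C * N / M * (2 + 20 * KA k C * |β| * N) ≤ K * N / u ^ 6 * (22 * K * u) := by gcongr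
        _ = _ := by field_simp
    obtain ⟨R, hR, hqR, hDR, A, hA, hmean⟩ := complete hk hC hg Y hY q hq a hcop
    have hmaj := major hk hg N M hM hM1 β hY ht hD q hq a R hR hqR hDR
    obtain ⟨F1, F2, F3, F4⟩ := FF_bounds hk hg N M hM hM1 β
    have hsum : ∑ m ∈ Finset.Icc 1 M, indW g Y m * FF g γ m = ∑ m ∈ Finset.Icc 1 M, indW g Y m * (ev g a q m * FF g β m) := by
      apply Finset.sum_congr rfl; intro m _; rw [ev_FF hγβ]
    rw [hsum]
    refine hmaj.trans ?_
    set Φ := ‖∑ m ∈ Finset.Icc 1 M, FF g β m‖ with hΦ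
    have hΦ0 : 0 ≤ Φ := norm_nonneg _
    set mu := ‖pmean (fun m => indW g Y m * ev g a q m) R‖ with hmu
    have hmu0 : 0 ≤ mu := norm_nonneg _
    have heps : epsB g Y t * Φ ≤ K ^ 2 * ε * N := by
      calc epsB g Y t * Φ ≤ ε * (K * N) := by gcongr
        _ = K * ε * N := by ring
        _ ≤ _ := by
          have : K ≤ K ^ 2 := le_self_pow₀ hK1 (by norm_num)
          gcongr
    have hpowu : ∀ j : ℕ, s ^ (j + 1) ≤ u ^ (j + 1) := fun j => by gcongr
    have hVε : 22 * K ^ 2 * N / u ^ 5 ≤ 22 * K ^ 2 * ε * N := by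
      rw [div_le_iff₀ (by positivity)]
      have : 1 ≤ ε * u ^ 5 := by
        calc 1 ≤ ε * s := hsε'
          _ ≤ ε * u ^ 5 := by gcongr; exact hsu.trans (le_self_pow₀ hu1 (by norm_num))
      calc 22 * K ^ 2 * N = 22 * K ^ 2 * N * 1 := by ring
        _ ≤ 22 * K ^ 2 * N * (ε * u ^ 5) := by gcongr
        _ = _ := by ring
    have hmid : (D:ℝ) * (4 * q * D * VV k C N M β) ≤ 88 * K ^ 2 * ε * N := by
      calc (D:ℝ) * (4 * q * D * VV k C N M β) ≤ s * (4 * u ^ 2 * s * (22 * K ^ 2 * N / u ^ 5)) := by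
            have hVn : 0 ≤ VV k C N M β := le_trans (by positivity) F2
            gcongr
        _ = 88 * K ^ 2 * N * (s * s / u ^ 3) := by field_simp; ring
        _ ≤ 88 * K ^ 2 * N * ε := by
          gcongr
          rw [div_le_iff₀ (by positivity)]
          calc s * s = 1 * (s * s) := by ring
            _ ≤ (ε * s) * (s * s) := by gcongr
            _ = ε * s ^ 3 := by ring
            _ ≤ ε * u ^ 3 := by gcongr
        _ = _ := by ring
    have hmain : mu * Φ ≤ (K * r' + 1 / κ) * (σ * w * N) + 22 * K ^ 2 * ε * N := by
      have hpn : (0:ℝ) ≤ 22 * K ^ 2 * ε * N := by positivity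
      by_cases hqκ : κ / σ ^ (k + 1) < q
      · have h1 := HE g hg σ hσ hσ1 q hq hqκ A hA
        have h2 : mu ≤ w * (r' * σ) := hmean.trans (by gcongr)
        have h3 : mu * Φ ≤ w * (r' * σ) * (K * N) := by gcongr
        have h4 : 0 ≤ 1 / κ * (σ * w * N) := by positivity
        have h5 : w * (r' * σ) * (K * N) = K * r' * (σ * w * N) := by ring
        rw [add_mul]
        linarith only [h3, h4, h5, hpn]
      · push Not at hqκ
        have h1 := minor_beta hγ hq hqκ hcop hγβ
        have hβ0 : 0 < |β| := lt_of_le_of_lt (by positivity) h1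
        have h2 := F3 (abs_pos.mp hβ0)
        have h3 : 1 / (Real.pi * |β|) ≤ 1 / κ * (σ * N) := by
          have a1 : κ / σ / N ≤ Real.pi * |β| := by
            have := Real.pi_gt_three
            have h8 : 1 * |β| ≤ Real.pi * |β| := by gcongr; linarith only [this]
            linarith only [h8, h1]
          calc 1 / (Real.pi * |β|) ≤ 1 / (κ / σ / N) := one_div_le_one_div_of_le (by positivity) a1
            _ = _ := by field_simp
        have h4 : mu ≤ w := by
          refine hmean.trans ?_
          calc w * _ ≤ w * 1 := by
                gcongr
                apply Finset.prod_le_one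
                · intro p hp; exact ell_nonneg hk hC hg (Nat.prime_of_mem_primeFactors hp) _ _ _
                · intro p hp
                  exact ell_le_one hk hC hg (Nat.prime_of_mem_primeFactors hp) _ _ _
            _ = w := mul_one w
        have h5 : mu * Φ ≤ w * (1 / κ * (σ * N)) + 1 * (22 * K ^ 2 * ε * N) := by
          calc mu * Φ ≤ w * Φ := by gcongr
            _ ≤ w * (1 / κ * (σ * N) + 22 * K ^ 2 * ε * N) := by gcongr; linarith
            _ = w * (1 / κ * (σ * N)) + w * (22 * K ^ 2 * ε * N) := by ring
            _ ≤ _ := by gcongr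
        have h6 : 0 ≤ K * r' * (σ * w * N) := by positivity
        have h7 : w * (1 / κ * (σ * N)) = 1 / κ * (σ * w * N) := by ring
        rw [add_mul]
        linarith only [h5, h6, h7]
    have h4 : 0 ≤ K ^ 2 * ε * N := by positivity
    rw [add_mul]
    linarith

theorem param (c B B' A q K rr : ℝ) (hc : 0 < c) (hB : 0 ≤ B) (hB' : 0 ≤ B') (hA : 0 ≤ A) (hq : 0 ≤ q) (hK : 0 ≤ K) (hrr : 0 < rr) :
    ∃ L0 : ℝ, ∀ L : ℝ, L0 ≤ L → 1 ≤ L ∧ 2 * L ^ 2 * (B + q * L) ≤ c * L ^ 4 ∧ 8 * (A * (1 + q * L)) ≤ L ^ 2 ∧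
      L + A * (1 + q * L) ≤ L ^ 2 / 2 ∧ L ^ 2 + B' ≤ c * L ^ 4 ∧ K * Real.exp (-(L ^ 2 / 2)) ≤ rr / 2 := by
  refine ⟨1 + 2 * (B + q) / c + 8 * (A * (1 + q)) + 2 * (1 + A * (1 + q)) + (1 + B') / c + 4 * K / rr, ?_⟩
  intro L hL
  have t1 : 0 ≤ 2 * (B + q) / c := by positivity
  have t2 : 0 ≤ 8 * (A * (1 + q)) := by positivity
  have t3 : 0 ≤ 2 * (1 + A * (1 + q)) := by positivity
  have t4 : 0 ≤ (1 + B') / c := by positivity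
  have t5 : 0 ≤ 4 * K / rr := by positivity
  have h1 : 1 ≤ L := by linarith
  have h2 : 2 * (B + q) / c ≤ L := by linarith
  have h4 : (1 + B') / c ≤ L := by linarith
  have h5 : 4 * K / rr ≤ L := by linarith
  rw [div_le_iff₀ (by positivity)] at h2 h4 h5
  have hL2 : L ≤ L ^ 2 := le_self_pow₀ h1 (by norm_num)
  have hAq : A * (1 + q * L) ≤ A * (1 + q) * L := by
    rw [mul_assoc]; gcongr; nlinarith
  refine ⟨h1, ?_, ?_, ?_, ?_, ?_⟩
  · have : B + q * L ≤ (B + q) * L := by nlinarith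
    calc 2 * L ^ 2 * (B + q * L) ≤ 2 * L ^ 2 * ((B + q) * L) := by gcongr
      _ = (2 * (B + q)) * L ^ 3 := by ring
      _ ≤ (L * c) * L ^ 3 := by gcongr
      _ = c * L ^ 4 := by ring
  · have : 8 * (A * (1 + q)) * L ≤ L * L := by gcongr; linarith
    nlinarith
  · have : 2 * (1 + A * (1 + q)) * L ≤ L * L := by gcongr; linarith
    nlinarith
  · calc L ^ 2 + B' ≤ (1 + B') * L ^ 2 := by nlinarith
      _ ≤ (L * c) * L ^ 2 := by gcongr
      _ = c * L ^ 2 * L := by ring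
      _ ≤ c * L ^ 2 * L ^ 2 := by gcongr
      _ = c * L ^ 4 := by ring
  · rw [Real.exp_neg, ← div_eq_mul_inv, div_le_iff₀ (Real.exp_pos _)]
    have := Real.add_one_le_exp (L ^ 2 / 2)
    have h6 : L / 2 ≤ Real.exp (L ^ 2 / 2) := by linarith
    calc K = 4 * K / 4 := by ring
      _ ≤ L * rr / 4 := by gcongr
      _ = rr / 2 * (L / 2) := by ring
      _ ≤ _ := by gcongr

set_option maxHeartbeats 1000000 in
theorem core (k C : ℕ) (hk : 1 ≤ k) (hC : 1 ≤ C) (rr : ℝ) (hrr : 0 < rr) :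
    ∃ κ : ℝ, 0 < κ ∧ ∃ N₀ : ℕ, ∀ N : ℕ, N₀ ≤ N → ∀ g : Polynomial ℤ, Good k C g → (g.leadingCoeff:ℝ) ≤ C * (N:ℝ) ^ ((1:ℝ) / ((8 * k : ℕ):ℝ)) →
      ∀ σ : ℝ, 0 < σ → σ ≤ 1 → -Real.log σ ≤ (Real.log N) ^ ((1:ℝ) / 4) → ∀ γ ∈ minorArcs N (κ / σ) (κ / σ ^ (k + 1)),
      ‖∑ m ∈ Finset.Icc 1 ⌊((N:ℝ) / (g.leadingCoeff:ℝ)) ^ ((1:ℝ) / k)⌋₊, indW g (σ ^ (-((k:ℝ) + 2))) m * FF g γ m‖ ≤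
        rr * σ * wProd g (σ ^ (-((k:ℝ) + 2))) * N := by
  obtain ⟨Cw, hCw, HW⟩ := weyl_ap k hk
  obtain ⟨A, hA, HA⟩ := w_low k C hk hC
  set K : ℝ := KA k C with hKd
  have hK1 : 1 ≤ K := KA_ge k C hC
  set r' := rr / (4 * K) with hr'
  have hr'0 : 0 < r' := by positivity
  obtain ⟨κ0, hκ0, HE0⟩ := ell_prod k C hk hC r' hr'0
  set κ := max κ0 (4 / rr) with hκd
  have hκ : 0 < κ := lt_of_lt_of_le hκ0 (le_max_left _ _)
  have hC1 : (1:ℝ) ≤ C := by exact_mod_cast hC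
  have hCw1 : (1:ℝ) ≤ Cw := by exact_mod_cast hCw
  have hKp : (1:ℝ) ≤ Kp k C := by exact_mod_cast Kp_pos k C hC
  have hk1 : (1:ℝ) ≤ k := by exact_mod_cast hk
  set c : ℝ := 1 / (16 * k * Cw * (8 * k)) with hc
  have hc0 : 0 < c := by positivity
  have hCC : (1:ℝ) ≤ Cw * C := one_le_mul_of_one_le_of_one_le hCw1 hC1
  obtain ⟨L0, HL⟩ := param c (Real.log (2 * Kp k C)) (Real.log (Cw * C + 2 * C)) A (k + 2) (200 * K ^ 2) rr hc0
    (Real.log_nonneg (by linarith)) (Real.log_nonneg (by linarith)) hA.le (by positivity) (by positivity) hrr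
  refine ⟨κ, hκ, ⌈Real.exp ((max L0 1) ^ 4)⌉₊, ?_⟩
  intro N hN g hg hlc σ hσ hσ1 hsig γ hγ
  have hN1 : Real.exp ((max L0 1) ^ 4) ≤ N := (Nat.le_ceil _).trans (by exact_mod_cast hN)
  have hNpos : (0:ℝ) < N := lt_of_lt_of_le (Real.exp_pos _) hN1
  set L := (Real.log N) ^ ((1:ℝ) / 4) with hL
  have hlog : (max L0 1) ^ 4 ≤ Real.log N := by rw [Real.le_log_iff_exp_le hNpos]; exact hN1
  have hm0 : 0 ≤ max L0 1 := le_trans (by norm_num) (le_max_right _ _)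
  have hlog0 : 0 ≤ Real.log N := le_trans (by positivity) hlog
  have hL4 : L ^ 4 = Real.log N := by
    rw [hL, one_div]
    exact_mod_cast Real.rpow_inv_natCast_pow hlog0 (by norm_num : (4:ℕ) ≠ 0)
  have hLn : 0 ≤ L := Real.rpow_nonneg hlog0 _
  have hL0 : L0 ≤ L := by
    refine (le_max_left L0 1).trans ?_
    rw [← hL4] at hlog
    exact le_of_pow_le_pow_left₀ (by norm_num) hLn hlog
  obtain ⟨p1, p2, p3, p4, p5, p6⟩ := HL L hL0
  set s := Real.exp (c * L ^ 4) with hs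
  have hNs : (N:ℝ) = (s ^ (16 * k * Cw)) ^ (8 * k) := by
    rw [hs, ← Real.exp_nat_mul, ← Real.exp_nat_mul]
    have : (((8 * k : ℕ):ℝ) * (((16 * k * Cw : ℕ):ℝ) * (c * L ^ 4))) = L ^ 4 := by
      push_cast; rw [hc]; field_simp
    rw [this, hL4, Real.exp_log hNpos]
  have hs0 : 0 < s := Real.exp_pos _
  have hsbig : Cw * C + 2 * C ≤ s := by
    rw [hs, ← Real.log_le_iff_le_exp (by positivity)]
    have : 0 ≤ L ^ 2 := by positivity
    linarith
  set Y := σ ^ (-((k:ℝ) + 2)) with hYd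
  have hY1 : 1 ≤ Y := Real.one_le_rpow_of_pos_of_le_one_of_nonpos hσ hσ1 (by linarith)
  have hY0 : 0 < Y := by linarith
  have hlogY : Real.log Y ≤ (k + 2) * L := by
    rw [hYd, Real.log_rpow hσ]
    have : (k + 2) * (-Real.log σ) ≤ (k + 2) * L := by gcongr
    linarith
  have hlogY0 : 0 ≤ Real.log Y := Real.log_nonneg hY1
  set t := ⌈L ^ 2⌉₊ with ht
  have ht1 : L ^ 2 ≤ t := Nat.le_ceil _
  have hL21 : 1 ≤ L ^ 2 := one_le_pow₀ p1
  have ht2 : (t:ℝ) ≤ 2 * L ^ 2 := by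
    have := (Nat.ceil_lt_add_one (by positivity : 0 ≤ L ^ 2)).le
    linarith
  have ht3 : 1 ≤ t := by
    have : (1:ℝ) ≤ t := hL21.trans ht1
    exact_mod_cast this
  obtain ⟨w1, w2, w3⟩ := HA g hg Y hY1
  set w := wProd g Y with hw
  have hAY : A * (1 + Real.log Y) ≤ A * (1 + (k + 2) * L) := by gcongr
  have hDs : (((Kp k C * (⌊Y⌋₊ + 1)) ^ t : ℕ):ℝ) ≤ s := by
    have hfl : ((⌊Y⌋₊ : ℝ) + 1) ≤ 2 * Y := by
      have := Nat.floor_le hY0.le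
      linarith
    push_cast
    calc ((Kp k C : ℝ) * (⌊Y⌋₊ + 1)) ^ t ≤ ((Kp k C : ℝ) * (2 * Y)) ^ t := by gcongr
      _ = Real.exp (t * (Real.log (2 * Kp k C) + Real.log Y)) := by
        rw [Real.exp_nat_mul, Real.exp_add, Real.exp_log (by positivity), Real.exp_log hY0]
        congr 1; ring
      _ ≤ s := by
        rw [hs]
        apply Real.exp_le_exp.mpr
        refine le_trans ?_ p2
        have : 0 ≤ Real.log (2 * Kp k C) := Real.log_nonneg (by linarith)
        gcongr
  have heps : epsB g Y t ≤ Real.exp (-L ^ 2) := by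
    unfold epsB
    rw [← Real.exp_add]
    apply Real.exp_le_exp.mpr
    linarith
  have hsε : 1 / s ≤ Real.exp (-L ^ 2) := by
    rw [hs, one_div, ← Real.exp_neg]
    apply Real.exp_le_exp.mpr
    have : 0 ≤ Real.log (Cw * C + 2 * C) := Real.log_nonneg (by linarith)
    linarith
  have hσw : Real.exp (-(L ^ 2 / 2)) ≤ σ * w := by
    have a1 : Real.exp (-L) ≤ σ := by
      rw [← Real.le_log_iff_exp_le hσ]; linarith
    calc Real.exp (-(L ^ 2 / 2)) ≤ Real.exp (-L + -(A * (1 + Real.log Y))) := by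
          apply Real.exp_le_exp.mpr; linarith
      _ = Real.exp (-L) * Real.exp (-(A * (1 + Real.log Y))) := Real.exp_add _ _
      _ ≤ σ * w := by gcongr
  have hw0 : 0 ≤ w := le_trans (Real.exp_pos _).le w2
  have hb0 : (0:ℝ) < g.leadingCoeff := by exact_mod_cast hg.2.1
  obtain ⟨m1, m2⟩ := M_facts hNpos.le hb0 hk
  have hlc' : (g.leadingCoeff:ℝ) ≤ C * s ^ (16 * k * Cw) := by
    refine hlc.trans (le_of_eq ?_)
    congr 1
    rw [hNs, one_div]
    exact Real.pow_rpow_inv_natCast (by positivity) (by omega)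
  have HE : ∀ g : Polynomial ℤ, Good k C g → ∀ σ : ℝ, 0 < σ → σ ≤ 1 → ∀ q : ℕ, 0 < q →
      κ / σ ^ (k + 1) < q → ∀ A : ℕ → ℤ, (∀ p ∈ q.primeFactors, ¬ (p:ℤ) ∣ A p) →
      ∏ p ∈ q.primeFactors, ell g (σ ^ (-((k:ℝ) + 2))) p (A p) (q.factorization p) ≤ r' * σ := by
    intro g hg σ hσ hσ1 q hq hlt
    refine HE0 g hg σ hσ hσ1 q hq (lt_of_le_of_lt ?_ hlt)
    gcongr
    exact le_max_left _ _
  have main := core_alg hk hC hCw HW hκ hr'0.le HE hg (s := s) (by linarith) (by linarith) (by linarith) hNs hlc' hσ hσ1 ht3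
    (sizeOK hk hC hg hY0.le t) hDs heps hsε hw0 w3 m1 m2 hγ
  refine main.trans ?_
  have f1 : K * r' = rr / 4 := by rw [hr']; field_simp
  have f2 : 1 / κ ≤ rr / 4 := by
    calc 1 / κ ≤ 1 / (4 / rr) := one_div_le_one_div_of_le (by positivity) (le_max_right _ _)
      _ = rr / 4 := by rw [one_div_div]
  have f3 : 200 * K ^ 2 * Real.exp (-L ^ 2) ≤ rr / 2 * (σ * w) := by
    have : Real.exp (-L ^ 2) = Real.exp (-(L ^ 2 / 2)) * Real.exp (-(L ^ 2 / 2)) := by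
      rw [← Real.exp_add]; congr 1; ring
    rw [this, ← mul_assoc]
    gcongr
  have f4 : (K * r' + 1 / κ) * (σ * w * N) ≤ (rr / 4 + rr / 4) * (σ * w * N) := by
    rw [f1]; gcongr
  have f5 : 200 * K ^ 2 * Real.exp (-L ^ 2) * N ≤ rr / 2 * (σ * w) * N := by gcongr
  calc _ ≤ (rr / 4 + rr / 4) * (σ * w * N) + rr / 2 * (σ * w) * N := add_le_add f4 f5
    _ = _ := by ring

open Polynomial in
theorem uniq_fac {K : Type*} [Field K] (z : K) (m n : ℕ) (Q V : K[X]) (hQ : Q.eval z ≠ 0) (hV : V.eval z ≠ 0)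
    (hh : (X - C z) ^ m * Q = (X - C z) ^ n * V) : Q = V := by
  have hX : (X - C z : K[X]) ≠ 0 := X_sub_C_ne_zero z
  rcases lt_trichotomy m n with h | h | h
  · exfalso; apply hQ
    have : Q = (X - C z) ^ (n - m) * V := by
      apply mul_left_cancel₀ (pow_ne_zero m hX)
      rw [hh, ← mul_assoc, ← pow_add]; congr 2; omega
    rw [this]; simp [show n - m ≠ 0 by omega]
  · subst h; exact mul_left_cancel₀ (pow_ne_zero m hX) hh
  · exfalso; apply hV
    have : V = (X - C z) ^ (m - n) * Q := by
      apply mul_left_cancel₀ (pow_ne_zero n hX)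
      rw [← hh, ← mul_assoc, ← pow_add]; congr 2; omega
    rw [this]; simp [show m - n ≠ 0 by omega]

open Polynomial in
theorem int_norm (W : ℚ[X]) : ∃ c : ℕ, 1 ≤ c ∧ ∃ w : ℤ[X], w.map (algebraMap ℤ ℚ) = C (c:ℚ) * W := by
  obtain ⟨b, hb, hs⟩ := IsLocalization.integerNormalization_spec (nonZeroDivisors ℤ) W
  have hb0 : b ≠ 0 := nonZeroDivisors.ne_zero hb
  refine ⟨b.natAbs, Int.natAbs_pos.2 hb0, C b.sign * IsLocalization.integerNormalization (nonZeroDivisors ℤ) W, ?_⟩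
  have h1 : (IsLocalization.integerNormalization (nonZeroDivisors ℤ) W).map (algebraMap ℤ ℚ) = C (b:ℚ) * W := by
    ext i
    rw [hs]; simp
  rw [Polynomial.map_mul, h1, ← mul_assoc, map_C, ← C_mul]
  congr 2
  have : ((b.sign * b : ℤ):ℚ) = ((b.natAbs:ℤ):ℚ) := by rw [Int.sign_mul_self, Int.natCast_natAbs]
  rw [Int.cast_mul] at this
  exact this

open Polynomial in
theorem per_factor (h P : ℚ[X]) (h0 : h ≠ 0) (hP : Irreducible P) (hd : P ∣ h) :
    ∃ c : ℕ, 1 ≤ c ∧ ∃ w : ℤ[X], ∀ (K : Type) [Field K] [CharZero K] (z : K), aeval z P = 0 →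
      ∃ (m : ℕ) (V : K[X]), h.map (algebraMap ℚ K) = (X - C z) ^ m * V ∧ V.eval z * aeval z w = c := by
  obtain ⟨R, hR, hnd⟩ := (FiniteMultiplicity.of_not_isUnit hP.not_isUnit h0).exists_eq_pow_mul_and_not_dvd
  set n := multiplicity P h with hn
  have hn1 : 1 ≤ n := by
    rcases Nat.eq_zero_or_pos n with h' | h'
    · rw [h', pow_zero, one_mul] at hR; exact absurd (hR ▸ hd) hnd
    · exact h'
  have hcop : IsCoprime P (derivative P * R) :=
    IsCoprime.mul_right hP.separable ((Irreducible.coprime_iff_not_dvd hP).2 hnd)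
  obtain ⟨A, B, hAB⟩ := hcop
  obtain ⟨c, hc, w, hw⟩ := int_norm (B ^ n * R ^ (n - 1))
  refine ⟨c, hc, w, ?_⟩
  intro K _ _ z hz
  obtain ⟨P1, hP1⟩ : (X - C z) ∣ P.map (algebraMap ℚ K) := by
    rw [dvd_iff_isRoot, IsRoot, eval_map_algebraMap]; exact hz
  refine ⟨n, P1 ^ n * R.map (algebraMap ℚ K), ?_, ?_⟩
  · conv_lhs => rw [hR]
    rw [Polynomial.map_mul, Polynomial.map_pow, hP1, mul_pow, mul_assoc]
  · have h1 : P1.eval z = aeval z (derivative P) := by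
      rw [← eval_map_algebraMap, ← derivative_map, hP1]; simp
    have h2 : aeval z B * (aeval z (derivative P) * aeval z R) = 1 := by
      have := congrArg (aeval z) hAB
      simpa [hz] using this
    have h3 : aeval z w = (c:K) * (aeval z B ^ n * aeval z R ^ (n - 1)) := by
      have := congrArg (aeval z) hw
      rw [aeval_map_algebraMap] at this
      rw [this]; simp
    rw [h3, eval_mul, eval_pow, h1, eval_map_algebraMap]
    have h4 : aeval z R * aeval z R ^ (n-1) = aeval z R ^ n := by rw [← pow_succ']; congr 1; omega
    calc _ = (c:K) * (aeval z (derivative P) ^ n * aeval z B ^ n * (aeval z R * aeval z R ^ (n-1))) := by ring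
      _ = c * (aeval z B * (aeval z (derivative P) * aeval z R)) ^ n := by rw [h4]; ring
      _ = c := by rw [h2]; simp

open Polynomial in
theorem alg_const (h : ℤ[X]) (h0 : h ≠ 0) : ∃ c : ℕ, 1 ≤ c ∧ ∀ (p : ℕ) [Fact p.Prime] (z : ℤ_[p]), aeval z h = 0 →
    ∃ Q : ℤ_[p][X], (X - C z) ^ (rootMultiplicity z (h.map (algebraMap ℤ ℤ_[p]))) * Q = h.map (algebraMap ℤ ℤ_[p]) ∧
      Q.eval z ∣ (c : ℤ_[p]) := by
  classical
  set hq := h.map (algebraMap ℤ ℚ) with hhq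
  have hq0 : hq ≠ 0 := (Polynomial.map_ne_zero_iff (algebraMap ℤ ℚ).injective_int).2 h0
  set F := (UniqueFactorizationMonoid.normalizedFactors hq).toFinset with hF
  have key : ∀ P ∈ F, ∃ c : ℕ, 1 ≤ c ∧ ∃ w : ℤ[X], ∀ (K : Type) [Field K] [CharZero K] (z : K), aeval z P = 0 →
      ∃ (m : ℕ) (V : K[X]), hq.map (algebraMap ℚ K) = (X - C z) ^ m * V ∧ V.eval z * aeval z w = c := by
    intro P hP
    rw [hF, Multiset.mem_toFinset] at hP
    exact per_factor hq P hq0 (UniqueFactorizationMonoid.irreducible_of_normalized_factor P hP)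
      (UniqueFactorizationMonoid.dvd_of_mem_normalizedFactors hP)
  choose! cc hcc ww hww using key
  refine ⟨∏ P ∈ F, cc P, Finset.one_le_prod' hcc, ?_⟩
  intro p _ z hz
  set hp := h.map (algebraMap ℤ ℤ_[p]) with hhp
  have hp0 : hp ≠ 0 := (Polynomial.map_ne_zero_iff (algebraMap ℤ ℤ_[p]).injective_int).2 h0
  refine ⟨hp /ₘ (X - C z) ^ rootMultiplicity z hp, pow_mul_divByMonic_rootMultiplicity_eq hp z, ?_⟩
  set Q := hp /ₘ (X - C z) ^ rootMultiplicity z hp with hQ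
  have hfac := pow_mul_divByMonic_rootMultiplicity_eq hp z
  have hQz : Q.eval z ≠ 0 := eval_divByMonic_pow_rootMultiplicity_ne_zero z hp0
  set φ := (PadicInt.Coe.ringHom (p := p)) with hφ
  have hinj : Function.Injective φ := Subtype.coe_injective
  -- the root as an element of Q_p
  have hz' : aeval (φ z) hq = 0 := by
    rw [hhq, aeval_map_algebraMap, aeval_def, eval₂_eq_eval_map]
    have : algebraMap ℤ ℚ_[p] = φ.comp (algebraMap ℤ ℤ_[p]) := RingHom.ext_int _ _
    rw [this, ← Polynomial.map_map, eval_map, eval₂_hom, ← eval₂_eq_eval_map, ← aeval_def, hz, map_zero]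
  obtain ⟨P, hPF, hPz⟩ : ∃ P ∈ F, aeval (φ z) P = 0 := by
    obtain ⟨u, hu⟩ := UniqueFactorizationMonoid.prod_normalizedFactors hq0
    rw [← hu, map_mul] at hz'
    have hu' : aeval (φ z) (u:ℚ[X]) ≠ 0 := ((u.isUnit).map (aeval (φ z))).ne_zero
    have := (mul_eq_zero.1 hz').resolve_right hu'
    rw [map_multiset_prod, Multiset.prod_eq_zero_iff, Multiset.mem_map] at this
    obtain ⟨P, h1, h2⟩ := this
    exact ⟨P, by rw [hF, Multiset.mem_toFinset]; exact h1, h2⟩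
  obtain ⟨m, V, hV, hVc⟩ := hww P hPF ℚ_[p] (φ z) hPz
  have hmap : hq.map (algebraMap ℚ ℚ_[p]) = hp.map φ := by
    rw [hhq, hhp, Polynomial.map_map, Polynomial.map_map]; congr 1
  have hQV : Q.map φ = V := by
    apply uniq_fac (φ z) (rootMultiplicity z hp) m
    · rw [eval_map, eval₂_hom]; intro h; exact hQz (hinj (by rw [h, map_zero]))
    · intro h
      rw [h, zero_mul] at hVc
      have := hcc P hPF
      have h2 : (cc P : ℚ_[p]) ≠ 0 := by exact_mod_cast (by omega : cc P ≠ 0)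
      exact h2 hVc.symm
    · rw [← hV, hmap]; conv_rhs => rw [← hfac]
      simp [Polynomial.map_mul, Polynomial.map_pow, hQ]
  refine dvd_trans ?_ (Nat.cast_dvd_cast (Finset.dvd_prod_of_mem cc hPF))
  refine ⟨aeval z (ww P), ?_⟩
  apply hinj
  rw [← hQV, eval_map, eval₂_hom] at hVc
  rw [map_mul, map_natCast, ← hVc]
  congr 1
  rw [aeval_def, aeval_def, hom_eval₂]
  congr 1

open Polynomial in
theorem local_good (h : ℤ[X]) (h0 : h ≠ 0) (c : ℕ) (p : ℕ) [Fact p.Prime] (z : ℤ_[p]) (hz : aeval z h = 0)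
    (Q : ℤ_[p][X])
    (hQ : (X - C z) ^ (rootMultiplicity z (h.map (algebraMap ℤ ℤ_[p]))) * Q = h.map (algebraMap ℤ ℤ_[p]))
    (hQc : Q.eval z ∣ (c : ℤ_[p])) (lam : ℕ → ℕ) (hlam1 : lam 1 = 1) (hlamMul : ∀ a b : ℕ, lam (a * b) = lam a * lam b)
    (hlamP : lam p = p ^ rootMultiplicity z (h.map (algebraMap ℤ ℤ_[p]))) (d : ℕ) (hd : 0 < d) (r : ℤ)
    (hrz : ∀ α : ℕ, p ^ α ∣ d → (p : ℤ_[p]) ^ α ∣ (z - (r : ℤ_[p]))) (H : ℤ[X])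
    (hH : C (lam d : ℤ) * H = h.comp (C r + C (d : ℤ) * X)) (j : ℕ) (K : ℤ)
    (hK : ∀ i, 1 ≤ i → (p:ℤ) ^ j ∣ K * H.coeff i) : (p:ℤ) ^ j ∣ K * c := by
  set hp := h.map (algebraMap ℤ ℤ_[p]) with hhp
  have hpp : p.Prime := Fact.out
  have hp0 : hp ≠ 0 := (Polynomial.map_ne_zero_iff (algebraMap ℤ ℤ_[p]).injective_int).2 h0
  set m := rootMultiplicity z hp with hm
  have hm1 : 1 ≤ m := by
    apply (rootMultiplicity_pos hp0).2
    rw [IsRoot, hhp, ← eval₂_eq_eval_map, ← aeval_def, hz]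
  obtain ⟨α, u, hu, hdu⟩ := Nat.exists_eq_pow_mul_and_not_dvd hd.ne' p hpp.ne_one
  obtain ⟨τ, hτ⟩ := hrz α (hdu ▸ Dvd.intro _ rfl)
  have hunit : IsUnit ((u : ℕ) : ℤ_[p]) := by
    rw [PadicInt.isUnit_iff]
    by_contra hne
    have hlt := lt_of_le_of_ne (PadicInt.norm_le_one _) hne
    have := PadicInt.norm_int_lt_one_iff_dvd (p := p) (u:ℤ)
    rw [Int.cast_natCast] at this
    exact hu (by exact_mod_cast this.1 hlt)
  obtain ⟨ν, hν⟩ := hunit.exists_right_inv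
  have hlampow : ∀ a : ℕ, lam (p ^ a) = p ^ (m * a) := by
    intro a
    induction a with
    | zero => simpa using hlam1
    | succ a ih => rw [pow_succ, hlamMul, ih, hlamP, ← pow_add]; congr 1
  have hlamd : lam d = p ^ (m * α) * lam u := by rw [hdu, hlamMul, hlampow]
  set Hp := H.map (algebraMap ℤ ℤ_[p]) with hHp
  set T : ℤ_[p][X] := C ν * (X + C τ) with hT
  have e1 : C ((lam d : ℕ) : ℤ_[p]) * Hp.comp T = X ^ m * C ((p:ℤ_[p]) ^ (m * α)) * Q.comp (C z + C ((p:ℤ_[p]) ^ α) * X) := by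
    have h1 := congrArg (fun f => (f.map (algebraMap ℤ ℤ_[p])).comp T) hH
    simp only [Polynomial.map_mul, Polynomial.map_comp, mul_comp, map_C, C_comp, Polynomial.map_add, map_X] at h1
    have h2 : (C ((algebraMap ℤ ℤ_[p]) r) + C ((algebraMap ℤ ℤ_[p]) (d:ℤ)) * X : ℤ_[p][X]).comp T = C z + C ((p:ℤ_[p]) ^ α) * X := by
      have h3 : (C ((algebraMap ℤ ℤ_[p]) r) : ℤ_[p][X]) = C z - C ((p:ℤ_[p]) ^ α) * C τ := by
        rw [← C_mul, ← C_sub]; congr 1; rw [← hτ]; simp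
      have h4 : (C ((algebraMap ℤ ℤ_[p]) (d:ℤ)) : ℤ_[p][X]) * C ν = C ((p:ℤ_[p]) ^ α) := by
        rw [← C_mul]; congr 1; rw [hdu]; simp [mul_assoc, hν]
      rw [h3, add_comp, mul_comp, sub_comp, mul_comp]
      simp only [C_comp, X_comp]
      rw [hT, ← mul_assoc, h4]; ring
    rw [comp_assoc, h2, ← hhp, ← hQ] at h1
    rw [show (algebraMap ℤ ℤ_[p]) ((lam d : ℕ):ℤ) = ((lam d : ℕ) : ℤ_[p]) by simp] at h1
    rw [hHp, h1]
    simp only [mul_comp, pow_comp, sub_comp, X_comp, C_comp, add_sub_cancel_left, mul_pow]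
    rw [show (C ((p:ℤ_[p]) ^ (m * α)) : ℤ_[p][X]) = C ((p:ℤ_[p]) ^ α) ^ m by rw [← C_pow, ← pow_mul, mul_comm]]; ring
  have hpne : ((p:ℤ_[p]) ^ (m * α)) ≠ 0 := pow_ne_zero _ (by exact_mod_cast hpp.ne_zero)
  have e2 : C ((lam u : ℕ) : ℤ_[p]) * Hp.comp T = X ^ m * Q.comp (C z + C ((p:ℤ_[p]) ^ α) * X) := by
    apply mul_left_cancel₀ (C_ne_zero.2 hpne)
    have : (C ((lam d : ℕ) : ℤ_[p]) : ℤ_[p][X]) = C ((p:ℤ_[p]) ^ (m * α)) * C ((lam u : ℕ) : ℤ_[p]) := by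
      rw [← C_mul, hlamd]; simp
    rw [← mul_assoc, ← this, e1]; ring
  have e3 : (X ^ m * Q.comp (C z + C ((p:ℤ_[p]) ^ α) * X)).coeff m = Q.eval z := by
    have h1 := coeff_X_pow_mul (Q.comp (C z + C ((p:ℤ_[p]) ^ α) * X)) m 0
    rw [zero_add] at h1
    rw [h1, coeff_zero_eq_eval_zero, eval_comp]; simp
  obtain ⟨G, hG⟩ : (C ((p:ℤ) ^ j)) ∣ C K * H - C (K * H.coeff 0) := by
    rw [C_dvd_iff_dvd_coeff]
    intro i
    rw [coeff_sub, coeff_C_mul, coeff_C]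
    split_ifs with hi
    · subst hi; simp
    · rw [sub_zero]; exact hK i (by omega)
  have e4 : (C (K:ℤ_[p]) * Hp.comp T) = C (((K * H.coeff 0 : ℤ)) : ℤ_[p]) + C ((p:ℤ_[p]) ^ j) * (G.map (algebraMap ℤ ℤ_[p])).comp T := by
    have h1 := congrArg (fun f => (f.map (algebraMap ℤ ℤ_[p])).comp T) hG
    simp only [Polynomial.map_mul, mul_comp, map_C, C_comp, Polynomial.map_sub, sub_comp] at h1
    rw [sub_eq_iff_eq_add'] at h1
    simpa [hHp] using h1
  have e5 : (p:ℤ_[p]) ^ j ∣ (K:ℤ_[p]) * Q.eval z := by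
    have h1 : (K:ℤ_[p]) * Q.eval z = ((lam u : ℕ) : ℤ_[p]) * (C (K:ℤ_[p]) * Hp.comp T).coeff m := by
      rw [← e3, ← e2, coeff_C_mul, coeff_C_mul]; ring
    rw [h1, e4, coeff_add, coeff_C, if_neg (by omega), zero_add, coeff_C_mul]
    exact Dvd.dvd.mul_left (Dvd.intro _ rfl) _
  have e6 : (p:ℤ_[p]) ^ j ∣ ((K * c : ℤ) : ℤ_[p]) := by
    refine e5.trans ?_
    rw [Int.cast_mul, Int.cast_natCast]
    exact mul_dvd_mul_left _ hQc
  exact (PadicInt.pow_p_dvd_int_iff j _).1 e6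

open Polynomial in
theorem lin_pow_coeff (r d : ℤ) (hr : |r| ≤ d) (j : ℕ) : ∀ i, |((C r + C d * X) ^ j : ℤ[X]).coeff i| ≤ (2 * d) ^ j := by
  have hd : 0 ≤ d := (abs_nonneg r).trans hr
  induction j with
  | zero => intro i; rw [pow_zero, coeff_one]; split_ifs <;> simp
  | succ j ih =>
    intro i
    have hpos : 0 ≤ (2 * d) ^ j := by positivity
    rw [pow_succ, mul_add, coeff_add, mul_comm _ (C r), coeff_C_mul, ← mul_assoc, mul_comm _ (C d), mul_assoc, coeff_C_mul]
    have h2 : |((C r + C d * X) ^ j * X : ℤ[X]).coeff i| ≤ (2 * d) ^ j := by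
      rcases i with _ | i
      · simpa using hpos
      · rw [coeff_mul_X]; exact ih i
    calc _ ≤ |r| * |((C r + C d * X) ^ j : ℤ[X]).coeff i| + |d| * |((C r + C d * X) ^ j * X : ℤ[X]).coeff i| := by
          rw [← abs_mul, ← abs_mul]; exact abs_add_le _ _
      _ ≤ d * (2 * d) ^ j + d * (2 * d) ^ j := by
          rw [abs_of_nonneg hd]
          exact add_le_add (mul_le_mul hr (ih i) (abs_nonneg _) hd) (mul_le_mul_of_nonneg_left h2 hd)
      _ = (2 * d) ^ (j + 1) := by ring

open Polynomial in
theorem comp_coeff (h : ℤ[X]) (r : ℤ) (d : ℕ) (hd : 1 ≤ d) (hr : |r| ≤ d) (i : ℕ) :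
    |(h.comp (C r + C (d:ℤ) * X)).coeff i| ≤ 2 ^ h.natDegree * (∑ j ∈ Finset.range (h.natDegree + 1), |h.coeff j|) * (d:ℤ) ^ h.natDegree := by
  rw [comp, eval₂_eq_sum_range, finsetSum_coeff]
  refine (Finset.abs_sum_le_sum_abs _ _).trans ?_
  rw [Finset.mul_sum, Finset.sum_mul]
  apply Finset.sum_le_sum
  intro j hj
  rw [coeff_C_mul, abs_mul]
  have h1 := lin_pow_coeff r d hr j i
  have hj' : j ≤ h.natDegree := by rw [Finset.mem_range] at hj; omega
  have hd1 : (1:ℤ) ≤ 2 * (d:ℤ) := by omega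
  have h2 : (2 * (d:ℤ)) ^ j ≤ (2 * (d:ℤ)) ^ h.natDegree := pow_le_pow_right₀ hd1 hj'
  calc _ ≤ |h.coeff j| * (2 * (d:ℤ)) ^ h.natDegree := mul_le_mul_of_nonneg_left (h1.trans h2) (abs_nonneg _)
    _ = _ := by ring

theorem lam_ge (lam : ℕ → ℕ) (hlam1 : lam 1 = 1) (hlamMul : ∀ a b : ℕ, lam (a * b) = lam a * lam b)
    (hp : ∀ p : ℕ, p.Prime → p ≤ lam p) (d : ℕ) : d ≤ lam d := by
  induction d using induction_on_primes with
  | zero => exact Nat.zero_le _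
  | one => exact hlam1.ge
  | prime_mul p a h ih => rw [hlamMul]; exact Nat.mul_le_mul (hp p h) ih

open Polynomial in
theorem good_H (k : ℕ) (hk : 0 < k) (h : ℤ[X]) (hdeg : h.natDegree = k) (hlead : 0 < h.leadingCoeff)
    (z : ∀ (p : ℕ) [Fact p.Prime], ℤ_[p])
    (hz : ∀ (p : ℕ) [Fact p.Prime], aeval (z p) h = 0)
    (lam : ℕ → ℕ) (hlam1 : lam 1 = 1)
    (hlamMul : ∀ a b : ℕ, lam (a * b) = lam a * lam b)
    (hlamP : ∀ (p : ℕ) [Fact p.Prime], lam p = p ^ rootMultiplicity (z p) (h.map (algebraMap ℤ ℤ_[p])))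
    (r : ℕ → ℤ) (hr : ∀ d : ℕ, 0 < d → -(d : ℤ) < r d ∧ r d ≤ 0)
    (hrz : ∀ d : ℕ, 0 < d → ∀ (p : ℕ) [Fact p.Prime], ∀ α : ℕ, p ^ α ∣ d → (p : ℤ_[p]) ^ α ∣ (z p - (r d : ℤ_[p])))
    (H : ℕ → ℤ[X])
    (hH : ∀ d : ℕ, 0 < d → C (lam d : ℤ) * H d = h.comp (C (r d) + C (d : ℤ) * X)) :
    ∃ C : ℕ, 1 ≤ C ∧ ∀ d : ℕ, 0 < d → Good k C (H d) ∧ (H d).leadingCoeff ≤ C * (d:ℤ) ^ (k - 1) := by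
  have h0 : h ≠ 0 := by rintro rfl; simp at hlead
  obtain ⟨c, hc, hcQ⟩ := alg_const h h0
  set S : ℕ := ∑ j ∈ Finset.range (k + 1), (h.coeff j).natAbs with hS
  set b := h.leadingCoeff with hb
  have hbS : b.natAbs ≤ S := by
    rw [hS]
    have : b.natAbs = (h.coeff k).natAbs := by rw [hb, leadingCoeff, hdeg]
    rw [this]
    exact Finset.single_le_sum (f := fun j => (h.coeff j).natAbs) (fun _ _ => Nat.zero_le _) (by simp)
  have hb1 : 1 ≤ b.natAbs := by omega
  have hS1 : 1 ≤ S := hb1.trans hbS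
  have h2k : 1 ≤ 2 ^ k := Nat.one_le_two_pow
  refine ⟨2 ^ k * S * c * b.natAbs, Nat.mul_pos (Nat.mul_pos (Nat.mul_pos h2k hS1) hc) hb1, ?_⟩
  intro d hd
  have hSZ : ((S:ℕ):ℤ) = ∑ j ∈ Finset.range (k + 1), |h.coeff j| := by
    rw [hS]; push_cast; rfl
  have hbZ : ((b.natAbs : ℕ):ℤ) = b := by omega
  have hlamge : ∀ p : ℕ, p.Prime → p ≤ lam p := by
    intro p hp
    have := Fact.mk hp
    rw [hlamP p]
    have hp0 : h.map (algebraMap ℤ ℤ_[p]) ≠ 0 := (Polynomial.map_ne_zero_iff (algebraMap ℤ ℤ_[p]).injective_int).2 h0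
    apply Nat.le_self_pow
    apply Nat.pos_iff_ne_zero.1
    apply (rootMultiplicity_pos hp0).2
    rw [IsRoot, ← eval₂_eq_eval_map, ← aeval_def, hz]
  have hld := lam_ge lam hlam1 hlamMul hlamge d
  have hlpos : 0 < lam d := by omega
  have hlposZ : (0:ℤ) < (lam d : ℤ) := by exact_mod_cast hlpos
  have hdZ : (1:ℤ) ≤ (d:ℤ) := by exact_mod_cast hd
  have hd0 : (d:ℤ) ≠ 0 := by omega
  have hHd := hH d hd
  have hL1 : (C (r d) + C (d:ℤ) * X : ℤ[X]).natDegree = 1 := by rw [add_comm]; exact natDegree_linear hd0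
  have hL2 : (C (r d) + C (d:ℤ) * X : ℤ[X]).leadingCoeff = d := by rw [add_comm]; exact leadingCoeff_linear hd0
  have hdegH : (H d).natDegree = k := by
    have := congrArg natDegree hHd
    rw [natDegree_C_mul hlposZ.ne', natDegree_comp, hL1, hdeg, mul_one] at this
    exact this
  have hleadH : (lam d : ℤ) * (H d).leadingCoeff = b * (d:ℤ) ^ k := by
    have := congrArg leadingCoeff hHd
    rw [leadingCoeff_mul, leadingCoeff_C, leadingCoeff_comp (by rw [hL1]; exact one_ne_zero), hL2, hdeg] at this
    exact this
  have hbd : 0 < (H d).leadingCoeff := by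
    have : 0 < (lam d : ℤ) * (H d).leadingCoeff := by rw [hleadH]; positivity
    exact pos_of_mul_pos_right this hlposZ.le
  have hcZ : (1:ℤ) ≤ (c:ℤ) := by exact_mod_cast hc
  have hSZ1 : (1:ℤ) ≤ (S:ℤ) := by exact_mod_cast hS1
  have h2kZ : (1:ℤ) ≤ (2:ℤ) ^ k := one_le_pow₀ (by norm_num)
  have hbZ1 : (1:ℤ) ≤ b := hlead
  have h2S : (1:ℤ) ≤ 2 ^ k * S := one_le_mul_of_one_le_of_one_le h2kZ hSZ1
  have h2Sc : (1:ℤ) ≤ 2 ^ k * S * c := one_le_mul_of_one_le_of_one_le h2S hcZ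
  refine ⟨⟨hdegH, hbd, ?_, ?_⟩, ?_⟩
  · intro i
    push_cast
    rw [abs_of_pos hlead]
    have hrd : |r d| ≤ d := by have := hr d hd; rw [abs_le]; omega
    have h1 := comp_coeff h (r d) d hd hrd i
    rw [hdeg, ← hSZ, ← hHd, coeff_C_mul, abs_mul, abs_of_pos hlposZ] at h1
    have h3 : (lam d : ℤ) * |(H d).coeff i| ≤ lam d * (2 ^ k * S * (H d).leadingCoeff) := by
      calc _ ≤ 2 ^ k * S * (d:ℤ) ^ k * 1 := by rw [mul_one]; exact h1
        _ ≤ 2 ^ k * S * (d:ℤ) ^ k * b := mul_le_mul_of_nonneg_left hbZ1 (by positivity)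
        _ = 2 ^ k * S * (lam d * (H d).leadingCoeff) := by rw [hleadH]; ring
        _ = _ := by ring
    have h4 := le_of_mul_le_mul_left h3 hlposZ
    refine h4.trans (mul_le_mul_of_nonneg_right ?_ hbd.le)
    calc (2:ℤ) ^ k * S = 2 ^ k * S * (1 * 1) := by ring
      _ ≤ 2 ^ k * S * (c * b) := mul_le_mul_of_nonneg_left (one_le_mul_of_one_le_of_one_le hcZ hbZ1) (by positivity)
      _ = _ := by ring
  · intro p hp j K hK
    have := Fact.mk hp
    obtain ⟨Q, hQ, hQc⟩ := hcQ p (z p) (hz p)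
    have := local_good h h0 c p (z p) (hz p) Q hQ hQc lam hlam1 hlamMul (hlamP p) d hd (r d) (hrz d hd p) (H d) hHd j K hK
    refine this.trans ⟨2 ^ k * S * b.natAbs, ?_⟩
    push_cast; ring
  · push_cast
    rw [abs_of_pos hlead]
    have h1 : (d:ℤ) * (H d).leadingCoeff ≤ d * (b * (d:ℤ) ^ (k - 1)) := by
      calc _ ≤ (lam d : ℤ) * (H d).leadingCoeff := mul_le_mul_of_nonneg_right (by exact_mod_cast hld) hbd.le
        _ = b * (d:ℤ) ^ ((k - 1) + 1) := by rw [hleadH]; congr 2; omega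
        _ = _ := by ring
    have h2 := le_of_mul_le_mul_left h1 (by omega : (0:ℤ) < d)
    refine h2.trans (mul_le_mul_of_nonneg_right ?_ (by positivity))
    calc b = 1 * b := (one_mul b).symm
      _ ≤ _ := mul_le_mul_of_nonneg_right h2Sc hlead.le

theorem rho_bound (k : ℕ) (hk : 0 < k) (N d : ℕ) (hN : 1 ≤ N)
    (hd : (d : ℝ) ≤ (N : ℝ) ^ ((1 : ℝ) / ((2 : ℝ) ^ (k + 2) * (k : ℝ) ^ 2))) :
    (d:ℝ) ^ (k - 1) ≤ (N:ℝ) ^ ((1:ℝ) / ((8 * k : ℕ):ℝ)) := by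
  have hN1 : (1:ℝ) ≤ N := by exact_mod_cast hN
  have hk0 : (0:ℝ) < k := by exact_mod_cast hk
  refine (pow_le_pow_left₀ (Nat.cast_nonneg d) hd (k - 1)).trans ?_
  rw [← Real.rpow_natCast, ← Real.rpow_mul (by linarith)]
  apply Real.rpow_le_rpow_of_exponent_le hN1
  have h1 : (8:ℝ) ≤ 2 ^ (k + 2) := by
    calc (8:ℝ) = 2 ^ 3 := by norm_num
      _ ≤ 2 ^ (k + 2) := pow_le_pow_right₀ (by norm_num) (by omega)
  have h2 : ((k - 1 : ℕ):ℝ) ≤ k := by exact_mod_cast Nat.sub_le k 1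
  push_cast
  calc 1 / ((2:ℝ) ^ (k + 2) * (k:ℝ) ^ 2) * ((k - 1 : ℕ):ℝ) ≤ 1 / ((2:ℝ) ^ (k + 2) * (k:ℝ) ^ 2) * k :=
        mul_le_mul_of_nonneg_left h2 (by positivity)
    _ = 1 / ((2:ℝ) ^ (k + 2) * k) := by field_simp
    _ ≤ 1 / (8 * k) := one_div_le_one_div_of_le (by positivity) (mul_le_mul_of_nonneg_right h1 hk0.le)

theorem sigma_ev : ∃ N₀ : ℕ, ∀ N : ℕ, N₀ ≤ N → ∀ σ : ℝ, 0 < σ →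
    Real.log N ^ (-(Real.log (Real.log (Real.log N)) / 4)) < σ → -Real.log σ ≤ (Real.log N) ^ ((1:ℝ) / 4) := by
  have t1 : Filter.Tendsto (fun N : ℕ => Real.log (Real.log (N:ℝ))) Filter.atTop Filter.atTop :=
    Real.tendsto_log_atTop.comp (Real.tendsto_log_atTop.comp tendsto_natCast_atTop_atTop)
  have t2 : Filter.Tendsto (fun N : ℕ => Real.log (N:ℝ)) Filter.atTop Filter.atTop :=
    Real.tendsto_log_atTop.comp tendsto_natCast_atTop_atTop
  obtain ⟨N₀, hN₀⟩ := Filter.eventually_atTop.1 ((t1.eventually_ge_atTop 384).and (t2.eventually_gt_atTop 0))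
  refine ⟨N₀, fun N hN σ hσ hs => ?_⟩
  obtain ⟨h1, h2⟩ := hN₀ N hN
  have h3 := Real.log_lt_log (Real.rpow_pos_of_pos h2 _) hs
  rw [Real.log_rpow h2] at h3
  rw [Real.rpow_def_of_pos h2]
  set l := Real.log (Real.log (N:ℝ)) with hl
  have h4 : Real.log l ≤ l := (Real.log_le_sub_one_of_pos (by linarith)).trans (by linarith)
  have h5 : (l * (1/4)) ^ 3 / 6 ≤ Real.exp (l * (1/4)) := by
    have := Real.pow_div_factorial_le_exp (l * (1/4)) (by linarith) 3
    simpa [Nat.factorial] using this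
  have h6 : Real.log l * l ≤ l * l := mul_le_mul_of_nonneg_right h4 (by linarith)
  have h7 : 384 * (l * l) ≤ l * (l * l) := mul_le_mul_of_nonneg_right h1 (by nlinarith)
  have h8 : (l * (1/4)) ^ 3 / 6 = l * (l * l) / 384 := by ring
  have h9 : 0 ≤ l * l := mul_self_nonneg l
  linarith

open scoped Classical in
/-- Lemma 4.6: minor-arc bound for the sieved Weyl sum attached to `h_d`: for `γ` in the
minor arcs `𝔪(N, κ/σ, κ/σ^{k+1})` (and `σ` not too small) one has
`|∑_{1 ≤ m ≤ M, m ∈ W_d(Y)} h_d′(m)·e(h_d(m)γ)| ≤ r·σ·w_d(Y)·N`. -/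
theorem stmt12
    (k : ℕ) (hk : 0 < k)
    (h : Polynomial ℤ) (hdeg : h.natDegree = k) (hlead : 0 < h.leadingCoeff)
    (hint : ∀ q : ℕ, 0 < q → ∃ n : ℤ, (q : ℤ) ∣ h.eval n)
    (z : ∀ (p : ℕ) [Fact p.Prime], ℤ_[p])
    (hz : ∀ (p : ℕ) [Fact p.Prime], Polynomial.aeval (z p) h = 0)
    (lam : ℕ → ℕ) (hlam1 : lam 1 = 1)
    (hlamMul : ∀ a b : ℕ, lam (a * b) = lam a * lam b)
    (hlamP : ∀ (p : ℕ) [Fact p.Prime],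
      lam p = p ^ Polynomial.rootMultiplicity (z p) (h.map (algebraMap ℤ ℤ_[p])))
    (r : ℕ → ℤ)
    (hr : ∀ d : ℕ, 0 < d → -(d : ℤ) < r d ∧ r d ≤ 0)
    (hrz : ∀ d : ℕ, 0 < d → ∀ (p : ℕ) [Fact p.Prime], ∀ α : ℕ, p ^ α ∣ d →
      (p : ℤ_[p]) ^ α ∣ (z p - (r d : ℤ_[p])))
    (H : ℕ → Polynomial ℤ)
    (hH : ∀ d : ℕ, 0 < d →
      Polynomial.C (lam d : ℤ) * H d =
        h.comp (Polynomial.C (r d) + Polynomial.C (d : ℤ) * Polynomial.X))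
    (rr : ℝ) (hrr : 0 < rr) :
    ∃ κ : ℝ, 0 < κ ∧ ∃ N₀ : ℕ, ∀ N : ℕ, N₀ ≤ N → ∀ d : ℕ, 0 < d →
      (d : ℝ) ≤ (N : ℝ) ^ ((1 : ℝ) / ((2 : ℝ) ^ (k + 2) * (k : ℝ) ^ 2)) →
      ∀ σ : ℝ, 0 < σ → σ ≤ 1 →
        Real.log N ^ (-(Real.log (Real.log (Real.log N)) / 4)) < σ →
        ∀ γ ∈ minorArcs N (κ / σ) (κ / σ ^ (k + 1)),
          ‖∑ m ∈ (Finset.Icc 1 ⌊((N : ℝ) / ((H d).leadingCoeff : ℝ)) ^ ((1 : ℝ) / k)⌋₊).filter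
              (fun m => (m : ℤ) ∈ WSet (H d) (σ ^ (-((k : ℝ) + 2)))),
              ((((Polynomial.derivative (H d)).eval (m : ℤ) : ℤ) : ℝ) : ℂ) *
                e ((((H d).eval (m : ℤ) : ℤ) : ℝ) * γ)‖ ≤
            rr * σ * wProd (H d) (σ ^ (-((k : ℝ) + 2))) * N := by
  obtain ⟨C, hC, hgood⟩ := good_H k hk h hdeg hlead z hz lam hlam1 hlamMul hlamP r hr hrz H hH
  obtain ⟨κ, hκ, N1, hcore⟩ := core k C hk hC rr hrr
  obtain ⟨N2, hσ⟩ := sigma_ev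
  refine ⟨κ, hκ, max 1 (max N1 N2), ?_⟩
  intro N hN d hd hdN σ hσ0 hσ1 hσN γ hγ
  have hN1 : 1 ≤ N := (le_max_left _ _).trans hN
  have hNN1 : N1 ≤ N := (le_max_left _ _).trans ((le_max_right _ _).trans hN)
  have hNN2 : N2 ≤ N := (le_max_right _ _).trans ((le_max_right _ _).trans hN)
  obtain ⟨hg, hlc⟩ := hgood d hd
  have hlc' : ((H d).leadingCoeff:ℝ) ≤ C * (N:ℝ) ^ ((1:ℝ) / ((8 * k : ℕ):ℝ)) := by
    have h1 : ((H d).leadingCoeff:ℝ) ≤ C * (d:ℝ) ^ (k - 1) := by exact_mod_cast hlc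
    exact h1.trans (mul_le_mul_of_nonneg_left (rho_bound k hk N d hN1 hdN) (Nat.cast_nonneg C))
  have key := hcore N hNN1 (H d) hg hlc' σ hσ0 hσ1 (hσ N hNN2 σ hσ0 hσN) γ hγ
  refine le_trans (le_of_eq ?_) key
  congr 1
  rw [Finset.sum_filter]
  symm
  refine Finset.sum_bij (fun (m : ℕ) _ => (m:ℤ)) ?_ ?_ ?_ ?_
  · intro m hm
    simp only [Finset.bind_def, Finset.pure_def, Finset.mem_sup, Finset.mem_singleton]
    exact ⟨m, hm, rfl⟩
  · intro a _ b _ hab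
    exact_mod_cast hab
  · intro b hb
    simp only [Finset.bind_def, Finset.pure_def, Finset.mem_sup, Finset.mem_singleton] at hb
    obtain ⟨m, hm, hmb⟩ := hb
    exact ⟨m, hm, hmb.symm⟩
  · intro m _
    unfold indW FF
    rw [mul_comm γ]
    split_ifs <;> simp
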